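/- arXiv:1209.6258 — 3 statements merged into one kernel-verified Lean document; each statement's English description precedes it below -/
import Mathlib

section
/- Let Q be an affine monoid of *dimension d ≥ 1. Then Q = ⋂_{F facet of Q} Q_F, where the intersection is over all faces F of Q with *dim F = d−1, if and only if every family of holes gp(F) + q of Q satisfies *dim F = d−1. -/
open scoped Pointwise

/-- The lattice `ℤ^N`. -/
abbrev ZN (N : ℕ) : Type := Fin N → ℤ

/-- The subgroup of `ℤ^N` generated by a submonoid `Q`, i.e. `gp(Q)`. -/
def gp {N : ℕ} (Q : AddSubmonoid (ZN N)) : AddSubgroup (ZN N) :=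
  AddSubgroup.closure (Q : Set (ZN N))

/-- `F` is a face of the monoid `Q`. -/
def IsFace {N : ℕ} (Q F : AddSubmonoid (ZN N)) : Prop :=
  F ≤ Q ∧ ∀ a b : ZN N, a ∈ Q → b ∈ Q → (a + b ∈ F ↔ a ∈ F ∧ b ∈ F)

/-- The normalization (saturation) `sat(Q)` of `Q`:
all `q ∈ gp(Q)` such that `n • q ∈ Q` for some `n ≥ 1`. -/
def sat {N : ℕ} (Q : AddSubmonoid (ZN N)) : AddSubmonoid (ZN N) where
  carrier := {q | q ∈ gp Q ∧ ∃ n : ℕ, 1 ≤ n ∧ n • q ∈ Q}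
  zero_mem' := ⟨(gp Q).zero_mem, 1, le_refl 1, by simpa using Q.zero_mem⟩
  add_mem' := by
    rintro a b ⟨ha, n, hn, hna⟩ ⟨hb, m, hm, hmb⟩
    refine ⟨(gp Q).add_mem ha hb, n * m,
      Nat.one_le_iff_ne_zero.mpr (Nat.mul_ne_zero (by omega) (by omega)), ?_⟩
    have h1 : (n * m) • a ∈ Q := by
      rw [mul_comm, mul_smul]; exact AddSubmonoid.nsmul_mem Q hna m
    have h2 : (n * m) • b ∈ Q := by
      rw [mul_smul]; exact AddSubmonoid.nsmul_mem Q hmb n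
    rw [smul_add]; exact Q.add_mem h1 h2

/-- `Q` is contained in its normalization. -/
theorem le_sat {N : ℕ} (Q : AddSubmonoid (ZN N)) : Q ≤ sat Q := fun q hq =>
  ⟨AddSubgroup.subset_closure hq, 1, le_refl 1, by simpa using hq⟩

/-- The set of holes `sat(Q) ∖ Q`. -/
def holes {N : ℕ} (Q : AddSubmonoid (ZN N)) : Set (ZN N) :=
  (sat Q : Set (ZN N)) \ (Q : Set (ZN N))

/-- The localization `Q_F = {q - f : q ∈ Q, f ∈ F}`. -/
def loc {N : ℕ} (Q F : AddSubmonoid (ZN N)) : AddSubmonoid (ZN N) where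
  carrier := {x | ∃ q ∈ Q, ∃ f ∈ F, x = q - f}
  zero_mem' := ⟨0, Q.zero_mem, 0, F.zero_mem, by simp⟩
  add_mem' := by
    rintro a b ⟨q, hq, f, hf, rfl⟩ ⟨q', hq', f', hf', rfl⟩
    exact ⟨q + q', Q.add_mem hq hq', f + f', F.add_mem hf hf', by ring⟩

/-- `F` is a maximal face (w.r.t. inclusion) among the faces `G` of `Q` with
`G + m ⊆ D`. -/
def IsMaxFaceFor {N : ℕ} (Q : AddSubmonoid (ZN N)) (D : Set (ZN N))
    (F : AddSubmonoid (ZN N)) (m : ZN N) : Prop :=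
  IsFace Q F ∧ (∀ f ∈ F, f + m ∈ D) ∧
    ∀ G : AddSubmonoid (ZN N), IsFace Q G → (∀ g ∈ G, g + m ∈ D) → F ≤ G → G = F

/-- `gp(F) + q` is a family of holes of `Q` (with the face `F` and base point `q`). -/
def IsFamilyOfHolesWith {N : ℕ} (Q F : AddSubmonoid (ZN N)) (q : ZN N) : Prop :=
  q ∈ holes Q ∧ IsMaxFaceFor Q (holes Q) F q

/-- `S ⊆ gp(Q)` is a family of holes of `Q`. -/
def IsFamilyOfHoles {N : ℕ} (Q : AddSubmonoid (ZN N)) (S : Set (ZN N)) : Prop :=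
  ∃ (q : ZN N) (F : AddSubmonoid (ZN N)), IsFamilyOfHolesWith Q F q ∧
    S = (fun f => f + q) '' (gp F : Set (ZN N))

/-- `M ⊆ gp(Q)` is a `Q`-module. -/
def IsQModule {N : ℕ} (Q : AddSubmonoid (ZN N)) (M : Set (ZN N)) : Prop :=
  M ⊆ (gp Q : Set (ZN N)) ∧ ∀ q ∈ Q, ∀ m ∈ M, q + m ∈ M

/-- `M` is a finitely generated `Q`-module: a finite union of translates of `Q`. -/
def IsFGQModule {N : ℕ} (Q : AddSubmonoid (ZN N)) (M : Set (ZN N)) : Prop :=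
  IsQModule Q M ∧ ∃ s : Finset (ZN N), ↑s ⊆ M ∧
    M = ⋃ m ∈ s, {x | ∃ q ∈ Q, x = m + q}

/-- The rank of a subgroup of `ℤ^N`. -/
noncomputable def rk {N : ℕ} (A : AddSubgroup (ZN N)) : ℕ :=
  Module.finrank ℤ (AddSubgroup.toIntSubmodule A)

/-- The face `F₀` of units of `Q`. -/
def unitsFace {N : ℕ} (Q : AddSubmonoid (ZN N)) : AddSubmonoid (ZN N) where
  carrier := {q | q ∈ Q ∧ -q ∈ Q}
  zero_mem' := ⟨Q.zero_mem, by simpa using Q.zero_mem⟩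
  add_mem' := by
    rintro a b ⟨ha, ha'⟩ ⟨hb, hb'⟩
    exact ⟨Q.add_mem ha hb, by rw [neg_add]; exact Q.add_mem ha' hb'⟩

/-- The *dimension of a face `F` of `Q`: `rank gp(F) - rank gp(F₀)`. -/
noncomputable def sdim {N : ℕ} (Q F : AddSubmonoid (ZN N)) : ℕ :=
  rk (gp F) - rk (gp (unitsFace Q))

/-- The *dimension of `Q`: `rank gp(Q) - rank gp(F₀)`. -/
noncomputable def sdimQ {N : ℕ} (Q : AddSubmonoid (ZN N)) : ℕ :=
  rk (gp Q) - rk (gp (unitsFace Q))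

/-- `Q` is seminormal: `2q, 3q ∈ Q` implies `q ∈ Q` for `q ∈ gp(Q)`. -/
def Seminormal {N : ℕ} (Q : AddSubmonoid (ZN N)) : Prop :=
  ∀ q ∈ gp Q, (2 : ℕ) • q ∈ Q → (3 : ℕ) • q ∈ Q → q ∈ Q

/-- The canonical embedding `ℤ^N → ℚ^N`. -/
def toQ {N : ℕ} (x : ZN N) : Fin N → ℚ := fun i => (x i : ℚ)

/-- The `ℚ`-linear span of (the image in `ℚ^N` of) a submonoid `F` of `ℤ^N`. -/
def qspan {N : ℕ} (F : AddSubmonoid (ZN N)) : Submodule ℚ (Fin N → ℚ) :=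
  Submodule.span ℚ (toQ '' (F : Set (ZN N)))

/-- **Farkas' lemma** for finitely many vectors of a `ℚ`-vector space. -/
theorem exists_nonneg_combination_or_separating {ι V : Type*} [AddCommGroup V] [Module ℚ V]
    (s : Finset ι) : ∀ (v : ι → V) (x : V),
      (∃ c : ι → ℚ, (∀ i, 0 ≤ c i) ∧ ∑ i ∈ s, c i • v i = x) ∨
        ∃ l : V →ₗ[ℚ] ℚ, (∀ i ∈ s, 0 ≤ l (v i)) ∧ l x < 0 := by
  classical
  induction s using Finset.induction_on with
  | empty =>
    intro v x
    by_cases hx : x = 0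
    · exact Or.inl ⟨0, by simp, by simp [hx]⟩
    · obtain ⟨l, hl, -⟩ := Submodule.exists_le_ker_of_notMem (K := ℚ) (p := ⊥) (v := x) (by simp [hx])
      rcases lt_or_gt_of_ne hl with h | h
      · exact Or.inr ⟨l, by simp, h⟩
      · exact Or.inr ⟨-l, by simp, by simpa using h⟩
  | insert a s ha ih =>
    intro v x
    rcases ih v x with ⟨c, hc, hx⟩ | ⟨l, hl, hlx⟩
    · refine Or.inl ⟨Function.update c a 0, fun i => ?_, ?_⟩
      · by_cases h : i = a <;> simp [h, hc]
      · rw [Finset.sum_insert ha, ← hx]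
        simp only [Function.update_self, zero_smul, zero_add]
        refine Finset.sum_congr rfl fun i hi => ?_
        rw [Function.update_of_ne (ne_of_mem_of_not_mem hi ha)]
    by_cases hla : 0 ≤ l (v a)
    · exact Or.inr ⟨l, by simpa [hla] using hl, hlx⟩
    push Not at hla
    let π : V →ₗ[ℚ] V := LinearMap.id - ((l (v a))⁻¹ • l).smulRight (v a)
    have hπ (y : V) : π y = y - ((l (v a))⁻¹ * l y) • v a := by simp [π]
    rcases ih (fun i => π (v i)) (π x) with ⟨c, hc, hx⟩ | ⟨m, hm, hmx⟩
    · have hsum : 0 ≤ ∑ i ∈ s, c i * l (v i) :=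
        Finset.sum_nonneg fun i hi => mul_nonneg (hc i) (hl i hi)
      let t : ℚ := (l (v a))⁻¹ * (l x - ∑ i ∈ s, c i * l (v i))
      refine Or.inl ⟨Function.update c a t, fun i => ?_, ?_⟩
      · by_cases h : i = a
        · subst h
          simpa using mul_nonneg_of_nonpos_of_nonpos (inv_nonpos.2 hla.le) (by linarith)
        · simp [h, hc]
      · rw [Finset.sum_insert ha]
        have h1 : ∑ i ∈ s, Function.update c a t i • v i = ∑ i ∈ s, c i • v i :=
          Finset.sum_congr rfl fun i hi => by
            rw [Function.update_of_ne (ne_of_mem_of_not_mem hi ha)]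
        rw [h1]
        have h2 : π (∑ i ∈ s, c i • v i) = π x := by simpa [map_sum] using hx
        rw [hπ, hπ] at h2
        have h3 : l (∑ i ∈ s, c i • v i) = ∑ i ∈ s, c i * l (v i) := by simp [map_sum]
        rw [h3] at h2
        rw [Function.update_self, eq_sub_iff_add_eq] at *
        rw [← h2]
        simp only [t]
        module
    · refine Or.inr ⟨m ∘ₗ π, fun i hi => ?_, hmx⟩
      rcases Finset.mem_insert.1 hi with rfl | hi
      · simp [hπ, inv_mul_cancel₀ hla.ne]
      · exact hm i hi

/-- `toQ` as a `ℤ`-linear map. -/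
def toQLinear (N : ℕ) : ZN N →ₗ[ℤ] (Fin N → ℚ) :=
  .pi fun i => Algebra.linearMap ℤ ℚ ∘ₗ .proj i

theorem toQ_zero {N : ℕ} : toQ (0 : ZN N) = 0 := map_zero (toQLinear N)

theorem toQ_add {N : ℕ} (x y : ZN N) : toQ (x + y) = toQ x + toQ y := map_add (toQLinear N) x y

theorem toQ_neg {N : ℕ} (x : ZN N) : toQ (-x) = -toQ x := map_neg (toQLinear N) x

theorem toQ_nsmul {N : ℕ} (n : ℕ) (x : ZN N) : toQ (n • x) = n • toQ x :=
  map_nsmul (toQLinear N) n x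

theorem toQ_zsmul {N : ℕ} (n : ℤ) (x : ZN N) : toQ (n • x) = n • toQ x :=
  map_zsmul (toQLinear N) n x

theorem toQ_injective {N : ℕ} : Function.Injective (toQ (N := N)) := fun x y h => by
  ext i
  simpa [toQ] using congrFun h i

theorem toQ_mem_qspan {N : ℕ} {F : AddSubmonoid (ZN N)} {x : ZN N} (hx : x ∈ gp F) :
    toQ x ∈ qspan F := by
  induction hx using AddSubgroup.closure_induction with
  | mem x hx => exact Submodule.subset_span ⟨x, hx, rfl⟩
  | zero => exact toQ_zero (N := N) ▸ (qspan F).zero_mem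
  | add x y _ _ hx hy => exact toQ_add x y ▸ add_mem hx hy
  | neg x _ hx => exact toQ_neg x ▸ neg_mem hx

theorem exists_nsmul_eq_toQ_of_mem_qspan {N : ℕ} {F : AddSubmonoid (ZN N)} {y : Fin N → ℚ}
    (hy : y ∈ qspan F) : ∃ n : ℕ, 1 ≤ n ∧ ∃ a ∈ gp F, n • y = toQ a := by
  induction hy using Submodule.span_induction with
  | mem y hy =>
    obtain ⟨x, hx, rfl⟩ := hy
    exact ⟨1, le_rfl, x, AddSubgroup.subset_closure hx, one_smul _ _⟩
  | zero => exact ⟨1, le_rfl, 0, zero_mem _, by simp [toQ_zero]⟩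
  | add x y _ _ hx hy =>
    obtain ⟨n, hn, a, ha, hna⟩ := hx
    obtain ⟨m, hm, b, hb, hmb⟩ := hy
    refine ⟨n * m, Nat.mul_pos hn hm, m • a + n • b,
      add_mem (nsmul_mem ha m) (nsmul_mem hb n), ?_⟩
    rw [toQ_add, toQ_nsmul, toQ_nsmul, ← hna, ← hmb]
    module
  | smul c x _ hx =>
    obtain ⟨n, hn, a, ha, hna⟩ := hx
    refine ⟨c.den * n, Nat.mul_pos c.den_pos hn, c.num • a, zsmul_mem ha _, ?_⟩
    rw [toQ_zsmul, ← hna, ← Nat.cast_smul_eq_nsmul ℚ, ← Nat.cast_smul_eq_nsmul ℚ,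
      ← Int.cast_smul_eq_zsmul ℚ, smul_smul, smul_smul]
    congr 1
    push_cast
    linear_combination (n : ℚ) * Rat.den_mul_eq_num c

theorem exists_nsmul_mem_gp {N : ℕ} {F : AddSubmonoid (ZN N)} {x : ZN N}
    (hx : toQ x ∈ qspan F) : ∃ n : ℕ, 1 ≤ n ∧ n • x ∈ gp F := by
  obtain ⟨n, hn, a, ha, h⟩ := exists_nsmul_eq_toQ_of_mem_qspan hx
  rw [← toQ_nsmul] at h
  exact ⟨n, hn, toQ_injective h ▸ ha⟩

theorem qspan_mono {N : ℕ} {F G : AddSubmonoid (ZN N)} (h : F ≤ G) : qspan F ≤ qspan G :=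
  Submodule.span_mono (Set.image_mono h)

theorem rk_gp_eq_finrank_qspan {N : ℕ} (F : AddSubmonoid (ZN N)) :
    rk (gp F) = Module.finrank ℚ (qspan F) := by
  have : IsLocalizedModule (nonZeroDivisors ℤ) (toQLinear N) :=
    inferInstanceAs (IsLocalizedModule _ (.pi fun i => Algebra.linearMap ℤ ℚ ∘ₗ .proj i))
  have hspan : qspan F =
      (AddSubgroup.toIntSubmodule (gp F)).localized' ℚ (nonZeroDivisors ℤ) (toQLinear N) := by
    rw [gp, AddSubgroup.toIntSubmodule_closure, Submodule.localized'_span]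
    rfl
  rw [hspan, rk]
  have h1 := IsLocalizedModule.finrank_eq (nonZeroDivisors ℤ)
    ((AddSubgroup.toIntSubmodule (gp F)).toLocalized' ℚ (nonZeroDivisors ℤ) (toQLinear N)) le_rfl
  rw [← h1]
  exact (IsLocalization.finrank_eq ℚ (nonZeroDivisors ℤ) (N := ((AddSubgroup.toIntSubmodule
    (gp F)).localized' ℚ (nonZeroDivisors ℤ) (toQLinear N))) le_rfl).symm

theorem rk_gp_mono {N : ℕ} {F G : AddSubmonoid (ZN N)} (h : F ≤ G) : rk (gp F) ≤ rk (gp G) := by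
  rw [rk_gp_eq_finrank_qspan, rk_gp_eq_finrank_qspan]
  exact Submodule.finrank_mono (qspan_mono h)

theorem mem_gp_iff {N : ℕ} {Q : AddSubmonoid (ZN N)} {x : ZN N} :
    x ∈ gp Q ↔ ∃ a ∈ Q, ∃ b ∈ Q, x = a - b := by
  refine ⟨fun hx => ?_, ?_⟩
  · induction hx using AddSubgroup.closure_induction with
    | mem x hx => exact ⟨x, hx, 0, zero_mem _, by simp⟩
    | zero => exact ⟨0, zero_mem _, 0, zero_mem _, by simp⟩
    | add x y _ _ hx hy =>
      obtain ⟨a, ha, b, hb, rfl⟩ := hx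
      obtain ⟨c, hc, d, hd, rfl⟩ := hy
      exact ⟨a + c, add_mem ha hc, b + d, add_mem hb hd, by abel⟩
    | neg x _ hx =>
      obtain ⟨a, ha, b, hb, rfl⟩ := hx
      exact ⟨b, hb, a, ha, by abel⟩
  · rintro ⟨a, ha, b, hb, rfl⟩
    exact sub_mem (AddSubgroup.subset_closure ha) (AddSubgroup.subset_closure hb)

namespace IsFace

variable {N : ℕ} {Q F G : AddSubmonoid (ZN N)}

theorem mem_of_nsmul_mem (hF : IsFace Q F) {x : ZN N} (hx : x ∈ Q) {n : ℕ} (hn : 1 ≤ n)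
    (h : n • x ∈ F) : x ∈ F := by
  obtain ⟨k, rfl⟩ := Nat.exists_eq_add_of_le' hn
  rw [succ_nsmul] at h
  exact ((hF.2 _ _ (nsmul_mem hx k) hx).1 h).2

theorem mem_of_toQ_mem_qspan (hF : IsFace Q F) {x : ZN N} (hx : x ∈ Q) (h : toQ x ∈ qspan F) :
    x ∈ F := by
  obtain ⟨n, hn, hmem⟩ := exists_nsmul_mem_gp h
  obtain ⟨a, ha, b, hb, hab⟩ := mem_gp_iff.1 hmem
  refine hF.mem_of_nsmul_mem hx hn ((hF.2 _ b (nsmul_mem hx n) (hF.1 hb)).1 ?_).1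
  rwa [hab, sub_add_cancel]

theorem rk_lt_of_lt (hF : IsFace Q F) (hG : IsFace Q G) (h : F < G) :
    rk (gp F) < rk (gp G) := by
  rw [rk_gp_eq_finrank_qspan, rk_gp_eq_finrank_qspan]
  obtain ⟨x, hxG, hxF⟩ := SetLike.exists_of_lt h
  refine Submodule.finrank_lt_finrank_of_lt ((qspan_mono h.le).lt_of_not_ge fun hle => hxF ?_)
  exact hF.mem_of_toQ_mem_qspan (hG.1 hxG) (hle (Submodule.subset_span ⟨x, hxG, rfl⟩))

theorem self (Q : AddSubmonoid (ZN N)) : IsFace Q Q :=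
  ⟨le_rfl, fun _ _ ha hb => ⟨fun _ => ⟨ha, hb⟩, fun _ => add_mem ha hb⟩⟩

theorem unitsFace (Q : AddSubmonoid (ZN N)) : IsFace Q (unitsFace Q) := by
  refine ⟨fun x hx => hx.1, fun a b ha hb => ⟨fun h => ⟨⟨ha, ?_⟩, ⟨hb, ?_⟩⟩,
    fun h => add_mem h.1 h.2⟩⟩
  · simpa using add_mem h.2 hb
  · simpa using add_mem h.2 ha

theorem unitsFace_le (hF : IsFace Q F) : _root_.unitsFace Q ≤ F := fun u hu =>
  ((hF.2 u (-u) hu.1 hu.2).1 (by simp)).1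

theorem sdim_eq_iff (hF : IsFace Q F) (hd : 1 ≤ sdimQ Q) :
    sdim Q F = sdimQ Q - 1 ↔ rk (gp F) + 1 = rk (gp Q) := by
  have := rk_gp_mono hF.unitsFace_le
  unfold sdim sdimQ at *
  omega

theorem inter_closure_eq {S : Set (ZN N)} (hS : AddSubmonoid.closure S = Q) (hF : IsFace Q F) :
    AddSubmonoid.closure (S ∩ F) = F := by
  refine le_antisymm (AddSubmonoid.closure_le.2 Set.inter_subset_right) fun x hxF => ?_
  have hx := hF.1 hxF
  rw [← hS] at hx
  induction hx using AddSubmonoid.closure_induction with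
  | mem x hx => exact AddSubmonoid.subset_closure ⟨hx, hxF⟩
  | zero => exact zero_mem _
  | add x y hx hy ihx ihy =>
    rw [hS] at hx hy
    obtain ⟨h1, h2⟩ := (hF.2 x y hx hy).1 hxF
    exact add_mem (ihx h1) (ihy h2)

theorem finite_setOf (hQ : Q.FG) : {F | IsFace Q F}.Finite := by
  obtain ⟨S, hS⟩ := hQ
  refine (S.finite_toSet.finite_subsets.image AddSubmonoid.closure).subset fun F hF => ?_
  exact ⟨S ∩ F, Set.inter_subset_left, inter_closure_eq hS hF⟩

end IsFace

theorem le_loc {N : ℕ} (Q F : AddSubmonoid (ZN N)) : Q ≤ loc Q F := fun q hq =>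
  ⟨q, hq, 0, zero_mem _, by simp⟩

theorem mem_loc_iff {N : ℕ} {Q F : AddSubmonoid (ZN N)} {x : ZN N} :
    x ∈ loc Q F ↔ ∃ f ∈ F, f + x ∈ Q := by
  constructor
  · rintro ⟨q, hq, f, hf, rfl⟩
    exact ⟨f, hf, by simpa⟩
  · rintro ⟨f, hf, h⟩
    exact ⟨f + x, h, f, hf, by abel⟩

theorem loc_le_gp {N : ℕ} {Q F : AddSubmonoid (ZN N)} (hF : F ≤ Q) {x : ZN N}
    (hx : x ∈ loc Q F) : x ∈ gp Q := by
  obtain ⟨q, hq, f, hf, rfl⟩ := hx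
  exact mem_gp_iff.2 ⟨q, hq, f, hF hf, rfl⟩

theorem forall_add_mem_holes_iff {N : ℕ} {Q F : AddSubmonoid (ZN N)} (hF : F ≤ Q) {q : ZN N}
    (hq : q ∈ sat Q) : (∀ f ∈ F, f + q ∈ holes Q) ↔ q ∉ loc Q F := by
  rw [mem_loc_iff]
  push Not
  exact forall₂_congr fun f hf => ⟨fun h => h.2, fun h => ⟨add_mem (le_sat Q (hF hf)) hq, h⟩⟩

/-- The smallest face of `Q` containing `G` and `f`. -/
def faceAdjoin {N : ℕ} (Q G : AddSubmonoid (ZN N)) (f : ZN N) : AddSubmonoid (ZN N) where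
  carrier := {x | x ∈ Q ∧ ∃ y ∈ Q, ∃ g ∈ G, ∃ n : ℕ, x + y = g + n • f}
  zero_mem' := ⟨zero_mem _, 0, zero_mem _, 0, zero_mem _, 0, by simp⟩
  add_mem' := by
    rintro a b ⟨ha, y, hy, g, hg, n, h⟩ ⟨hb, z, hz, k, hk, m, h'⟩
    refine ⟨add_mem ha hb, y + z, add_mem hy hz, g + k, add_mem hg hk, n + m, ?_⟩
    rw [add_add_add_comm, h, h', add_smul]
    abel

theorem isFace_faceAdjoin {N : ℕ} (Q G : AddSubmonoid (ZN N)) (f : ZN N) :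
    IsFace Q (faceAdjoin Q G f) := by
  refine ⟨fun x hx => hx.1, fun a b ha hb => ⟨?_, fun h => add_mem h.1 h.2⟩⟩
  rintro ⟨-, y, hy, g, hg, n, h⟩
  exact ⟨⟨ha, b + y, add_mem hb hy, g, hg, n, by rw [← h, add_assoc]⟩,
    ⟨hb, a + y, add_mem ha hy, g, hg, n, by rw [← h]; abel⟩⟩

theorem exists_nsmul_add_mem_loc {N : ℕ} {Q G : AddSubmonoid (ZN N)} (hG : IsFace Q G)
    (hrk : rk (gp G) + 1 = rk (gp Q)) {f : ZN N} (hf : f ∈ Q) (hfG : f ∉ G) {q : ZN N}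
    (hq : q ∈ gp Q) : ∃ n : ℕ, n • f + q ∈ loc Q G := by
  have hface := isFace_faceAdjoin Q G f
  have hlt : G < faceAdjoin Q G f := by
    refine lt_of_le_of_ne (fun g hg => ⟨hG.1 hg, 0, zero_mem _, g, hg, 0, by simp⟩) fun h => hfG ?_
    rw [h]
    exact ⟨hf, 0, zero_mem _, 0, zero_mem _, 1, by simp⟩
  have h1 := hG.rk_lt_of_lt hface hlt
  have htop : faceAdjoin Q G f = Q := by
    by_contra hne
    have := hface.rk_lt_of_lt (IsFace.self Q) (lt_of_le_of_ne hface.1 hne)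
    omega
  obtain ⟨a, ha, b, hb, rfl⟩ := mem_gp_iff.1 hq
  rw [← htop] at hb
  obtain ⟨-, y, hy, g, hg, n, h⟩ := hb
  refine ⟨n, mem_loc_iff.2 ⟨g, hg, ?_⟩⟩
  have : g + (n • f + (a - b)) = a + y := by rw [← add_assoc, ← h]; abel
  exact this ▸ add_mem ha hy

theorem mem_sat_of_nonneg_combination {N : ℕ} {Q : AddSubmonoid (ZN N)} {S : Finset (ZN N)}
    (hS : ∀ s ∈ S, s ∈ Q) {x : ZN N} (hx : x ∈ gp Q) {c : ZN N → ℚ} (hc : ∀ i, 0 ≤ c i)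
    (h : ∑ i ∈ S, c i • toQ i = toQ x) : x ∈ sat Q := by
  have key : ∃ n : ℕ, 1 ≤ n ∧ ∃ a ∈ Q, n • ∑ i ∈ S, c i • toQ i = toQ a := by
    refine Finset.sum_induction _ (fun y => ∃ n : ℕ, 1 ≤ n ∧ ∃ a ∈ Q, n • y = toQ a) ?_ ?_ ?_
    · rintro y z ⟨n, hn, a, ha, hna⟩ ⟨m, hm, b, hb, hmb⟩
      refine ⟨n * m, Nat.mul_pos hn hm, m • a + n • b,
        add_mem (nsmul_mem ha m) (nsmul_mem hb n), ?_⟩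
      rw [toQ_add, toQ_nsmul, toQ_nsmul, ← hna, ← hmb]
      module
    · exact ⟨1, le_rfl, 0, zero_mem _, by simp [toQ_zero]⟩
    · intro s hs
      refine ⟨(c s).den, (c s).den_pos, (c s).num.toNat • s, nsmul_mem (hS s hs) _, ?_⟩
      rw [toQ_nsmul, ← Nat.cast_smul_eq_nsmul ℚ, ← Nat.cast_smul_eq_nsmul ℚ, smul_smul,
        Rat.den_mul_eq_num]
      congr 1
      exact_mod_cast (Int.toNat_of_nonneg (Rat.num_nonneg.2 (hc s))).symm
  obtain ⟨n, hn, a, ha, hna⟩ := key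
  rw [h, ← toQ_nsmul] at hna
  exact ⟨hx, n, hn, toQ_injective hna ▸ ha⟩

theorem nonneg_of_mem_closure {N : ℕ} {S : Set (ZN N)} {l : (Fin N → ℚ) →ₗ[ℚ] ℚ}
    (hl : ∀ s ∈ S, 0 ≤ l (toQ s)) {x : ZN N} (hx : x ∈ AddSubmonoid.closure S) :
    0 ≤ l (toQ x) := by
  induction hx using AddSubmonoid.closure_induction with
  | mem x hx => exact hl x hx
  | zero => simp [toQ_zero]
  | add x y _ _ hx hy => rw [toQ_add, map_add]; exact add_nonneg hx hy

/-- The elements of `Q` on which the functional `l` vanishes. -/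
def zeroFace {N : ℕ} (Q : AddSubmonoid (ZN N)) (l : (Fin N → ℚ) →ₗ[ℚ] ℚ) :
    AddSubmonoid (ZN N) :=
  Q ⊓ (LinearMap.ker l).toAddSubmonoid.comap (toQLinear N).toAddMonoidHom

theorem mem_zeroFace {N : ℕ} {Q : AddSubmonoid (ZN N)} {l : (Fin N → ℚ) →ₗ[ℚ] ℚ} {x : ZN N} :
    x ∈ zeroFace Q l ↔ x ∈ Q ∧ l (toQ x) = 0 := Iff.rfl

theorem isFace_zeroFace {N : ℕ} {Q : AddSubmonoid (ZN N)} {l : (Fin N → ℚ) →ₗ[ℚ] ℚ}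
    (hl : ∀ x ∈ Q, 0 ≤ l (toQ x)) : IsFace Q (zeroFace Q l) := by
  refine ⟨inf_le_left, fun a b ha hb => ⟨fun h => ?_, fun h => add_mem h.1 h.2⟩⟩
  have h0 := (mem_zeroFace.1 h).2
  rw [toQ_add, map_add] at h0
  have h1 := hl a ha
  have h2 := hl b hb
  exact ⟨⟨ha, by change l (toQ a) = 0; linarith⟩, ⟨hb, by change l (toQ b) = 0; linarith⟩⟩

/-- If `l` is nonnegative on `S`, `m` is negative somewhere on `S` and vanishes on the zeros of `l`
in `S`, then some translate of `l` along `m` is nonnegative on `S` with more zeros than `l`. -/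
theorem exists_translate_more_zeros {V : Type*} [AddCommGroup V] [Module ℚ V] {ι : Type*}
    (S : Finset ι) (v : ι → V) (l m : V →ₗ[ℚ] ℚ) (hl : ∀ s ∈ S, 0 ≤ l (v s))
    (hlm : ∀ s ∈ S, l (v s) = 0 → m (v s) = 0) (hm : ∃ s ∈ S, m (v s) < 0) :
    ∃ t : ℚ, (∀ s ∈ S, 0 ≤ (l + t • m) (v s)) ∧
      (S.filter fun s => (l + t • m) (v s) ≠ 0) ⊂ S.filter fun s => l (v s) ≠ 0 := by
  obtain ⟨s, hs, hms⟩ := hm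
  obtain ⟨g, hg, hmin⟩ := (S.filter fun s => m (v s) < 0).exists_min_image
    (fun s => l (v s) / -m (v s)) ⟨s, by simp [hs, hms]⟩
  rw [Finset.mem_filter] at hg
  have ht : 0 ≤ l (v g) / -m (v g) := div_nonneg (hl g hg.1) (by linarith [hg.2])
  refine ⟨l (v g) / -m (v g), fun s hs => ?_, ?_⟩
  · rw [LinearMap.add_apply, LinearMap.smul_apply, smul_eq_mul]
    rcases lt_or_ge (m (v s)) 0 with h | h
    · have := hmin s (by simp [hs, h])
      rw [le_div_iff₀ (by linarith)] at this
      linarith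
    · exact add_nonneg (hl s hs) (mul_nonneg ht h)
  · refine (Finset.ssubset_iff_of_subset fun s hs => ?_).2 ⟨g, ?_, ?_⟩
    · rw [Finset.mem_filter] at hs ⊢
      refine ⟨hs.1, fun h => hs.2 ?_⟩
      simp [h, hlm s hs.1 h]
    · exact Finset.mem_filter.2 ⟨hg.1, fun h => hg.2.ne (hlm g hg.1 h)⟩
    · simp [div_neg, hg.2.ne]

/-- A point of `gp Q` outside the normalization is separated from it by a facet. -/
theorem exists_facet_notMem_loc {N : ℕ} {Q : AddSubmonoid (ZN N)} (hQ : Q.FG) {x : ZN N}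
    (hx : x ∈ gp Q) (hxs : x ∉ sat Q) :
    ∃ G, IsFace Q G ∧ rk (gp G) + 1 = rk (gp Q) ∧ x ∉ loc Q G := by
  obtain ⟨S, hS⟩ := hQ
  have hSQ : ∀ s ∈ S, s ∈ Q := fun s hs => hS ▸ AddSubmonoid.subset_closure hs
  have hsep : ∃ l : (Fin N → ℚ) →ₗ[ℚ] ℚ, (∀ s ∈ S, 0 ≤ l (toQ s)) ∧ l (toQ x) < 0 := by
    rcases exists_nonneg_combination_or_separating S toQ (toQ x) with ⟨c, hc, h⟩ | h
    · exact absurd (mem_sat_of_nonneg_combination hSQ hx hc h) hxs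
    · exact h
  obtain ⟨l, ⟨hl, hlx⟩, hmin⟩ := exists_minimalFor_of_wellFoundedLT
    (fun l : (Fin N → ℚ) →ₗ[ℚ] ℚ => (∀ s ∈ S, 0 ≤ l (toQ s)) ∧ l (toQ x) < 0)
    (fun l => (S.filter fun s => l (toQ s) ≠ 0).card) hsep
  have hlQ : ∀ y ∈ Q, 0 ≤ l (toQ y) := fun y hy => nonneg_of_mem_closure hl (hS.symm ▸ hy)
  have hface := isFace_zeroFace hlQ
  have hker : qspan (zeroFace Q l) ≤ LinearMap.ker l :=
    Submodule.span_le.2 (by rintro _ ⟨y, hy, rfl⟩; exact hy.2)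
  refine ⟨zeroFace Q l, hface, ?_, fun h => ?_⟩
  · have hlt : rk (gp (zeroFace Q l)) < rk (gp Q) := by
      refine hface.rk_lt_of_lt (IsFace.self Q) (lt_of_le_of_ne hface.1 fun h => hlx.ne ?_)
      rw [h] at hker
      exact hker (toQ_mem_qspan hx)
    by_contra hne
    have hW : Module.finrank ℚ ↥(qspan (zeroFace Q l) ⊔ ℚ ∙ toQ x) <
        Module.finrank ℚ (qspan Q) := by
      have h1 := Submodule.finrank_add_le_finrank_add_finrank (qspan (zeroFace Q l)) (ℚ ∙ toQ x)
      have h2 : Module.finrank ℚ (ℚ ∙ toQ x) ≤ 1 := by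
        simpa using finrank_span_le_card (R := ℚ) ({toQ x} : Set (Fin N → ℚ))
      rw [rk_gp_eq_finrank_qspan, rk_gp_eq_finrank_qspan] at hlt hne
      omega
    obtain ⟨s, hs, hsW⟩ : ∃ s ∈ S, toQ s ∉ qspan (zeroFace Q l) ⊔ ℚ ∙ toQ x := by
      by_contra! hall
      refine hW.not_ge (Submodule.finrank_mono (Submodule.span_le.2 ?_))
      rintro _ ⟨y, hy, rfl⟩
      rw [← hS] at hy
      exact (AddSubmonoid.closure_le (S := (qspan (zeroFace Q l) ⊔ ℚ ∙ toQ x).toAddSubmonoid.comap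
        (toQLinear N).toAddMonoidHom)).2 hall hy
    obtain ⟨m, hms, hmW⟩ : ∃ m : (Fin N → ℚ) →ₗ[ℚ] ℚ, m (toQ s) < 0 ∧
        qspan (zeroFace Q l) ⊔ ℚ ∙ toQ x ≤ LinearMap.ker m := by
      obtain ⟨m, hms, hmW⟩ := Submodule.exists_le_ker_of_notMem hsW
      rcases lt_or_gt_of_ne hms with h | h
      · exact ⟨m, h, hmW⟩
      · exact ⟨-m, by simpa using h, by simpa using hmW⟩
    obtain ⟨t, ht, hsub⟩ := exists_translate_more_zeros S toQ l m hl
      (fun y hy h => hmW (Submodule.mem_sup_left (Submodule.subset_span ⟨y, ⟨hSQ y hy, h⟩, rfl⟩)))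
      ⟨s, hs, hms⟩
    have hmx : m (toQ x) = 0 := hmW (Submodule.mem_sup_right (Submodule.mem_span_singleton_self _))
    have hcard := Finset.card_lt_card hsub
    exact hcard.not_ge (hmin ⟨ht, by simpa [hmx] using hlx⟩ hcard.le)
  · obtain ⟨f, hf, hfx⟩ := mem_loc_iff.1 h
    have h1 := hlQ _ hfx
    rw [toQ_add, map_add, (mem_zeroFace.1 hf).2] at h1
    linarith

theorem exists_facet {N : ℕ} {Q : AddSubmonoid (ZN N)} (hQ : Q.FG) (hd : 1 ≤ sdimQ Q) :
    ∃ G, IsFace Q G ∧ rk (gp G) + 1 = rk (gp Q) := by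
  obtain ⟨q, hq, hqu⟩ : ∃ q ∈ Q, q ∉ unitsFace Q := by
    by_contra! h
    have := rk_gp_mono h
    unfold sdimQ at hd
    omega
  obtain ⟨G, hG, hrk, -⟩ := exists_facet_notMem_loc hQ
    (neg_mem (AddSubgroup.subset_closure hq) : -q ∈ gp Q) fun ⟨_, n, hn, hmem⟩ =>
      hqu ((IsFace.unitsFace Q).mem_of_nsmul_mem hq hn
        ⟨nsmul_mem hq n, by rwa [← smul_neg]⟩)
  exact ⟨G, hG, hrk⟩

theorem exists_isMaxFaceFor_holes {N : ℕ} {Q : AddSubmonoid (ZN N)} (hQ : Q.FG) {q : ZN N}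
    (hq : q ∈ holes Q) : ∃ F, IsMaxFaceFor Q (holes Q) F q := by
  obtain ⟨F, hF⟩ := ((IsFace.finite_setOf hQ).subset
    (fun F hF => hF.1 : {F | IsFace Q F ∧ ∀ f ∈ F, f + q ∈ holes Q} ⊆ _)).exists_maximal
    ⟨unitsFace Q, IsFace.unitsFace Q,
      (forall_add_mem_holes_iff (IsFace.unitsFace Q).1 hq.1).2 fun h => by
        obtain ⟨f, hf, hfq⟩ := mem_loc_iff.1 h
        exact hq.2 (by simpa using add_mem hf.2 hfq)⟩
  exact ⟨F, hF.1.1, hF.1.2, fun G hG hGq hle => le_antisymm (hF.2 ⟨hG, hGq⟩ hle) hle⟩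

theorem exists_mem_forall_add_mem_loc {N : ℕ} {Q F : AddSubmonoid (ZN N)} (hF : F ≤ Q) {q : ZN N}
    {T : Set (AddSubmonoid (ZN N))} (hT : T.Finite)
    (h : ∀ G ∈ T, ∃ f ∈ F, f + q ∈ loc Q G) : ∃ f ∈ F, ∀ G ∈ T, f + q ∈ loc Q G := by
  induction T, hT using Set.Finite.induction_on with
  | empty => exact ⟨0, zero_mem _, by simp⟩
  | @insert G T _ _ ih =>
    obtain ⟨f, hf, hfT⟩ := ih fun H hH => h H (Set.mem_insert_of_mem _ hH)
    obtain ⟨g, hg, hgG⟩ := h G (Set.mem_insert _ _)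
    refine ⟨f + g, add_mem hf hg, ?_⟩
    rintro H (rfl | hH)
    · rw [add_assoc]
      exact add_mem (le_loc Q _ (hF hf)) hgG
    · rw [add_comm f, add_assoc]
      exact add_mem (le_loc Q _ (hF hg)) (hfT H hH)

/-- `Q` is the intersection of its localizations at the facets iff every
family of holes of `Q` has *dimension `d - 1`. -/
theorem eq_inter_facet_loc_iff {N : ℕ} (Q : AddSubmonoid (ZN N)) (hQ : Q.FG)
    (hd : 1 ≤ sdimQ Q) :
    ((Q : Set (ZN N)) =
      ⋂ F ∈ {F : AddSubmonoid (ZN N) | IsFace Q F ∧ sdim Q F = sdimQ Q - 1},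
        (loc Q F : Set (ZN N))) ↔
      ∀ (q : ZN N) (F : AddSubmonoid (ZN N)),
        IsFamilyOfHolesWith Q F q → sdim Q F = sdimQ Q - 1 := by
  have hmem (x : ZN N) : (x ∈ ⋂ F ∈ {F : AddSubmonoid (ZN N) | IsFace Q F ∧
      sdim Q F = sdimQ Q - 1}, (loc Q F : Set (ZN N))) ↔
        ∀ G, IsFace Q G → rk (gp G) + 1 = rk (gp Q) → x ∈ loc Q G := by
    simp only [Set.mem_iInter, Set.mem_ofPred_eq, SetLike.mem_coe, and_imp]
    exact forall₂_congr fun G hG => by rw [hG.sdim_eq_iff hd]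
  constructor
  · rintro heq q F ⟨hq, hF, hFq, hmax⟩
    rw [hF.sdim_eq_iff hd]
    obtain ⟨f, hf, hfT⟩ := exists_mem_forall_add_mem_loc hF.1 (q := q)
      (T := {G | IsFace Q G ∧ rk (gp G) + 1 = rk (gp Q) ∧ ¬ F ≤ G})
      ((IsFace.finite_setOf hQ).subset fun G hG => hG.1) <| by
        rintro G ⟨hG, hrk, hFG⟩
        obtain ⟨f, hf, hfG⟩ := SetLike.not_le_iff_exists.1 hFG
        obtain ⟨n, hn⟩ := exists_nsmul_add_mem_loc hG hrk (hF.1 hf) hfG hq.1.1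
        exact ⟨n • f, nsmul_mem hf n, hn⟩
    have hnot : f + q ∉ (Q : Set (ZN N)) := (hFq f hf).2
    rw [heq, hmem] at hnot
    push Not at hnot
    obtain ⟨G, hG, hrk, hGq⟩ := hnot
    have hFG : F ≤ G := by
      by_contra h
      exact hGq (hfT G ⟨hG, hrk, h⟩)
    have hGholes := (forall_add_mem_holes_iff hG.1 hq.1).2 fun h =>
      hGq (add_mem (le_loc Q G (hF.1 hf)) h)
    exact hmax G hG hGholes hFG ▸ hrk
  · intro hfam
    ext x
    rw [hmem]
    refine ⟨fun hx G _ _ => le_loc Q G hx, fun hx => ?_⟩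
    have hgp : x ∈ gp Q := by
      obtain ⟨G, hG, hrk⟩ := exists_facet hQ hd
      exact loc_le_gp hG.1 (hx G hG hrk)
    have hsat : x ∈ sat Q := by
      by_contra h
      obtain ⟨G, hG, hrk, hxG⟩ := exists_facet_notMem_loc hQ hgp h
      exact hxG (hx G hG hrk)
    by_contra hxQ
    obtain ⟨F, hF⟩ := exists_isMaxFaceFor_holes hQ (⟨hsat, hxQ⟩ : x ∈ holes Q)
    have hdim := hfam x F ⟨⟨hsat, hxQ⟩, hF⟩
    rw [hF.1.sdim_eq_iff hd] at hdim
    exact (forall_add_mem_holes_iff hF.1.1 hsat).1 hF.2.1 (hx F hF.1 hdim)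
end

section
/- Let n ≥ 1 and let P ⊆ ℝ^n be the convex hull of a finite set of points of ℤ^n. Suppose the topological interior of P contains a point of ℤ^n, and let N be the number of points of ℤ^n contained in P. Then the normalized volume of P is at least N − 1; that is, n! · vol(P) ≥ N − 1, where vol denotes the n-dimensional Lebesgue measure. -/
/-- The linear combination of the vectors of `F` with coefficients `c`. -/
def vecComb {E : Type*} [AddCommGroup E] [Module ℝ E] (F : Finset E) (c : E → ℝ) : E :=
  ∑ f ∈ F, c f • f

/-- A complete simplicial fan modulo the subspace `L`, each cone being given by its generators. -/
structure IsFanMod {E : Type*} [AddCommGroup E] [Module ℝ E] (L : Submodule ℝ E)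
    (D : Finset (Finset E)) : Prop where
  indep : ∀ F ∈ D, ∀ c : E → ℝ, vecComb F c ∈ L → ∀ f ∈ F, c f = 0
  span : ∀ F ∈ D, Submodule.span ℝ (F : Set E) ⊔ L = ⊤
  disj : ∀ F ∈ D, ∀ G ∈ D, ∀ c d : E → ℝ, (∀ f ∈ F, 0 < c f) → (∀ g ∈ G, 0 < d g) →
    vecComb F c - vecComb G d ∈ L → F = G
  cover : ∀ x : E, ∃ F ∈ D, ∃ c : E → ℝ, (∀ f ∈ F, 0 ≤ c f) ∧ x - vecComb F c ∈ L

section Fan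

variable {E : Type*} [AddCommGroup E] [Module ℝ E]

lemma vecComb_congr {F : Finset E} {c d : E → ℝ} (h : ∀ f ∈ F, c f = d f) :
    vecComb F c = vecComb F d :=
  Finset.sum_congr rfl fun f hf => by rw [h f hf]

lemma vecComb_add (F : Finset E) (c d : E → ℝ) :
    vecComb F (c + d) = vecComb F c + vecComb F d := by
  simp [vecComb, add_smul, Finset.sum_add_distrib]

lemma vecComb_sub (F : Finset E) (c d : E → ℝ) :
    vecComb F (c - d) = vecComb F c - vecComb F d := by
  simp [vecComb, sub_smul, Finset.sum_sub_distrib]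

lemma vecComb_smul (F : Finset E) (a : ℝ) (c : E → ℝ) :
    vecComb F (a • c) = a • vecComb F c := by
  simp [vecComb, Finset.smul_sum, mul_smul]

lemma vecComb_mem {F : Finset E} {c : E → ℝ} {W : Submodule ℝ E} (h : ∀ f ∈ F, f ∈ W) :
    vecComb F c ∈ W :=
  W.sum_mem fun f hf => W.smul_mem _ (h f hf)

open Classical in
lemma vecComb_erase {F : Finset E} {c : E → ℝ} {t : E} (h : c t = 0) :
    vecComb (F.erase t) c = vecComb F c := by
  refine Finset.sum_subset (Finset.erase_subset _ _) fun f hf hf' => ?_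
  have : f = t := by simpa [hf] using hf'
  simp [this, h]

open Classical in
lemma vecComb_filter {F : Finset E} {c : E → ℝ} {p : E → Prop} (h : ∀ f ∈ F, ¬ p f → c f = 0) :
    vecComb (F.filter p) c = vecComb F c := by
  refine Finset.sum_subset (Finset.filter_subset _ _) fun f hf hf' => ?_
  rw [h f hf (by simpa [hf] using hf'), zero_smul]

open Classical in
lemma vecComb_insert {F : Finset E} {c : E → ℝ} {p : E} (h : p ∉ F) :
    vecComb (insert p F) c = c p • p + vecComb F c :=
  Finset.sum_insert h

open Classical in
lemma vecComb_union {F G : Finset E} {c : E → ℝ} (h : Disjoint F G) :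
    vecComb (F ∪ G) c = vecComb F c + vecComb G c :=
  Finset.sum_union h

open Classical in
/-- The shape of a minimal positive relation modulo a subspace. -/
lemma exists_positive_circuit {L : Submodule ℝ E} {S : Finset E} (hL : L ≠ ⊤)
    (hS : ∀ x : E, ∃ c : E → ℝ, (∀ s ∈ S, 0 ≤ c s) ∧ x - vecComb S c ∈ L) :
    ∃ T ⊆ S, 2 ≤ T.card ∧ (∀ t ∈ T, t ∉ L) ∧
      (∃ γ : E → ℝ, (∀ t ∈ T, 0 < γ t) ∧ vecComb T γ ∈ L) ∧
      ∀ t ∈ T, ∀ d : E → ℝ, vecComb (T.erase t) d ∈ L → ∀ f ∈ T.erase t, d f = 0 := by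
  have hs : ∃ s ∈ S, s ∉ L := by
    by_contra! h
    refine hL (eq_top_iff.2 fun x _ => ?_)
    obtain ⟨c, -, hc⟩ := hS x
    simpa using L.add_mem hc (vecComb_mem (c := c) h)
  let p : Finset E → Prop := fun T => T.Nonempty ∧ T ⊆ S ∧ (∀ t ∈ T, t ∉ L) ∧
    ∃ γ : E → ℝ, (∀ t ∈ T, 0 < γ t) ∧ vecComb T γ ∈ L
  have hp : ∃ T, p T := by
    obtain ⟨s, hsS, hsL⟩ := hs
    obtain ⟨c, hc0, hc⟩ := hS (-s)
    set e : E → ℝ := c + Pi.single s 1 with he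
    have hsum : vecComb S e ∈ L := by
      rw [he, vecComb_add]
      have : vecComb S (Pi.single s 1) = s := by
        simp [vecComb, Pi.single_apply, hsS]
      rw [this]
      have := L.neg_mem hc
      rwa [neg_sub, sub_neg_eq_add] at this
    have hnn : ∀ f ∈ S, 0 ≤ e f := fun f hf => by
      have := hc0 f hf
      simp only [he, Pi.add_apply, Pi.single_apply]
      split_ifs <;> linarith
    have hes : 0 < e s := by
      have := hc0 s hsS
      simp [e]; linarith
    refine ⟨S.filter fun f => f ∉ L ∧ 0 < e f, ⟨s, by simp [hsS, hsL, hes]⟩,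
      Finset.filter_subset _ _, by simp +contextual, e, by simp +contextual, ?_⟩
    have h2 : vecComb (S.filter fun f => ¬ (f ∉ L ∧ 0 < e f)) e ∈ L := by
      refine L.sum_mem fun f hf => ?_
      simp only [Finset.mem_filter, not_and] at hf
      by_cases hfL : f ∈ L
      · exact L.smul_mem _ hfL
      · have : e f = 0 := le_antisymm (not_lt.1 (hf.2 hfL)) (hnn f hf.1)
        simp [this]
    have h3 : vecComb S e = vecComb (S.filter fun f => f ∉ L ∧ 0 < e f) e +
        vecComb (S.filter fun f => ¬ (f ∉ L ∧ 0 < e f)) e :=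
      (Finset.sum_filter_add_sum_filter_not _ _ _).symm
    rw [h3] at hsum
    exact (L.add_mem_iff_left h2).1 hsum
  obtain ⟨T, hT⟩ := exists_minimal_of_wellFoundedLT p hp
  obtain ⟨⟨hne, hTS, hTL, γ, hγ, hγL⟩, hmin⟩ := hT
  refine ⟨T, hTS, ?_, hTL, ⟨γ, hγ, hγL⟩, ?_⟩
  · by_contra! hcard
    have h1 : T.card = 1 := by have := hne.card_pos; omega
    obtain ⟨t, rfl⟩ := Finset.card_eq_one.1 h1
    have h0 : γ t ≠ 0 := (hγ t (by simp)).ne'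
    refine hTL t (by simp) ?_
    rw [vecComb, Finset.sum_singleton] at hγL
    exact (L.smul_mem_iff h0).1 hγL
  · intro t ht
    have key : ∀ d : E → ℝ, vecComb (T.erase t) d ∈ L → ∀ f ∈ T.erase t, d f ≤ 0 := by
      intro d hd f hf
      by_contra! hdf
      obtain ⟨f₀, hf₀, hf₀min⟩ := Finset.exists_min_image ((T.erase t).filter fun f => 0 < d f)
        (fun f => γ f / d f) ⟨f, by simp [hf, hdf]⟩
      simp only [Finset.mem_filter] at hf₀ hf₀min
      let e : E → ℝ := γ - (γ f₀ / d f₀) • Function.update d t 0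
      have het : e t = γ t := by simp [e]
      have hef : ∀ f ∈ T.erase t, e f = γ f - γ f₀ / d f₀ * d f := fun f hf => by
        simp [e, Finset.ne_of_mem_erase hf]
      have hr : 0 < γ f₀ / d f₀ := div_pos (hγ _ (Finset.mem_of_mem_erase hf₀.1)) hf₀.2
      have hnn : ∀ f ∈ T, 0 ≤ e f := by
        intro f hf
        by_cases hft : f = t
        · rw [hft, het]; exact (hγ t ht).le
        have hf' : f ∈ T.erase t := Finset.mem_erase.2 ⟨hft, hf⟩
        rw [hef f hf', sub_nonneg]
        by_cases hdf : 0 < d f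
        · have := hf₀min f ⟨hf', hdf⟩
          rwa [le_div_iff₀ hdf] at this
        · exact (mul_nonpos_of_nonneg_of_nonpos hr.le (not_lt.1 hdf)).trans (hγ f hf).le
      have heL : vecComb T e ∈ L := by
        rw [vecComb_sub, vecComb_smul, ← vecComb_erase (t := t) (c := Function.update d t 0)
          (by simp), vecComb_congr (F := T.erase t) (c := Function.update d t 0) (d := d)
          (fun f hf => by simp [Finset.ne_of_mem_erase hf])]
        exact L.sub_mem hγL (L.smul_mem _ hd)
      have hsub : T.filter (fun f => 0 < e f) ⊆ T := Finset.filter_subset _ _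
      have hle := hmin (y := T.filter fun f => 0 < e f) ⟨⟨t, by simp [ht, het, hγ t ht]⟩,
        hsub.trans hTS, fun f hf => hTL f (hsub hf), e, by simp +contextual, by
          rw [vecComb_filter fun f hf h => le_antisymm (not_lt.1 h) (hnn f hf)]
          exact heL⟩ hsub
      have := hle (Finset.mem_of_mem_erase hf₀.1)
      rw [Finset.mem_filter, hef f₀ hf₀.1, div_mul_cancel₀ _ hf₀.2.ne', sub_self] at this
      exact lt_irrefl _ this.2
    intro d hd f hf
    refine le_antisymm (key d hd f hf) ?_
    have := key (-d) (by
      have h := vecComb_smul (T.erase t) (-1) d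
      simp only [neg_smul, one_smul] at h
      rw [h]; exact L.neg_mem hd) f hf
    simpa using this

open Classical in
lemma exists_isFanMod [FiniteDimensional ℝ E] (S : Finset E) (L : Submodule ℝ E)
    (hS : ∀ x : E, ∃ c : E → ℝ, (∀ s ∈ S, 0 ≤ c s) ∧ x - vecComb S c ∈ L) :
    ∃ D : Finset (Finset E), IsFanMod L D ∧ D.biUnion id ⊆ S ∧
      ((D.card = 1 ∧ D.biUnion id = ∅) ∨ (2 ≤ D.card ∧ (D.biUnion id).card ≤ D.card)) := by
  induction L using WellFoundedGT.induction with
  | ind L ih =>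
  by_cases hL : L = ⊤
  · subst hL
    exact ⟨{∅}, ⟨by simp, by simp, by simp, by simp⟩, by simp, by simp⟩
  obtain ⟨T, hTS, hTcard, hTL, ⟨γ, hγ, hγL⟩, hTind⟩ := exists_positive_circuit hL hS
  set M := L ⊔ Submodule.span ℝ (T : Set E) with hM
  have hTM : ∀ t ∈ T, t ∈ M := fun t ht =>
    (le_sup_right : _ ≤ M) (Submodule.subset_span ht)
  have hLM : L ≤ M := le_sup_left
  have hlt : L < M := by
    obtain ⟨t, ht⟩ : T.Nonempty := Finset.card_pos.1 (by omega)
    exact lt_of_le_of_ne hLM fun h => hTL t ht (h ▸ hTM t ht)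
  obtain ⟨D, hD, hDS, hDc⟩ := ih M hlt fun x => by
    obtain ⟨c, hc, h⟩ := hS x
    exact ⟨c, hc, hLM h⟩
  have hnot : ∀ F ∈ D, ∀ f ∈ F, f ∉ M := fun F hF f hf hfM => by
    have := hD.indep F hF (Pi.single f 1)
      (by simpa [vecComb, Pi.single_apply, hf] using hfM) f hf
    simp at this
  have hdisj : ∀ F ∈ D, Disjoint T F := fun F hF =>
    Finset.disjoint_left.2 fun f hfT hfF => hnot F hF f hfF (hTM f hfT)
  have hdisj' : ∀ t, ∀ F ∈ D, Disjoint (T.erase t) F := fun t F hF =>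
    (hdisj F hF).mono_left (Finset.erase_subset _ _)
  have hinj : Set.InjOn (fun q : E × Finset E => T.erase q.1 ∪ q.2)
      (T ×ˢ D : Finset (E × Finset E)) := by
    rintro ⟨t, F⟩ h1 ⟨u, G⟩ h2 h
    simp only [Finset.coe_product, Set.mem_prod, Finset.mem_coe] at h1 h2
    simp only at h
    have hF := Finset.disjoint_left.1 (hdisj F h1.2)
    have hG := Finset.disjoint_left.1 (hdisj G h2.2)
    have htu : t = u := by
      by_contra hne
      have : u ∈ T.erase t ∪ F := by simp [h2.1, Ne.symm hne]
      rw [h] at this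
      simp [hG h2.1] at this
    have hFG : F = G := by
      ext f
      have := Finset.ext_iff.1 h f
      simp only [Finset.mem_union, Finset.mem_erase] at this
      constructor
      · intro hf
        have hfT : f ∉ T := fun h => hF h hf
        tauto
      · intro hf
        have hfT : f ∉ T := fun h => hG h hf
        tauto
    rw [htu, hFG]
  have hcomb : ∀ t, ∀ c, vecComb (T.erase t) c ∈ M := fun t c =>
    vecComb_mem fun f hf => hTM f (Finset.mem_of_mem_erase hf)
  refine ⟨(T ×ˢ D).image fun q => T.erase q.1 ∪ q.2, ⟨?_, ?_, ?_, ?_⟩, ?_, ?_⟩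
  · intro F' hF' c hc
    obtain ⟨⟨t, F⟩, hq, rfl⟩ := Finset.mem_image.1 hF'
    obtain ⟨ht, hF⟩ := Finset.mem_product.1 hq
    simp only at ht hF hc ⊢
    rw [vecComb_union (hdisj' t F hF)] at hc
    have h1 : ∀ f ∈ F, c f = 0 :=
      hD.indep F hF c ((M.add_mem_iff_right (hcomb t c)).1 (hLM hc))
    have h2 : vecComb F c = 0 := Finset.sum_eq_zero fun f hf => by simp [h1 f hf]
    rw [h2, add_zero] at hc
    intro f hf
    rcases Finset.mem_union.1 hf with hf | hf
    · exact hTind t ht c hc f hf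
    · exact h1 f hf
  · intro F' hF'
    obtain ⟨⟨t, F⟩, hq, rfl⟩ := Finset.mem_image.1 hF'
    obtain ⟨ht, hF⟩ := Finset.mem_product.1 hq
    simp only at ht hF ⊢
    rw [eq_top_iff, ← hD.span F hF]
    set W := Submodule.span ℝ ((T.erase t ∪ F : Finset E) : Set E) ⊔ L with hW
    have hWL : L ≤ W := le_sup_right
    have hsub : ∀ f ∈ T.erase t ∪ F, f ∈ W := fun f hf =>
      (le_sup_left : _ ≤ W) (Submodule.subset_span hf)
    have hT : ∀ f ∈ T.erase t, f ∈ W := fun f hf => hsub f (Finset.mem_union_left _ hf)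
    refine sup_le (Submodule.span_le.2 fun f hf => hsub f (Finset.mem_union_right _ hf))
      (sup_le hWL (Submodule.span_le.2 fun f hf => ?_))
    by_cases hft : f = t
    · have : γ t • t + vecComb (T.erase t) γ = vecComb T γ :=
        Finset.add_sum_erase T (fun f => γ f • f) ht
      have h1 : γ t • t ∈ W := by
        rw [← W.add_mem_iff_left (vecComb_mem hT), this]
        exact hWL hγL
      rw [hft]
      exact (W.smul_mem_iff (hγ t ht).ne').1 h1
    · exact hT f (Finset.mem_erase.2 ⟨hft, hf⟩)
  · intro F' hF' G' hG' c d hc hd hcd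
    obtain ⟨⟨t, F⟩, hq, rfl⟩ := Finset.mem_image.1 hF'
    obtain ⟨⟨u, G⟩, hq', rfl⟩ := Finset.mem_image.1 hG'
    obtain ⟨ht, hF⟩ := Finset.mem_product.1 hq
    obtain ⟨hu, hG⟩ := Finset.mem_product.1 hq'
    simp only at ht hF hu hG hc hd hcd ⊢
    rw [vecComb_union (hdisj' t F hF), vecComb_union (hdisj' u G hG)] at hcd
    have hFGM : vecComb F c - vecComb G d ∈ M := by
      have := M.sub_mem (hLM hcd) (M.sub_mem (hcomb t c) (hcomb u d))
      convert this using 1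
      abel
    obtain rfl : F = G := hD.disj F hF G hG c d
      (fun f hf => hc f (Finset.mem_union_right _ hf))
      (fun f hf => hd f (Finset.mem_union_right _ hf)) hFGM
    rw [← vecComb_sub] at hFGM
    have hz := hD.indep F hF _ hFGM
    have hcd' : vecComb F c = vecComb F d :=
      vecComb_congr fun f hf => by simpa [sub_eq_zero] using hz f hf
    rw [hcd', add_sub_add_right_eq_sub] at hcd
    congr 1
    by_contra hne
    have htu : t ≠ u := fun h => hne (by rw [h])
    set c' := Function.update c t 0 with hc'
    set d' := Function.update d u 0 with hd'
    have h1 : vecComb (T.erase t) c = vecComb T c' := by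
      rw [← vecComb_erase (t := t) (c := c') (by simp [hc'])]
      exact vecComb_congr fun f hf => by simp [hc', Finset.ne_of_mem_erase hf]
    have h2 : vecComb (T.erase u) d = vecComb T d' := by
      rw [← vecComb_erase (t := u) (c := d') (by simp [hd'])]
      exact vecComb_congr fun f hf => by simp [hd', Finset.ne_of_mem_erase hf]
    rw [h1, h2, ← vecComb_sub] at hcd
    have h3 : vecComb (T.erase t) ((c' - d') + (d' t / γ t) • γ) ∈ L := by
      rw [vecComb_erase (by simp [hc', div_mul_cancel₀ _ (hγ t ht).ne']), vecComb_add, vecComb_smul]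
      exact L.add_mem hcd (L.smul_mem _ hγL)
    have h4 := hTind t ht _ h3 u (Finset.mem_erase.2 ⟨htu.symm, hu⟩)
    have h5 : 0 < c u := hc u (by simp [htu.symm, hu])
    have h6 : 0 < d t := hd t (by simp [htu, ht])
    have h7 := hγ t ht
    have h8 := hγ u hu
    simp only [Pi.add_apply, Pi.sub_apply, Pi.smul_apply, smul_eq_mul, hc', hd',
      Function.update_self, Function.update_of_ne htu, Function.update_of_ne htu.symm] at h4
    have : 0 < d t / γ t * γ u := by positivity
    linarith
  · intro x
    obtain ⟨F, hF, c, hc, hx⟩ := hD.cover x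
    obtain ⟨l, hl, y, hy, hly⟩ := Submodule.mem_sup.1 hx
    obtain ⟨d, -, rfl⟩ := Submodule.mem_span_finset.1 hy
    obtain ⟨t, ht, hmin⟩ := Finset.exists_min_image T (fun f => d f / γ f)
      (Finset.card_pos.1 (by omega))
    set d' := d - (d t / γ t) • γ with hd'
    have hd't : d' t = 0 := by simp [hd', div_mul_cancel₀ _ (hγ t ht).ne']
    refine ⟨T.erase t ∪ F, Finset.mem_image.2 ⟨(t, F), by simp [ht, hF], rfl⟩,
      fun f => if f ∈ T then d' f else c f, ?_, ?_⟩
    · intro f hf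
      by_cases hfT : f ∈ T
      · have h1 := hmin f hfT
        rw [le_div_iff₀ (hγ f hfT)] at h1
        simpa [hfT, hd'] using h1
      · have : f ∈ F := by simpa [hfT] using hf
        simpa [hfT] using hc f this
    · rw [vecComb_union (hdisj' t F hF),
        vecComb_congr (F := F) (d := c) (fun f hf => by
          exact if_neg fun h => Finset.disjoint_left.1 (hdisj F hF) h hf),
        vecComb_congr (F := T.erase t) (d := d') (fun f hf => by
          simp [Finset.mem_of_mem_erase hf]), vecComb_erase hd't, hd', vecComb_sub, vecComb_smul]
      have h1 : x = l + vecComb T d + vecComb F c := by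
        rw [vecComb, hly]; abel
      have h2 : x - (vecComb T d - (d t / γ t) • vecComb T γ + vecComb F c) =
          l + (d t / γ t) • vecComb T γ := by
        rw [h1]; abel
      rw [h2]
      exact L.add_mem hl (L.smul_mem _ hγL)
  · intro f hf
    simp only [Finset.mem_biUnion, Finset.mem_image, id] at hf
    obtain ⟨_, ⟨⟨t, F⟩, hq, rfl⟩, hf⟩ := hf
    rcases Finset.mem_union.1 hf with hf | hf
    · exact hTS (Finset.mem_of_mem_erase hf)
    · exact hDS (Finset.mem_biUnion.2 ⟨F, (Finset.mem_product.1 hq).2, hf⟩)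
  · right
    have hrays : (((T ×ˢ D).image fun q => T.erase q.1 ∪ q.2).biUnion id) ⊆
        T ∪ D.biUnion id := by
      intro f hf
      simp only [Finset.mem_biUnion, Finset.mem_image, id] at hf
      obtain ⟨_, ⟨⟨t, F⟩, hq, rfl⟩, hf⟩ := hf
      rcases Finset.mem_union.1 hf with hf | hf
      · exact Finset.mem_union_left _ (Finset.mem_of_mem_erase hf)
      · exact Finset.mem_union_right _
          (Finset.mem_biUnion.2 ⟨F, (Finset.mem_product.1 hq).2, hf⟩)
    have hle := (Finset.card_le_card hrays).trans (Finset.card_union_le _ _)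
    rw [Finset.card_image_of_injOn hinj, Finset.card_product]
    rcases hDc with ⟨h1, h2⟩ | ⟨h1, h2⟩
    · rw [h2, Finset.card_empty] at hle
      rw [h1]; omega
    · constructor
      · nlinarith
      · refine hle.trans ?_
        nlinarith

open Classical in
/-- Stellar subdivision of a single simplicial cone along the ray through `p`. -/
lemma exists_cone_subdivision {F : Finset E} {p : E} (hp0 : p ≠ 0)
    (hp : ∀ f ∈ F, ∀ a : ℝ, 0 < a → p ≠ a • f)
    (hF : ∀ c : E → ℝ, vecComb F c = 0 → ∀ f ∈ F, c f = 0)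
    (hFs : Submodule.span ℝ (F : Set E) = ⊤) :
    ∃ R : Finset (Finset E), (∀ H ∈ R, H ⊆ insert p F) ∧
      (∀ H ∈ R, ∀ c : E → ℝ, vecComb H c = 0 → ∀ f ∈ H, c f = 0) ∧
      (∀ H ∈ R, Submodule.span ℝ (H : Set E) = ⊤) ∧
      (∀ H ∈ R, ∀ c : E → ℝ, (∀ f ∈ H, 0 < c f) →
        ∃ c' : E → ℝ, (∀ f ∈ F, 0 < c' f) ∧ vecComb H c = vecComb F c') ∧
      (∀ H ∈ R, ∀ K ∈ R, ∀ c d : E → ℝ, (∀ f ∈ H, 0 < c f) → (∀ f ∈ K, 0 < d f) →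
        vecComb H c = vecComb K d → H = K) ∧
      (∀ c : E → ℝ, (∀ f ∈ F, 0 ≤ c f) →
        ∃ H ∈ R, ∃ c' : E → ℝ, (∀ f ∈ H, 0 ≤ c' f) ∧ vecComb F c = vecComb H c') ∧
      1 ≤ R.card ∧
      ((∃ c : E → ℝ, (∀ f ∈ F, 0 ≤ c f) ∧ p = vecComb F c) → 2 ≤ R.card) := by
  by_cases h : ∃ c : E → ℝ, (∀ f ∈ F, 0 ≤ c f) ∧ p = vecComb F c
  swap
  · refine ⟨{F}, by simp, by simpa using hF, by simpa using hFs, ?_, by simp, ?_, by simp,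
      fun h' => absurd h' h⟩
    · intro H hH c hc
      obtain rfl := Finset.mem_singleton.1 hH
      exact ⟨c, hc, rfl⟩
    · exact fun c hc => ⟨F, by simp, c, hc, rfl⟩
  obtain ⟨π, hπ, hpπ⟩ := h
  have hpF : p ∉ F := fun h => hp p h 1 one_pos (one_smul _ _).symm
  have hne : ∀ f ∈ F, f ≠ p := fun f hf h => hpF (h ▸ hf)
  set Q := F.filter fun f => 0 < π f with hQ
  have hQF : ∀ f ∈ Q, f ∈ F := fun f hf => (Finset.mem_filter.1 hf).1
  have hQπ : ∀ f ∈ Q, 0 < π f := fun f hf => (Finset.mem_filter.1 hf).2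
  have hpQ : p = vecComb Q π := by
    rw [hQ, vecComb_filter fun f hf h => le_antisymm (not_lt.1 h) (hπ f hf), ← hpπ]
  have hQcard : 2 ≤ Q.card := by
    by_contra! hlt
    have : Q.card = 0 ∨ Q.card = 1 := by omega
    rcases this with h0 | h1
    · rw [Finset.card_eq_zero.1 h0] at hpQ
      exact hp0 (by simpa [vecComb] using hpQ)
    · obtain ⟨f, hf⟩ := Finset.card_eq_one.1 h1
      have hfQ : f ∈ Q := by simp [hf]
      rw [hf] at hpQ
      exact hp f (hQF f hfQ) (π f) (hQπ f hfQ) (by simpa [vecComb] using hpQ)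
  have hform : ∀ f ∈ F, ∀ c : E → ℝ, vecComb (insert p (F.erase f)) c =
      vecComb F (Function.update c f 0 + c p • π) := by
    intro f hf c
    rw [vecComb_insert (by simp [hpF]), vecComb_add, vecComb_smul, ← hpπ,
      ← vecComb_erase (t := f) (c := Function.update c f 0) (by simp), add_comm]
    congr 1
    exact vecComb_congr fun g hg => by simp [Finset.ne_of_mem_erase hg]
  have hinj : Set.InjOn (fun f => insert p (F.erase f)) (Q : Set E) := by
    intro f hf g hg hfg
    by_contra hne'
    have h1 : g ∈ insert p (F.erase f) := by simp [hQF g hg, Ne.symm hne']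
    simp only at hfg
    rw [hfg] at h1
    simp [hne g (hQF g hg)] at h1
  have hcard : (Q.image fun f => insert p (F.erase f)).card = Q.card :=
    Finset.card_image_of_injOn hinj
  refine ⟨Q.image fun f => insert p (F.erase f), ?_, ?_, ?_, ?_, ?_, ?_, by omega,
    fun _ => by omega⟩
  · intro H hH
    obtain ⟨f, hf, rfl⟩ := Finset.mem_image.1 hH
    exact Finset.insert_subset_insert _ (Finset.erase_subset _ _)
  · intro H hH c hc
    obtain ⟨f, hf, rfl⟩ := Finset.mem_image.1 hH
    rw [hform f (hQF f hf)] at hc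
    have h1 := hF _ hc
    have h2 : c p = 0 := by
      have := h1 f (hQF f hf)
      simpa [(hQπ f hf).ne'] using this
    intro g hg
    rcases Finset.mem_insert.1 hg with rfl | hg
    · exact h2
    · have := h1 g (Finset.mem_of_mem_erase hg)
      simpa [h2, Finset.ne_of_mem_erase hg] using this
  · intro H hH
    obtain ⟨f, hf, rfl⟩ := Finset.mem_image.1 hH
    rw [eq_top_iff, ← hFs, Submodule.span_le]
    set W := Submodule.span ℝ ((insert p (F.erase f) : Finset E) : Set E) with hW
    have hsub : ∀ g ∈ insert p (F.erase f), g ∈ W := fun g hg => Submodule.subset_span hg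
    intro g hg
    by_cases hgf : g = f
    · have h1 : π f • f + vecComb (F.erase f) π = p :=
        (Finset.add_sum_erase F (fun f => π f • f) (hQF f hf)).trans hpπ.symm
      have h2 : π f • f ∈ W := by
        rw [← W.add_mem_iff_left (vecComb_mem (c := π) fun g hg =>
          hsub g (Finset.mem_insert_of_mem hg)), h1]
        exact hsub p (Finset.mem_insert_self _ _)
      rw [hgf]
      exact (W.smul_mem_iff (hQπ f hf).ne').1 h2
    · exact hsub g (Finset.mem_insert_of_mem (Finset.mem_erase.2 ⟨hgf, hg⟩))
  · intro H hH c hc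
    obtain ⟨f, hf, rfl⟩ := Finset.mem_image.1 hH
    refine ⟨_, fun g hg => ?_, hform f (hQF f hf) c⟩
    have hcp : 0 < c p := hc p (Finset.mem_insert_self _ _)
    by_cases hgf : g = f
    · subst hgf
      have := hQπ g hf
      simp only [Pi.add_apply, Function.update_self, Pi.smul_apply, smul_eq_mul]
      positivity
    · have h1 := hc g (by simp [hg, hgf])
      have h2 := hπ g hg
      simp only [Pi.add_apply, Function.update_of_ne hgf, Pi.smul_apply, smul_eq_mul]
      positivity
  · intro H hH K hK c d hc hd hcd
    obtain ⟨f, hf, rfl⟩ := Finset.mem_image.1 hH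
    obtain ⟨g, hg, rfl⟩ := Finset.mem_image.1 hK
    rw [hform f (hQF f hf), hform g (hQF g hg), ← sub_eq_zero, ← vecComb_sub] at hcd
    have h0 := hF _ hcd
    by_contra hne'
    have hfg : f ≠ g := fun h => hne' (by rw [h])
    have h1 := h0 f (hQF f hf)
    have h2 := h0 g (hQF g hg)
    simp only [Pi.add_apply, Pi.sub_apply, Pi.smul_apply, smul_eq_mul, Function.update_self,
      Function.update_of_ne hfg, Function.update_of_ne hfg.symm] at h1 h2
    have h3 : 0 < d f := hd f (by simp [hfg, hQF f hf])
    have h4 : 0 < c g := hc g (by simp [hfg.symm, hQF g hg])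
    have h5 : d p < c p := lt_of_mul_lt_mul_right (by linarith) (hQπ f hf).le
    have h6 : c p < d p := lt_of_mul_lt_mul_right (by linarith) (hQπ g hg).le
    exact lt_asymm h5 h6
  · intro c hc
    obtain ⟨f, hf, hmin⟩ := Finset.exists_min_image Q (fun f => c f / π f)
      (Finset.card_pos.1 (by omega))
    set r := c f / π f with hr
    have hr0 : 0 ≤ r := div_nonneg (hc f (hQF f hf)) (hQπ f hf).le
    refine ⟨_, Finset.mem_image_of_mem _ hf, Function.update (c - r • π) p r, ?_, ?_⟩
    · intro g hg
      rcases Finset.mem_insert.1 hg with rfl | hg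
      · simpa using hr0
      · have hgF := Finset.mem_of_mem_erase hg
        simp only [Function.update_of_ne (hne g hgF), Pi.sub_apply, Pi.smul_apply, smul_eq_mul,
          sub_nonneg]
        by_cases hgQ : 0 < π g
        · have := hmin g (by simp [hQ, hgF, hgQ])
          rwa [le_div_iff₀ hgQ] at this
        · rw [le_antisymm (not_lt.1 hgQ) (hπ g hgF), mul_zero]
          exact hc g hgF
    · rw [hform f (hQF f hf)]
      refine vecComb_congr fun g hg => ?_
      by_cases hgf : g = f
      · subst hgf
        simp [hr, div_mul_cancel₀ _ (hQπ g hf).ne']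
      · simp [hgf, hne g hg]

open Classical in
lemma IsFanMod.exists_subdivision {D : Finset (Finset E)} (hD : IsFanMod ⊥ D) {p : E}
    (hp0 : p ≠ 0) (hp : ∀ F ∈ D, ∀ f ∈ F, ∀ a : ℝ, 0 < a → p ≠ a • f) :
    ∃ D' : Finset (Finset E), IsFanMod ⊥ D' ∧ D.card + 1 ≤ D'.card ∧
      D'.biUnion id ⊆ insert p (D.biUnion id) := by
  have hex := fun (F : Finset E) (hF : F ∈ D) => exists_cone_subdivision hp0 (hp F hF)
    (fun c hc => hD.indep F hF c (by simpa using hc)) (by simpa using hD.span F hF)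
  choose! R h1 h2 h3 h4 h5 h6 h7 h8 using hex
  have hdisj : (D : Set (Finset E)).PairwiseDisjoint R := by
    intro F hF G hG hne
    rw [Function.onFun, Finset.disjoint_left]
    intro H hHF hHG
    obtain ⟨c, hc, hc'⟩ := h4 F hF H hHF 1 (by simp)
    obtain ⟨d, hd, hd'⟩ := h4 G hG H hHG 1 (by simp)
    exact hne (hD.disj F hF G hG c d hc hd (by simp [← hc', ← hd']))
  refine ⟨D.biUnion R, ⟨?_, ?_, ?_, ?_⟩, ?_, ?_⟩
  · intro H hH c hc
    obtain ⟨F, hF, hHF⟩ := Finset.mem_biUnion.1 hH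
    exact h2 F hF H hHF c (by simpa using hc)
  · intro H hH
    obtain ⟨F, hF, hHF⟩ := Finset.mem_biUnion.1 hH
    simpa using h3 F hF H hHF
  · intro H hH K hK c d hc hd hcd
    obtain ⟨F, hF, hHF⟩ := Finset.mem_biUnion.1 hH
    obtain ⟨G, hG, hKG⟩ := Finset.mem_biUnion.1 hK
    obtain ⟨c', hc', hcc⟩ := h4 F hF H hHF c hc
    obtain ⟨d', hd', hdd⟩ := h4 G hG K hKG d hd
    obtain rfl := hD.disj F hF G hG c' d' hc' hd' (by rwa [← hcc, ← hdd])
    exact h5 F hF H hHF K hKG c d hc hd (by simpa [sub_eq_zero] using hcd)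
  · intro x
    obtain ⟨F, hF, c, hc, hx⟩ := hD.cover x
    obtain ⟨H, hH, d, hd, hcd⟩ := h6 F hF c hc
    exact ⟨H, Finset.mem_biUnion.2 ⟨F, hF, hH⟩, d, hd, by rwa [← hcd]⟩
  · rw [Finset.card_biUnion hdisj]
    obtain ⟨F, hF, c, hc, hx⟩ := hD.cover p
    have hlt : ∑ _F ∈ D, 1 < ∑ F ∈ D, (R F).card :=
      Finset.sum_lt_sum h7 ⟨F, hF, h8 F hF ⟨c, hc, by simpa [sub_eq_zero] using hx⟩⟩
    simpa using hlt
  · intro f hf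
    simp only [Finset.mem_biUnion, id] at hf
    obtain ⟨H, ⟨F, hF, hHF⟩, hf⟩ := hf
    rcases Finset.mem_insert.1 (h1 F hF H hHF hf) with rfl | h
    · exact Finset.mem_insert_self _ _
    · exact Finset.mem_insert_of_mem (Finset.mem_biUnion.2 ⟨F, hF, h⟩)

open Classical in
/-- A positively spanning set of vectors on distinct rays supports a complete simplicial fan
using all these rays, with at least as many maximal cones as rays. -/
lemma exists_fan_generators_eq [FiniteDimensional ℝ E] (S : Finset E)
    (hS : ∀ x : E, ∃ c : E → ℝ, (∀ s ∈ S, 0 ≤ c s) ∧ x = vecComb S c) (h0 : (0 : E) ∉ S)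
    (hray : ∀ s ∈ S, ∀ t ∈ S, ∀ a : ℝ, 0 < a → s = a • t → s = t) :
    ∃ D : Finset (Finset E), IsFanMod ⊥ D ∧ (∀ f, f ∈ S ↔ ∃ F ∈ D, f ∈ F) ∧
      S.card ≤ D.card := by
  let good : Finset (Finset E) → Prop := fun D =>
    IsFanMod ⊥ D ∧ D.biUnion id ⊆ S ∧ (D.biUnion id).card ≤ D.card
  have hne : (S.powerset.powerset.filter good).Nonempty := by
    obtain ⟨D, hD, hDS, hc⟩ := exists_isFanMod S ⊥ fun x => by
      obtain ⟨c, hc, h⟩ := hS x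
      exact ⟨c, hc, by simp [← h]⟩
    refine ⟨D, Finset.mem_filter.2 ⟨?_, hD, hDS, ?_⟩⟩
    · exact Finset.mem_powerset.2 fun F hF => Finset.mem_powerset.2
        ((Finset.subset_biUnion_of_mem id hF).trans hDS)
    · rcases hc with ⟨-, h⟩ | ⟨-, h⟩
      · simp [h]
      · exact h
  obtain ⟨D, hDm, hmax⟩ := Finset.exists_max_image _ Finset.card hne
  obtain ⟨-, hD, hDS, hDc⟩ := Finset.mem_filter.1 hDm
  have hSD : S ⊆ D.biUnion id := by
    intro p hpS
    by_contra hpD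
    have hmem : ∀ F ∈ D, ∀ f ∈ F, f ∈ D.biUnion id := fun F hF f hf =>
      Finset.mem_biUnion.2 ⟨F, hF, hf⟩
    obtain ⟨D', hD', hcard, hsub⟩ := hD.exists_subdivision (p := p) (fun h => h0 (h ▸ hpS))
      fun F hF f hf a ha h => hpD
        (hray p hpS f (hDS (hmem F hF f hf)) a ha h ▸ hmem F hF f hf)
    have hD'S : D'.biUnion id ⊆ S := hsub.trans (Finset.insert_subset hpS hDS)
    have := hmax D' (Finset.mem_filter.2 ⟨Finset.mem_powerset.2 fun F hF =>
      Finset.mem_powerset.2 ((Finset.subset_biUnion_of_mem id hF).trans hD'S), hD', hD'S, by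
        have := (Finset.card_le_card hsub).trans (Finset.card_insert_le _ _)
        omega⟩)
    omega
  have heq := Finset.Subset.antisymm hDS hSD
  exact ⟨D, hD, fun f => by simp [← heq], heq ▸ hDc⟩

end Fan

section Volume

open MeasureTheory

/-- The open corner simplex in `ℝ^n`. -/
def openCorner (n : ℕ) : Set (Fin n → ℝ) := {x | (∀ i, 0 < x i) ∧ ∑ i, x i < 1}

lemma isOpen_openCorner (n : ℕ) : IsOpen (openCorner n) := by
  have h : openCorner n = (⋂ i, {x | 0 < x i}) ∩ {x | ∑ i, x i < 1} := by
    ext x; simp [openCorner]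
  rw [h]
  exact (isOpen_iInter_of_finite fun i => isOpen_lt (by fun_prop) (by fun_prop)).inter
    (isOpen_lt (by fun_prop) (by fun_prop))

lemma le_volume_openCorner (n : ℕ) :
    ENNReal.ofReal (1 / n.factorial) ≤ volume (openCorner n) := by
  have hcross : volume {x : Fin n → ℝ | ∑ i, |x i| < 1} =
      ENNReal.ofReal (2 ^ n / n.factorial) := by
    have h := volume_sum_rpow_lt_one (Fin n) (p := 1) le_rfl
    have h2 : Real.Gamma (1 + 1) = 1 := by
      norm_num
    simpa [h2, Real.Gamma_nat_eq_factorial] using h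
  let g : (Fin n → Bool) → (Fin n → ℝ) →ₗ[ℝ] (Fin n → ℝ) := fun ε =>
    Matrix.toLin' (Matrix.diagonal fun i => if ε i then (1 : ℝ) else -1)
  have hvol : ∀ ε, volume (g ε '' openCorner n) = volume (openCorner n) := by
    intro ε
    rw [Measure.addHaar_image_linearMap, LinearMap.det_toLin', Matrix.det_diagonal,
      Finset.abs_prod]
    have : ∀ i, |if ε i then (1 : ℝ) else -1| = 1 := fun i => by split_ifs <;> simp
    simp [this]
  have hsub : {x : Fin n → ℝ | ∑ i, |x i| < 1} ⊆
      (⋃ i, {x : Fin n → ℝ | x i = 0}) ∪ ⋃ ε, g ε '' openCorner n := by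
    intro x hx
    by_cases h0 : ∃ i, x i = 0
    · left; simpa using h0
    · right
      push Not at h0
      refine Set.mem_iUnion.2 ⟨fun i => decide (0 < x i), fun i => |x i|,
        ⟨fun i => abs_pos.2 (h0 i), hx⟩, ?_⟩
      ext i
      simp only [g, Matrix.toLin'_apply, Matrix.mulVec_diagonal, decide_eq_true_eq]
      split_ifs with hi
      · rw [abs_of_pos hi, one_mul]
      · rw [abs_of_nonpos (not_lt.1 hi)]; ring
  have hnull : volume (⋃ i, {x : Fin n → ℝ | x i = 0}) = 0 :=
    measure_iUnion_null fun i => Measure.pi_hyperplane (fun _ => (volume : Measure ℝ)) i 0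
  have hle : ENNReal.ofReal (2 ^ n / n.factorial) ≤ 2 ^ n * volume (openCorner n) := by
    rw [← hcross]
    calc _ ≤ _ := measure_mono hsub
      _ ≤ _ := measure_union_le _ _
      _ = volume (⋃ ε, g ε '' openCorner n) := by rw [hnull, zero_add]
      _ ≤ ∑ ε, volume (g ε '' openCorner n) := measure_iUnion_fintype_le _ _
      _ = _ := by simp [hvol]
  have h2 : ENNReal.ofReal (2 ^ n / n.factorial) = 2 ^ n * ENNReal.ofReal (1 / n.factorial) := by
    rw [div_eq_mul_one_div, ENNReal.ofReal_mul (by positivity), ENNReal.ofReal_pow (by norm_num)]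
    simp
  rw [h2] at hle
  exact (ENNReal.mul_le_mul_iff_right (by positivity) (by finiteness)).1 hle

/-- The open simplex with vertices `0` and the elements of a basis `F`, whose elements are the
`k f`-fold multiples of lattice vectors. -/
lemma exists_openSimplex {n : ℕ} (F : Finset (Fin n → ℝ)) (k : (Fin n → ℝ) → ℕ)
    (hF : ∀ c : (Fin n → ℝ) → ℝ, vecComb F c = 0 → ∀ f ∈ F, c f = 0)
    (hFs : Submodule.span ℝ (F : Set (Fin n → ℝ)) = ⊤)
    (hk : ∀ f ∈ F, ∃ g : ℕ, ∃ z : Fin n → ℤ, k f ≤ g ∧ f = fun i => (g : ℝ) * z i) :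
    ∃ U : Set (Fin n → ℝ), MeasurableSet U ∧
      (∀ x ∈ U, ∃ c : (Fin n → ℝ) → ℝ, (∀ f ∈ F, 0 < c f) ∧ ∑ f ∈ F, c f < 1 ∧
        x = vecComb F c) ∧
      ENNReal.ofReal ((∏ f ∈ F, k f : ℕ) / n.factorial) ≤ volume U := by
  classical
  have hli : LinearIndepOn ℝ id (F : Set (Fin n → ℝ)) :=
    linearIndepOn_finset_iff.2 fun c hc => hF c hc
  have hcard : F.card = n := by
    rw [← finrank_span_finset_eq_card hli, hFs]
    simp
  let e : Fin n ≃ F := (Finset.equivFinOfCardEq hcard).symm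
  have hsum : ∀ {M : Type} [AddCommMonoid M] (φ : (Fin n → ℝ) → M),
      ∑ f ∈ F, φ f = ∑ j, φ (e j) := by
    intro M _ φ
    rw [← Finset.sum_coe_sort F φ]
    exact (Equiv.sum_comp e fun f : F => φ f).symm
  have hprod : ∏ f ∈ F, k f = ∏ j, k (e j) := by
    rw [← Finset.prod_coe_sort F k]
    exact (Equiv.prod_comp e fun f : F => k f).symm
  let M : Matrix (Fin n) (Fin n) ℝ := Matrix.of fun i j => (e j : Fin n → ℝ) i
  have hext : ∀ x : Fin n → ℝ, ∃ c : (Fin n → ℝ) → ℝ, (∀ j, c (e j) = x j) := fun x =>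
    ⟨fun f => if h : f ∈ F then x (e.symm ⟨f, h⟩) else 0, fun j => by simp⟩
  have hM : ∀ (x : Fin n → ℝ) (c : (Fin n → ℝ) → ℝ), (∀ j, c (e j) = x j) →
      Matrix.toLin' M x = vecComb F c := by
    intro x c hc
    rw [vecComb, hsum]
    ext i
    simp [M, Matrix.mulVec, dotProduct, hc, mul_comm]
  have hinj : Function.Injective (Matrix.toLin' M) := by
    rw [← LinearMap.ker_eq_bot, LinearMap.ker_eq_bot']
    intro x hx
    obtain ⟨c, hc⟩ := hext x
    rw [hM x c hc] at hx
    ext j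
    rw [← hc j]
    exact hF c hx _ (e j).2
  have hdet : M.det ≠ 0 := by
    have : IsUnit M := Matrix.mulVec_injective_iff_isUnit.1 hinj
    exact ((Matrix.isUnit_iff_isUnit_det _).1 this).ne_zero
  have hdet' : ((∏ f ∈ F, k f : ℕ) : ℝ) ≤ |M.det| := by
    choose! g z hg hz using hk
    let Z : Matrix (Fin n) (Fin n) ℤ := Matrix.of fun i j => z (e j) i
    have h1 : M = Matrix.of fun i j => (g (e j) : ℝ) * (Z.map (Int.cast : ℤ → ℝ)) i j := by
      ext i j
      exact congrFun (hz _ (e j).2) i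
    have h2 : M.det = (∏ j, (g (e j) : ℝ)) * (Z.det : ℝ) := by
      rw [h1, Matrix.det_mul_row]
      congr 1
      exact (Int.cast_det Z).symm
    have h3 : Z.det ≠ 0 := fun h => hdet (by rw [h2, h]; simp)
    have h4 : (1 : ℝ) ≤ |(Z.det : ℝ)| := by
      exact_mod_cast Int.one_le_abs h3
    rw [h2, abs_mul, hprod, Finset.abs_prod, Nat.cast_prod]
    calc ∏ j, (k (e j) : ℝ) ≤ ∏ j, |(g (e j) : ℝ)| :=
          Finset.prod_le_prod (fun _ _ => by positivity) fun j _ => by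
            rw [abs_of_nonneg (by positivity)]
            exact_mod_cast hg _ (e j).2
      _ ≤ _ := le_mul_of_one_le_right (Finset.prod_nonneg fun _ _ => abs_nonneg _) h4
  refine ⟨Matrix.toLin' M '' openCorner n, ?_, ?_, ?_⟩
  · exact (isOpen_openCorner n).measurableSet.image_of_continuousOn_injOn
      (LinearMap.continuous_of_finiteDimensional _).continuousOn hinj.injOn
  · rintro _ ⟨x, ⟨hx, hx1⟩, rfl⟩
    obtain ⟨c, hc⟩ := hext x
    refine ⟨c, fun f hf => ?_, ?_, hM x c hc⟩
    · have := hc (e.symm ⟨f, hf⟩)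
      rw [e.apply_symm_apply] at this
      rw [this]
      exact hx _
    · rw [hsum]
      simpa [hc] using hx1
  · rw [Measure.addHaar_image_linearMap, LinearMap.det_toLin', div_eq_mul_one_div,
      ENNReal.ofReal_mul (by positivity)]
    exact mul_le_mul' (ENNReal.ofReal_le_ofReal hdet') (le_volume_openCorner n)

end Volume

section Rays

/-- The number of points of `A` on the half-open segment from the origin to `f`. -/
noncomputable def rayCount {n : ℕ} (A : Finset (Fin n → ℤ)) (f : Fin n → ℝ) : ℕ := by
  classical
  exact (A.filter fun a => ∃ c : ℝ, 0 < c ∧ c ≤ 1 ∧ (fun i => (a i : ℝ)) = c • f).card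

lemma exists_rayCount_le {n : ℕ} (A : Finset (Fin n → ℤ)) {t : Fin n → ℤ} (ht : t ≠ 0) :
    ∃ g : ℕ, ∃ z : Fin n → ℤ, rayCount A (fun i => (t i : ℝ)) ≤ g ∧
      (fun i => (t i : ℝ)) = fun i => (g : ℝ) * z i := by
  classical
  obtain ⟨u, hu⟩ := Finset.gcd_eq_sum_mul Finset.univ t
  set g := Finset.univ.gcd t with hg
  have hg0 : 0 < g := by
    refine lt_of_le_of_ne ?_ fun h => ht ?_
    · exact Int.nonneg_of_normalize_eq_self Finset.normalize_gcd
    · ext i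
      exact Finset.gcd_eq_zero_iff.1 h.symm i (Finset.mem_univ i)
  have hdvd : ∀ i, ∃ z, t i = g * z := fun i => Finset.gcd_dvd (Finset.mem_univ i)
  choose z hz using hdvd
  have hgc : ((g.toNat : ℕ) : ℝ) = (g : ℝ) := by
    exact_mod_cast Int.toNat_of_nonneg hg0.le
  refine ⟨g.toNat, z, ?_, ?_⟩
  · have hφ : ∀ a : Fin n → ℤ, ∀ c : ℝ, (fun i => (a i : ℝ)) = c • (fun i => (t i : ℝ)) →
        ((∑ i, a i * u i : ℤ) : ℝ) = c * g := by
      intro a c h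
      rw [hu]
      push_cast
      rw [Finset.mul_sum]
      refine Finset.sum_congr rfl fun i _ => ?_
      have := congrFun h i
      simp only [Pi.smul_apply, smul_eq_mul] at this
      rw [this]; ring
    have hgR : (0 : ℝ) < g := by exact_mod_cast hg0
    have hcard : (Finset.Icc 1 g).card = g.toNat := by simp
    rw [← hcard, rayCount]
    refine Finset.card_le_card_of_injOn (fun a => ∑ i, a i * u i) ?_ ?_
    · intro a ha
      obtain ⟨-, c, hc0, hc1, hc⟩ := Finset.mem_filter.1 ha
      have h := hφ a c hc
      simp only [Finset.coe_Icc, Set.mem_Icc]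
      constructor
      · have : (0 : ℝ) < ((∑ i, a i * u i : ℤ) : ℝ) := by rw [h]; positivity
        have : 0 < ∑ i, a i * u i := by exact_mod_cast this
        omega
      · have : ((∑ i, a i * u i : ℤ) : ℝ) ≤ g := by rw [h]; nlinarith
        exact_mod_cast this
    · intro a ha b hb hab
      obtain ⟨-, c, -, -, hc⟩ := Finset.mem_filter.1 ha
      obtain ⟨-, d, -, -, hd⟩ := Finset.mem_filter.1 hb
      simp only at hab
      have h1 := hφ a c hc
      have h2 := hφ b d hd
      rw [hab, h2] at h1
      have hcd : d = c := mul_right_cancel₀ hgR.ne' h1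
      ext i
      have := congrFun (hc.trans (hcd ▸ hd.symm)) i
      exact_mod_cast this
  · ext i
    rw [hgc, hz i]
    push_cast
    ring

end Rays

lemma Finset.one_add_sum_le_prod_one_add_nat {ι : Type*} (s : Finset ι) (j : ι → ℕ) :
    1 + ∑ i ∈ s, j i ≤ ∏ i ∈ s, (1 + j i) := by
  classical
  induction s using Finset.induction_on with
  | empty => simp
  | insert a s ha ih =>
    rw [Finset.sum_insert ha, Finset.prod_insert ha]
    nlinarith [Nat.zero_le (j a), Nat.zero_le (∑ i ∈ s, j i), mul_le_mul_right ih (1 + j a)]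

lemma Finset.sum_biUnion_le_nat {α β : Type*} [DecidableEq β] (s : Finset α) (t : α → Finset β)
    (j : β → ℕ) : ∑ i ∈ s.biUnion t, j i ≤ ∑ a ∈ s, ∑ x ∈ t a, j x := by
  classical
  induction s using Finset.induction_on with
  | empty => simp
  | insert a s ha ih =>
    rw [Finset.sum_insert ha, Finset.biUnion_insert]
    have := Finset.sum_union_inter (s₁ := t a) (s₂ := s.biUnion t) (f := j)
    omega

section LatticePolytope

/-- The inclusion of `ℤ^n` into `ℝ^n`. -/
def latticeVec {n : ℕ} (z : Fin n → ℤ) : Fin n → ℝ := fun i => (z i : ℝ)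

lemma latticeVec_injective {n : ℕ} : Function.Injective (latticeVec (n := n)) := fun a b h => by
  ext i
  exact Int.cast_injective (congrFun h i)

lemma latticeVec_eq_zero {n : ℕ} {z : Fin n → ℤ} : latticeVec z = 0 ↔ z = 0 := by
  have h : latticeVec (0 : Fin n → ℤ) = 0 := by ext i; simp [latticeVec]
  exact ⟨fun hz => latticeVec_injective (hz.trans h.symm), fun hz => hz ▸ h⟩

/-- Every nonzero point of a finite set lies on the segment from the origin to an outermost
point of the set. -/
lemma exists_outermost {n : ℕ} (A : Finset (Fin n → ℤ)) {a : Fin n → ℤ} (ha : a ∈ A)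
    (ha0 : a ≠ 0) : ∃ t ∈ A, t ≠ 0 ∧
      (∀ b ∈ A, ∀ c : ℝ, 0 < c → latticeVec b = c • latticeVec t → c ≤ 1) ∧
      ∃ c : ℝ, 0 < c ∧ c ≤ 1 ∧ latticeVec a = c • latticeVec t := by
  classical
  have hpos : ∀ {z : Fin n → ℤ}, z ≠ 0 → 0 < ‖latticeVec z‖ := fun hz =>
    norm_pos_iff.2 fun h => hz (latticeVec_eq_zero.1 h)
  obtain ⟨t, ht, hmax⟩ := Finset.exists_max_image
    (A.filter fun b => ∃ c : ℝ, 0 < c ∧ latticeVec b = c • latticeVec a)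
    (fun b => ‖latticeVec b‖) ⟨a, by simpa [ha] using ⟨1, one_pos, by simp⟩⟩
  obtain ⟨htA, c₀, hc₀, htc⟩ := Finset.mem_filter.1 ht
  have ht0 : t ≠ 0 := by
    rintro rfl
    rw [latticeVec_eq_zero.2 rfl] at htc
    rcases smul_eq_zero.1 htc.symm with h | h
    · exact hc₀.ne' h
    · exact ha0 (latticeVec_eq_zero.1 h)
  have hout : ∀ b ∈ A, ∀ c : ℝ, 0 < c → latticeVec b = c • latticeVec t → c ≤ 1 := by
    intro b hb c hc h
    have h1 := hmax b (Finset.mem_filter.2 ⟨hb, c * c₀, by positivity, by rw [h, htc, smul_smul]⟩)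
    rw [h, norm_smul, Real.norm_of_nonneg hc.le] at h1
    exact le_of_mul_le_mul_right (by simpa using h1) (hpos ht0)
  have hinv : latticeVec a = c₀⁻¹ • latticeVec t := by
    rw [htc, smul_smul, inv_mul_cancel₀ hc₀.ne', one_smul]
  exact ⟨t, htA, ht0, hout, c₀⁻¹, by positivity, hout a ha _ (by positivity) hinv, hinv⟩

lemma convex_setOf_vecComb {n : ℕ} (S : Finset (Fin n → ℝ)) :
    Convex ℝ {x | ∃ c : (Fin n → ℝ) → ℝ, (∀ s ∈ S, 0 ≤ c s) ∧ x = vecComb S c} := by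
  rintro _ ⟨c, hc, rfl⟩ _ ⟨d, hd, rfl⟩ a b ha hb -
  refine ⟨a • c + b • d, fun s hs => ?_, ?_⟩
  · have := hc s hs
    have := hd s hs
    simp only [Pi.add_apply, Pi.smul_apply, smul_eq_mul]
    positivity
  · rw [vecComb_add, vecComb_smul, vecComb_smul]

lemma vecComb_mem_of_convex {n : ℕ} {Q : Set (Fin n → ℝ)} (hQ : Convex ℝ Q) (h0 : 0 ∈ Q)
    {F : Finset (Fin n → ℝ)} (hF : ∀ f ∈ F, f ∈ Q) {c : (Fin n → ℝ) → ℝ}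
    (hc : ∀ f ∈ F, 0 ≤ c f) (hc1 : ∑ f ∈ F, c f ≤ 1) : vecComb F c ∈ Q := by
  have h := hQ.sum_mem (t := Finset.univ) (w := fun o : Option F => o.elim (1 - ∑ f ∈ F, c f)
    fun f => c f) (z := fun o => o.elim 0 fun f => (f : Fin n → ℝ)) ?_ ?_ ?_
  · rw [Fintype.sum_option] at h
    simpa [vecComb, ← Finset.sum_coe_sort F] using h
  · rintro (_ | f) -
    · simpa using hc1
    · exact hc f f.2
  · rw [Fintype.sum_option]
    simp [← Finset.sum_coe_sort F c]
  · rintro (_ | f) -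
    · exact h0
    · exact hF f f.2

/-- The main inequality, for a polytope with the origin in its interior. -/
lemma card_sub_one_le_volume {n : ℕ} {Q : Set (Fin n → ℝ)} (hQ : Convex ℝ Q)
    (h0 : 0 ∈ interior Q) (A : Finset (Fin n → ℤ)) (hA : ∀ a ∈ A, latticeVec a ∈ Q)
    (hQA : Q ⊆ convexHull ℝ (latticeVec '' (A : Set (Fin n → ℤ)))) :
    ENNReal.ofReal (((A.card - 1 : ℕ) : ℝ) / n.factorial) ≤ MeasureTheory.volume Q := by
  classical
  have h0Q : (0 : Fin n → ℝ) ∈ Q := interior_subset h0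
  let T₀ := A.filter fun t => t ≠ 0 ∧
    ∀ b ∈ A, ∀ c : ℝ, 0 < c → latticeVec b = c • latticeVec t → c ≤ 1
  let T := T₀.image latticeVec
  have hTmem : ∀ f ∈ T, ∃ t ∈ A, t ≠ 0 ∧
      (∀ b ∈ A, ∀ c : ℝ, 0 < c → latticeVec b = c • latticeVec t → c ≤ 1) ∧
      latticeVec t = f := by
    intro f hf
    obtain ⟨t, ht, rfl⟩ := Finset.mem_image.1 hf
    obtain ⟨h1, h2, h3⟩ := Finset.mem_filter.1 ht
    exact ⟨t, h1, h2, h3, rfl⟩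
  have hTQ : ∀ f ∈ T, f ∈ Q := by
    intro f hf
    obtain ⟨t, ht, -, -, rfl⟩ := hTmem f hf
    exact hA t ht
  have hout : ∀ a ∈ A, a ≠ 0 →
      ∃ f ∈ T, ∃ c : ℝ, 0 < c ∧ c ≤ 1 ∧ latticeVec a = c • f := by
    intro a ha ha0
    obtain ⟨t, htA, ht0, h1, h2⟩ := exists_outermost A ha ha0
    exact ⟨_, Finset.mem_image_of_mem _ (Finset.mem_filter.2 ⟨htA, ht0, h1⟩), h2⟩
  have hcone : Q ⊆ {x | ∃ c : (Fin n → ℝ) → ℝ, (∀ s ∈ T, 0 ≤ c s) ∧ x = vecComb T c} := by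
    refine hQA.trans (convexHull_min ?_ (convex_setOf_vecComb T))
    rintro _ ⟨a, ha, rfl⟩
    by_cases ha0 : a = 0
    · exact ⟨0, by simp, by simp [vecComb, latticeVec_eq_zero.2 ha0]⟩
    · obtain ⟨f, hf, c, hc, -, h⟩ := hout a ha ha0
      refine ⟨Pi.single f c, fun s _ => ?_, by simp [vecComb, Pi.single_apply, hf, h]⟩
      rw [Pi.single_apply]
      split_ifs <;> linarith
  have hspan : ∀ x : Fin n → ℝ, ∃ c : (Fin n → ℝ) → ℝ, (∀ s ∈ T, 0 ≤ c s) ∧ x = vecComb T c := by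
    intro x
    have htend : Filter.Tendsto (fun r : ℝ => r • x) (nhdsWithin 0 (Set.Ioi 0)) (nhds 0) := by
      have : Filter.Tendsto (fun r : ℝ => r • x) (nhds 0) (nhds ((0 : ℝ) • x)) :=
        (continuous_id.smul continuous_const).tendsto 0
      rw [zero_smul] at this
      exact this.mono_left nhdsWithin_le_nhds
    obtain ⟨r, hrQ, hr⟩ := ((htend.eventually (mem_interior_iff_mem_nhds.1 h0)).and
      self_mem_nhdsWithin).exists
    have hr : 0 < r := hr
    obtain ⟨c, hc, h⟩ := hcone hrQ
    refine ⟨r⁻¹ • c, fun s hs => mul_nonneg (by positivity) (hc s hs), ?_⟩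
    rw [vecComb_smul, ← h, smul_smul, inv_mul_cancel₀ hr.ne', one_smul]
  obtain ⟨D, hD, hDT, hcard⟩ := exists_fan_generators_eq T hspan
    (fun h => by
      obtain ⟨t, -, ht0, -, ht⟩ := hTmem 0 h
      exact ht0 (latticeVec_eq_zero.1 ht))
    (fun s hs t ht a ha hst => by
      obtain ⟨s', hsA, -, hs1, rfl⟩ := hTmem s hs
      obtain ⟨t', htA, -, ht1, rfl⟩ := hTmem t ht
      have h1 : a ≤ 1 := ht1 s' hsA a ha hst
      have h2 : a⁻¹ ≤ 1 := hs1 t' htA a⁻¹ (by positivity) (by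
        rw [hst, smul_smul, inv_mul_cancel₀ ha.ne', one_smul])
      have h3 : a = 1 := le_antisymm h1 ((inv_le_one₀ ha).1 h2)
      rw [hst, h3, one_smul])
  have hFT : ∀ F ∈ D, ∀ f ∈ F, f ∈ T := fun F hF f hf =>
    (hDT f).2 ⟨F, hF, hf⟩
  have hDT' : D.biUnion id = T := by
    ext f
    simp [hDT f]
  set k := rayCount A with hk
  have hex := fun (F : Finset (Fin n → ℝ)) (hF : F ∈ D) => exists_openSimplex F k
    (fun c hc => hD.indep F hF c (by simpa using hc)) (by simpa using hD.span F hF)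
    (fun f hf => by
      obtain ⟨t, -, ht0, -, rfl⟩ := hTmem f (hFT F hF f hf)
      exact exists_rayCount_le A ht0)
  choose! U hUm hU hUvol using hex
  have hdisj : (D : Set (Finset (Fin n → ℝ))).PairwiseDisjoint U := by
    intro F hF G hG hne
    rw [Function.onFun, Set.disjoint_left]
    intro x hxF hxG
    obtain ⟨c, hc, -, hx⟩ := hU F hF x hxF
    obtain ⟨d, hd, -, hx'⟩ := hU G hG x hxG
    exact hne (hD.disj F hF G hG c d hc hd (by simp [← hx, ← hx']))
  have hsub : (⋃ F ∈ D, U F) ⊆ Q := by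
    refine Set.iUnion₂_subset fun F hF x hx => ?_
    obtain ⟨c, hc, hc1, rfl⟩ := hU F hF x hx
    exact vecComb_mem_of_convex hQ h0Q (fun f hf => hTQ f (hFT F hF f hf))
      (fun f hf => (hc f hf).le) hc1.le
  have hk1 : ∀ f ∈ T, 1 ≤ k f := by
    intro f hf
    obtain ⟨t, ht, -, -, rfl⟩ := hTmem f hf
    rw [hk, rayCount, Nat.one_le_iff_ne_zero, ← Nat.pos_iff_ne_zero, Finset.card_pos]
    exact ⟨t, Finset.mem_filter.2 ⟨ht, 1, one_pos, le_rfl, (one_smul _ _).symm⟩⟩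
  have hAk : A.card - 1 ≤ ∑ f ∈ T, k f := by
    have h1 : A.erase 0 ⊆ T.biUnion fun f => A.filter fun a =>
        ∃ c : ℝ, 0 < c ∧ c ≤ 1 ∧ (fun i => (a i : ℝ)) = c • f := by
      intro a ha
      obtain ⟨ha0, ha⟩ := Finset.mem_erase.1 ha
      obtain ⟨f, hf, h⟩ := hout a ha ha0
      exact Finset.mem_biUnion.2 ⟨f, hf, Finset.mem_filter.2 ⟨ha, h⟩⟩
    exact Finset.pred_card_le_card_erase.trans
      ((Finset.card_le_card h1).trans Finset.card_biUnion_le)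
  have hcount : A.card - 1 ≤ ∑ F ∈ D, ∏ f ∈ F, k f := by
    calc A.card - 1 ≤ ∑ f ∈ T, k f := hAk
      _ = ∑ f ∈ T, (1 + (k f - 1)) := Finset.sum_congr rfl fun f hf => by
          have := hk1 f hf
          omega
      _ = T.card + ∑ f ∈ D.biUnion id, (k f - 1) := by
          rw [Finset.sum_add_distrib, hDT']; simp
      _ ≤ D.card + ∑ F ∈ D, ∑ f ∈ F, (k f - 1) :=
          add_le_add hcard (Finset.sum_biUnion_le_nat D id _)
      _ = ∑ F ∈ D, (1 + ∑ f ∈ F, (k f - 1)) := by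
          rw [Finset.sum_add_distrib]; simp
      _ ≤ ∑ F ∈ D, ∏ f ∈ F, (1 + (k f - 1)) :=
          Finset.sum_le_sum fun F _ => Finset.one_add_sum_le_prod_one_add_nat F _
      _ = ∑ F ∈ D, ∏ f ∈ F, k f := Finset.sum_congr rfl fun F hF =>
          Finset.prod_congr rfl fun f hf => by
            have := hk1 f (hFT F hF f hf)
            omega
  calc ENNReal.ofReal (((A.card - 1 : ℕ) : ℝ) / n.factorial)
      ≤ ENNReal.ofReal (∑ F ∈ D, ((∏ f ∈ F, k f : ℕ) : ℝ) / n.factorial) := by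
        refine ENNReal.ofReal_le_ofReal ?_
        rw [← Finset.sum_div]
        gcongr
        exact_mod_cast hcount
    _ = ∑ F ∈ D, ENNReal.ofReal (((∏ f ∈ F, k f : ℕ) : ℝ) / n.factorial) :=
        ENNReal.ofReal_sum_of_nonneg fun _ _ => by positivity
    _ ≤ ∑ F ∈ D, MeasureTheory.volume (U F) := Finset.sum_le_sum fun F hF => hUvol F hF
    _ = MeasureTheory.volume (⋃ F ∈ D, U F) :=
        (MeasureTheory.measure_biUnion_finset hdisj fun F hF => hUm F hF).symm
    _ ≤ _ := MeasureTheory.measure_mono hsub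

end LatticePolytope

/-- A lattice polytope `P ⊆ ℝ^n` with a lattice point in its interior
has normalized volume at least `N - 1`, where `N` is the number of lattice points of `P`. -/
theorem normalized_volume_ge_card_latticePoints_sub_one
    (n : ℕ) (hn : 1 ≤ n) (s : Finset (Fin n → ℤ)) (P : Set (Fin n → ℝ))
    (hP : P = convexHull ℝ ((fun v : Fin n → ℤ => fun i => (v i : ℝ)) '' (s : Set (Fin n → ℤ))))
    (hint : ∃ v : Fin n → ℤ, (fun i => (v i : ℝ)) ∈ interior P) :
    (({v : Fin n → ℤ | (fun i => (v i : ℝ)) ∈ P}.ncard : ℝ) - 1) ≤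
      (n.factorial : ℝ) * (MeasureTheory.volume P).toReal := by
  classical
  by_cases hfin : {v : Fin n → ℤ | (fun i => (v i : ℝ)) ∈ P}.Finite
  swap
  · rw [Set.Infinite.ncard hfin]
    have : 0 ≤ (n.factorial : ℝ) * (MeasureTheory.volume P).toReal := by positivity
    push_cast
    linarith
  obtain ⟨v, hv⟩ := hint
  have hsub : ∀ z : Fin n → ℤ, latticeVec (z - v) = -latticeVec v + latticeVec z := fun z => by
    ext i
    simp only [latticeVec, Pi.sub_apply, Pi.add_apply, Pi.neg_apply]
    push_cast
    ring
  set Q : Set (Fin n → ℝ) := (fun x => latticeVec v + x) ⁻¹' P with hQ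
  have hvol : MeasureTheory.volume Q = MeasureTheory.volume P :=
    MeasureTheory.measure_preimage_add _ _ _
  have hPfin : MeasureTheory.volume P ≠ ⊤ := by
    rw [hP]
    exact ((s.finite_toSet.image _).isCompact_convexHull ℝ).measure_ne_top
  have hPconv : Convex ℝ P := hP ▸ convex_convexHull ℝ _
  have hQeq : Q = (fun x => -latticeVec v + x) '' P := by
    ext x
    simp only [hQ, Set.mem_preimage, Set.mem_image]
    exact ⟨fun h => ⟨_, h, by simp⟩, by rintro ⟨y, hy, rfl⟩; simpa using hy⟩
  set A := hfin.toFinset.image (fun z => z - v) with hA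
  have hAcard : A.card = {v : Fin n → ℤ | (fun i => (v i : ℝ)) ∈ P}.ncard := by
    rw [hA, Finset.card_image_of_injective _ sub_left_injective, Set.ncard_eq_toFinset_card _ hfin]
  have key := card_sub_one_le_volume (Q := Q) (hPconv.translate_preimage_right _) ?_ A ?_ ?_
  · rw [hvol, hAcard, ENNReal.ofReal_le_iff_le_toReal hPfin, div_le_iff₀ (by positivity)] at key
    rw [mul_comm]
    refine le_trans ?_ key
    have : {v : Fin n → ℤ | (fun i => (v i : ℝ)) ∈ P}.ncard ≤
        ({v : Fin n → ℤ | (fun i => (v i : ℝ)) ∈ P}.ncard - 1) + 1 := by omega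
    have : ({v : Fin n → ℤ | (fun i => (v i : ℝ)) ∈ P}.ncard : ℝ) ≤
        (({v : Fin n → ℤ | (fun i => (v i : ℝ)) ∈ P}.ncard - 1 : ℕ) : ℝ) + 1 := by
      exact_mod_cast this
    linarith
  · refine preimage_interior_subset_interior_preimage (by fun_prop) ?_
    rw [Set.mem_preimage, add_zero]
    exact hv
  · intro a ha
    obtain ⟨z, hz, rfl⟩ := Finset.mem_image.1 ha
    rw [hQ, Set.mem_preimage, hsub, add_neg_cancel_left]
    exact hfin.mem_toFinset.1 hz
  · have h1 : (fun x => -latticeVec v + x) '' P =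
        convexHull ℝ ((fun x => -latticeVec v + x) '' (latticeVec '' (s : Set (Fin n → ℤ)))) := by
      have := convexHull_vadd (𝕜 := ℝ) (-latticeVec v) (latticeVec '' (s : Set (Fin n → ℤ)))
      rw [hP]
      exact this.symm
    rw [hQeq, h1]
    refine convexHull_mono ?_
    rintro _ ⟨_, ⟨z, hz, rfl⟩, rfl⟩
    refine ⟨z - v, ?_, hsub z⟩
    refine Finset.mem_image_of_mem _ (hfin.mem_toFinset.2 ?_)
    rw [Set.mem_ofPred_eq, hP]
    exact subset_convexHull ℝ _ ⟨z, hz, rfl⟩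
end

section
/- Let k be a field, let Q be an affine monoid of *dimension d, let R = k[Q], let C denote the quotient of k[sat(Q)] by the image of k[Q] regarded as an R-module, and let m = p_{F₀} ⊆ R be the maximal monomial ideal, spanned by the monomials x^q with q ∈ Q∖F₀ where F₀ is the face of units of Q. Then for every i with 1 ≤ i < d, the local cohomology modules H^i_m(R) and H^{i−1}_m(C) are isomorphic as R-modules. -/
open scoped Pointwise

/-- The inclusion of monoids `Q ⊆ sat Q` as an additive monoid homomorphism. -/
def satIncl {N : ℕ} (Q : AddSubmonoid (ZN N)) : ↥Q →+ ↥(sat Q) :=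
  AddSubmonoid.inclusion (le_sat Q)

/-- The induced ring homomorphism `k[Q] →+* k[sat Q]`. -/
noncomputable def satMap (k : Type) [Field k] {N : ℕ} (Q : AddSubmonoid (ZN N)) :
    AddMonoidAlgebra k ↥Q →+* AddMonoidAlgebra k ↥(sat Q) :=
  AddMonoidAlgebra.mapDomainRingHom k (satIncl Q)

/-- `k[sat Q]` as a `k[Q]`-algebra (hence a `k[Q]`-module) via the inclusion
of monoids `Q ⊆ sat Q`. -/
noncomputable instance satAlg (k : Type) [Field k] {N : ℕ} (Q : AddSubmonoid (ZN N)) :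
    Algebra (AddMonoidAlgebra k ↥Q) (AddMonoidAlgebra k ↥(sat Q)) :=
  (satMap k Q).toAlgebra

/-- The monomial ideal `p_F ⊆ k[Q]`, spanned by the monomials `x^q` with `q ∈ Q ∖ F`.
(Since `F` is a face, the ideal generated by these monomials coincides with their
`k`-linear span.) -/
noncomputable def pIdeal (k : Type) [Field k] {N : ℕ} (Q F : AddSubmonoid (ZN N)) :
    Ideal (AddMonoidAlgebra k ↥Q) :=
  Ideal.span {x | ∃ q : ↥Q, (q : ZN N) ∉ F ∧ x = AddMonoidAlgebra.single q (1 : k)}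

/-- The quotient `C` of `k[sat Q]` by the image of `k[Q]`, as a `k[Q]`-module. -/
noncomputable abbrev holeModule (k : Type) [Field k] {N : ℕ} (Q : AddSubmonoid (ZN N)) :=
  AddMonoidAlgebra k ↥(sat Q) ⧸
    LinearMap.range (Algebra.linearMap (AddMonoidAlgebra k ↥Q) (AddMonoidAlgebra k ↥(sat Q)))

namespace LocalCohomologyIso

section Homological

open CategoryTheory Limits

variable {R : Type} [CommRing R]

/-- The contravariant functor `Hom(-, Y)`, viewed as a covariant functor to the opposite
category. -/
noncomputable abbrev homOp (Y : ModuleCat.{0} R) : ModuleCat.{0} R ⥤ (ModuleCat.{0} R)ᵒᵖ :=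
  ((linearYoneda R (ModuleCat.{0} R)).obj Y).rightOp

/-- The natural transformation `Hom(-, Z)ᵒᵖ ⟶ Hom(-, Y)ᵒᵖ` induced by `f : Y ⟶ Z`. -/
noncomputable abbrev homOpMap {Y Z : ModuleCat.{0} R} (f : Y ⟶ Z) : homOp Z ⟶ homOp Y :=
  NatTrans.rightOp ((linearYoneda R (ModuleCat.{0} R)).map f)

/-- The opposite of the sequence of cochain complexes `Hom(P, S)`. -/
noncomputable def homSeq (P : ChainComplex (ModuleCat.{0} R) ℕ)
    (S : ShortComplex (ModuleCat.{0} R)) :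
    ShortComplex (ChainComplex (ModuleCat.{0} R)ᵒᵖ ℕ) :=
  ShortComplex.mk
    ((NatTrans.mapHomologicalComplex (homOpMap S.g) (ComplexShape.down ℕ)).app P)
    ((NatTrans.mapHomologicalComplex (homOpMap S.f) (ComplexShape.down ℕ)).app P) (by
      rw [← NatTrans.comp_app, ← NatTrans.mapHomologicalComplex_comp]
      have : homOpMap S.g ≫ homOpMap S.f = 0 := by
        have h : homOpMap S.g ≫ homOpMap S.f = homOpMap (S.f ≫ S.g) := by
          simp only [homOpMap, Functor.map_comp]
          rfl
        rw [h, S.zero]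
        ext X
        simp
      rw [this]
      ext
      rfl)

lemma homSeq_shortExact (P : ChainComplex (ModuleCat.{0} R) ℕ) [∀ n, Projective (P.X n)]
    {S : ShortComplex (ModuleCat.{0} R)} (hS : S.ShortExact) : (homSeq P S).ShortExact := by
  apply HomologicalComplex.shortExact_of_degreewise_shortExact
  intro i
  have := hS.mono_f
  have := hS.epi_g
  have h0 (u : P.X i ⟶ S.X₁) : (u ≫ S.f) ≫ S.g = 0 := by simp
  have h : (ShortComplex.mk (((linearYoneda R (ModuleCat.{0} R)).map S.f).app (Opposite.op (P.X i)))
      (((linearYoneda R (ModuleCat.{0} R)).map S.g).app (Opposite.op (P.X i))) (by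
        ext u; exact h0 u)).ShortExact := by
    refine ModuleCat.shortComplex_shortExact _ ?_ ?_ ?_
    · intro u
      constructor
      · intro hu
        exact ⟨hS.exact.lift u hu, hS.exact.lift_f u hu⟩
      · rintro ⟨v, rfl⟩
        exact h0 v
    · intro u v huv
      exact (cancel_mono S.f).1 huv
    · intro u
      exact ⟨Projective.factorThru u S.g, Projective.factorThru_comp u S.g⟩
  exact h.op

/-- `homSeq P S` is functorial in `P`. -/
noncomputable def homSeqMap {P P' : ChainComplex (ModuleCat.{0} R) ℕ} (φ : P ⟶ P')
    (S : ShortComplex (ModuleCat.{0} R)) : homSeq P S ⟶ homSeq P' S where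
  τ₁ := ((homOp S.X₃).mapHomologicalComplex _).map φ
  τ₂ := ((homOp S.X₂).mapHomologicalComplex _).map φ
  τ₃ := ((homOp S.X₁).mapHomologicalComplex _).map φ
  comm₁₂ := (NatTrans.mapHomologicalComplex_naturality (homOpMap S.g) φ)
  comm₂₃ := (NatTrans.mapHomologicalComplex_naturality (homOpMap S.f) φ)

/-- `Ext^i(X, Y)`, as an object of the opposite category. -/
noncomputable abbrev extOp (i : ℕ) (X Y : ModuleCat.{0} R) : (ModuleCat.{0} R)ᵒᵖ :=
  ((homOp Y).leftDerived i).obj X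

/-- The connecting isomorphism attached to a short exact sequence whose middle term has
vanishing `Ext` in two consecutive degrees. -/
noncomputable def extOpIso {S : ShortComplex (ModuleCat.{0} R)} (hS : S.ShortExact)
    (X : ModuleCat.{0} R) (i : ℕ) (h1 : IsZero (extOp (i + 1) X S.X₂))
    (h0 : IsZero (extOp i X S.X₂)) :
    extOp (i + 1) X S.X₁ ≅ extOp i X S.X₃ :=
  (projectiveResolution X).isoLeftDerivedObj (homOp S.X₁) (i + 1) ≪≫
    (homSeq_shortExact (projectiveResolution X).complex hS).δIso (i + 1) i (by simp)
      (h1.of_iso ((projectiveResolution X).isoLeftDerivedObj (homOp S.X₂) (i + 1)).symm)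
      (h0.of_iso ((projectiveResolution X).isoLeftDerivedObj (homOp S.X₂) i).symm) ≪≫
    ((projectiveResolution X).isoLeftDerivedObj (homOp S.X₃) i).symm

lemma conj_comp_conj {C : Type*} [Category C] {A A' B B' U U' V V' : C} (a : A ≅ U) (a' : A' ≅ U')
    (b : B ≅ V) (b' : B' ≅ V') (m : U ⟶ U') (n : V ⟶ V') (d : U ⟶ V) (d' : U' ⟶ V')
    (h : d ≫ n = m ≫ d') :
    (a.hom ≫ m ≫ a'.inv) ≫ a'.hom ≫ d' ≫ b'.inv =
      (a.hom ≫ d ≫ b.inv) ≫ b.hom ≫ n ≫ b'.inv := by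
  simp only [Category.assoc, Iso.inv_hom_id_assoc]
  rw [← Category.assoc m, ← h, Category.assoc]

lemma extOpIso_naturality {S : ShortComplex (ModuleCat.{0} R)} (hS : S.ShortExact)
    {X X' : ModuleCat.{0} R} (f : X ⟶ X') (i : ℕ) (h1 : IsZero (extOp (i + 1) X S.X₂))
    (h0 : IsZero (extOp i X S.X₂)) (h1' : IsZero (extOp (i + 1) X' S.X₂))
    (h0' : IsZero (extOp i X' S.X₂)) :
    ((homOp S.X₁).leftDerived (i + 1)).map f ≫ (extOpIso hS X' i h1' h0').hom =
      (extOpIso hS X i h1 h0).hom ≫ ((homOp S.X₃).leftDerived i).map f := by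
  let φ := ProjectiveResolution.lift f (projectiveResolution X) (projectiveResolution X')
  have hφ : φ ≫ (projectiveResolution X').π =
      (projectiveResolution X).π ≫ (ChainComplex.single₀ _).map f :=
    ProjectiveResolution.lift_commutes _ _ _
  rw [Functor.leftDerived_map_eq _ _ f φ hφ, Functor.leftDerived_map_eq _ _ f φ hφ]
  have nat := HomologicalComplex.HomologySequence.δ_naturality
    (homSeqMap φ S) (homSeq_shortExact (projectiveResolution X).complex hS)
    (homSeq_shortExact (projectiveResolution X').complex hS) (i + 1) i (by simp)
  exact conj_comp_conj _ _ _ _ _ _ _ _ nat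

/-- `Ext^i(R/Jⁿ, M)` vanishes for all `n` and all `i < e`. -/
def DepthGE (J : Ideal R) (e : ℕ) (M : Type) [AddCommGroup M] [Module R M] : Prop :=
  ∀ i < e, ∀ n : ℕ, IsZero (extOp i (ModuleCat.of R (R ⧸ J ^ n)) (ModuleCat.of R M))

/-- The long exact sequence: vanishing of the outer terms forces vanishing of the middle one. -/
lemma isZero_extOp_middle {S : ShortComplex (ModuleCat.{0} R)} (hS : S.ShortExact)
    (X : ModuleCat.{0} R) (i : ℕ) (h₁ : IsZero (extOp i X S.X₁)) (h₃ : IsZero (extOp i X S.X₃)) :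
    IsZero (extOp i X S.X₂) := by
  let P := projectiveResolution X
  have ex := (homSeq_shortExact P.complex hS).homology_exact₂ i
  refine IsZero.of_iso ?_ (P.isoLeftDerivedObj (homOp S.X₂) i)
  exact ex.isZero_of_both_zeros
    ((h₃.of_iso (P.isoLeftDerivedObj (homOp S.X₃) i).symm).eq_of_src _ _)
    ((h₁.of_iso (P.isoLeftDerivedObj (homOp S.X₁) i).symm).eq_of_tgt _ _)

lemma epi_iso_comp_iso {C : Type*} [Category C] {A U V B : C} (a : A ≅ U) (b : B ≅ V)
    (m : U ⟶ V) (h : Epi m) : Epi (a.hom ≫ m ≫ b.inv) :=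
  inferInstance

lemma epi_leftDerived_homOpMap_zero {S : ShortComplex (ModuleCat.{0} R)} (hS : S.ShortExact)
    (X : ModuleCat.{0} R) : Epi ((NatTrans.leftDerived (homOpMap S.f) 0).app X) := by
  let P := projectiveResolution X
  rw [ProjectiveResolution.leftDerived_app_eq _ P]
  have : Epi (HomologicalComplex.homologyMap (homSeq P.complex S).g 0) := by
    have := (homSeq_shortExact P.complex hS).epi_g
    exact HomologicalComplex.epi_homologyMap_of_epi_of_not_rel _ _ (by simp)
  exact epi_iso_comp_iso _ _ _ this

lemma epi_leftDerived_homOpMap_succ {S : ShortComplex (ModuleCat.{0} R)} (hS : S.ShortExact)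
    (X : ModuleCat.{0} R) (i : ℕ) (h : IsZero (extOp i X S.X₃)) :
    Epi ((NatTrans.leftDerived (homOpMap S.f) (i + 1)).app X) := by
  let P := projectiveResolution X
  rw [ProjectiveResolution.leftDerived_app_eq _ P]
  have : Epi (HomologicalComplex.homologyMap (homSeq P.complex S).g (i + 1)) := by
    have := (homSeq_shortExact P.complex hS).homology_exact₃ (i + 1) i (by simp)
    exact this.epi_f ((h.of_iso (P.isoLeftDerivedObj (homOp S.X₃) i).symm).eq_of_tgt _ _)
  exact epi_iso_comp_iso _ _ _ this

lemma leftDerived_homOpMap_smul (x : R) (X M : ModuleCat.{0} R) (i : ℕ) :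
    (NatTrans.leftDerived (homOpMap (x • 𝟙 M)) i).app X =
      ((homOp M).leftDerived i).map (x • 𝟙 X) := by
  let P := projectiveResolution X
  have hP : (x • 𝟙 P.complex) ≫ P.π = P.π ≫ (ChainComplex.single₀ _).map (x • 𝟙 X) := by
    apply HomologicalComplex.to_single_hom_ext
    have h₁ (Y : ModuleCat.{0} R) (u : P.complex.X 0 ⟶ Y) :
        (x • 𝟙 (P.complex.X 0)) ≫ u = u ≫ (x • 𝟙 Y) := by
      rw [Linear.comp_smul, Linear.smul_comp, Category.comp_id, Category.id_comp]
    have h₂ : ((ChainComplex.single₀ (ModuleCat.{0} R)).map (x • 𝟙 X)).f 0 = x • 𝟙 X :=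
      ChainComplex.single₀_map_f_zero _
    rw [HomologicalComplex.comp_f, HomologicalComplex.comp_f, h₂]
    exact h₁ _ _
  rw [ProjectiveResolution.leftDerived_app_eq _ P,
    Functor.leftDerived_map_eq _ _ (x • 𝟙 X) (P := P) (Q := P) (x • 𝟙 P.complex) hP]
  congr 3
  ext j
  apply Quiver.Hom.unop_inj
  have h (u : P.complex.X j ⟶ M) : u ≫ (x • 𝟙 M) = (x • 𝟙 (P.complex.X j)) ≫ u := by
    rw [Linear.comp_smul, Linear.smul_comp, Category.comp_id, Category.id_comp]
  ext u
  exact h u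

lemma leftDerived_homOp_map_zero (X M : ModuleCat.{0} R) (i : ℕ) :
    ((homOp M).leftDerived i).map (0 : X ⟶ X) = 0 := by
  let P := projectiveResolution X
  rw [Functor.leftDerived_map_eq _ _ (0 : X ⟶ X) (P := P) (Q := P) 0 (by simp)]
  simp only [Functor.map_zero, zero_comp, comp_zero]

lemma isZero_of_epi_map_of_pow_eq_zero {C D : Type*} [Category C] [Category D] [Preadditive C]
    [Preadditive D] (F : C ⥤ D) {X : C} (hF : F.map (0 : X ⟶ X) = 0) (f : End X)
    (h : Epi (F.map f)) (n : ℕ) (hn : f ^ n = 0) : IsZero (F.obj X) := by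
  have key (m : ℕ) : Epi (F.map (f ^ m : End X)) := by
    induction m with
    | zero =>
      change Epi (F.map (𝟙 X))
      rw [F.map_id]
      infer_instance
    | succ m ih =>
      rw [pow_succ]
      change Epi (F.map (f ≫ (f ^ m : End X)))
      rw [F.map_comp]
      infer_instance
  have := key n
  rw [hn] at this
  change Epi (F.map (0 : X ⟶ X)) at this
  rw [hF] at this
  exact IsZero.of_epi_eq_zero (0 : F.obj X ⟶ F.obj X) rfl

namespace DepthGE

variable {J : Ideal R} {e : ℕ} {M M' M'' : Type} [AddCommGroup M] [Module R M]
  [AddCommGroup M'] [Module R M'] [AddCommGroup M''] [Module R M'']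

lemma zero_right (J : Ideal R) (M : Type) [AddCommGroup M] [Module R M] : DepthGE J 0 M :=
  fun i hi => absurd hi (Nat.not_lt_zero i)

lemma middle (f : M →ₗ[R] M') (g : M' →ₗ[R] M'') (hf : Function.Injective f)
    (hg : Function.Surjective g) (hfg : Function.Exact f g) (h₁ : DepthGE J e M)
    (h₃ : DepthGE J e M'') : DepthGE J e M' := fun i hi n =>
  isZero_extOp_middle (S := ShortComplex.mk (ModuleCat.ofHom f) (ModuleCat.ofHom g)
      (by ext; exact hfg.apply_apply_eq_zero _))
    (ModuleCat.shortComplex_shortExact _ hfg hf hg) _ i (h₁ i hi n) (h₃ i hi n)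

lemma of_subsingleton [Subsingleton M] : DepthGE J e M := fun i _ n => by
  let X := ModuleCat.of R (R ⧸ J ^ n)
  have hM : 𝟙 (homOp (ModuleCat.of R M)) = homOpMap ((0 : R) • 𝟙 (ModuleCat.of R M)) := by
    ext Y
    apply Quiver.Hom.unop_inj
    ext u
    exact (ModuleCat.isZero_of_subsingleton (ModuleCat.of R M)).eq_of_tgt _ _
  have h := leftDerived_homOpMap_smul 0 X (ModuleCat.of R M) i
  rw [← hM, NatTrans.leftDerived_id, zero_smul, leftDerived_homOp_map_zero] at h
  exact (IsZero.iff_id_eq_zero _).2 h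

lemma of_equiv (f : M ≃ₗ[R] M') (h : DepthGE J e M) : DepthGE J e M' :=
  middle (M'' := PUnit) f.toLinearMap 0 f.injective (fun _ => ⟨0, rfl⟩)
    (fun y => ⟨fun _ => f.surjective y, fun _ => rfl⟩) h of_subsingleton

lemma succ {x : R} (hx : x ∈ J) (g : M →ₗ[R] M') (hinj : ∀ m : M, x • m = 0 → m = 0)
    (hg : Function.Surjective g) (hker : ∀ m, g m = 0 ↔ ∃ m', x • m' = m)
    (h : DepthGE J e M') : DepthGE J (e + 1) M := by
  intro i hi n
  let S : ShortComplex (ModuleCat.{0} R) :=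
    ShortComplex.mk (x • 𝟙 (ModuleCat.of R M)) (ModuleCat.ofHom g)
      (by ext m; exact (hker _).2 ⟨m, rfl⟩)
  have hS : S.ShortExact := by
    refine ModuleCat.shortComplex_shortExact S hker ?_ hg
    exact (injective_iff_map_eq_zero (x • LinearMap.id : M →ₗ[R] M)).2 hinj
  have epi : Epi ((NatTrans.leftDerived (homOpMap S.f) i).app (ModuleCat.of R (R ⧸ J ^ n))) := by
    cases i with
    | zero => exact epi_leftDerived_homOpMap_zero hS _
    | succ i => exact epi_leftDerived_homOpMap_succ hS _ _ (h i (by lia) n)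
  have h' := leftDerived_homOpMap_smul x (ModuleCat.of R (R ⧸ J ^ n)) (ModuleCat.of R M) i
  rw [h'] at epi
  refine isZero_of_epi_map_of_pow_eq_zero ((homOp (ModuleCat.of R M)).leftDerived i)
    (leftDerived_homOp_map_zero _ _ _) (x • 𝟙 (ModuleCat.of R (R ⧸ J ^ n)) : End _) epi n ?_
  have hpow (m : ℕ) : (x • (1 : End (ModuleCat.of R (R ⧸ J ^ n)))) ^ m = x ^ m • 1 := by
    rw [smul_pow, one_pow]
  refine (hpow n).trans ?_
  apply ModuleCat.hom_ext
  ext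
  change x ^ n • (Submodule.Quotient.mk (1 : R) : R ⧸ J ^ n) = 0
  rw [← Submodule.Quotient.mk_smul, Submodule.Quotient.mk_eq_zero]
  simpa using Ideal.pow_mem_pow hx n

end DepthGE

lemma comp_inv_eq_inv_comp {C : Type*} [Category C] {A A' B B' : C} (e : A ≅ B) (e' : A' ≅ B')
    (m : A ⟶ A') (m' : B ⟶ B') (h : m ≫ e'.hom = e.hom ≫ m') :
    e.inv ≫ m = m' ≫ e'.inv := by
  rw [Iso.inv_comp_eq, ← Category.assoc, ← h, Category.assoc, Iso.hom_inv_id, Category.comp_id]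

lemma localCohomology_succ_iso (J : Ideal R) {S : ShortComplex (ModuleCat.{0} R)}
    (hS : S.ShortExact) {d : ℕ} (hd : DepthGE J d S.X₂) (i : ℕ) (hi : i + 1 < d) :
    Nonempty ((localCohomology J (i + 1)).obj S.X₁ ≅ (localCohomology J i).obj S.X₃) := by
  let I := localCohomology.idealPowersDiagram J
  let α : localCohomology.diagram I (i + 1) ⋙ (evaluation _ _).obj S.X₁ ≅
      localCohomology.diagram I i ⋙ (evaluation _ _).obj S.X₃ :=
    NatIso.ofComponents (fun n => (extOpIso hS ((localCohomology.ringModIdeals I).obj n.unop) i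
        (hd (i + 1) hi _) (hd i (by lia) _)).symm.unop) (by
      intro m n f
      apply Quiver.Hom.op_inj
      have := extOpIso_naturality hS ((localCohomology.ringModIdeals I).map f.unop) i
        (hd (i + 1) hi _) (hd i (by lia) _) (hd (i + 1) hi _) (hd i (by lia) _)
      exact comp_inv_eq_inv_comp _ _ _ _ this)
  exact ⟨colimitObjIsoColimitCompEvaluation _ _ ≪≫ HasColimit.isoOfNatIso α ≪≫
    (colimitObjIsoColimitCompEvaluation _ _).symm⟩

namespace DepthGE

variable {J : Ideal R} {e : ℕ} {M : Type} [AddCommGroup M] [Module R M] {A B C : Submodule R M}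

lemma subquotient_trans (hAB : A ≤ B) (hBC : B ≤ C) (h₁ : DepthGE J e (B ⧸ A.submoduleOf B))
    (h₃ : DepthGE J e (C ⧸ B.submoduleOf C)) : DepthGE J e (C ⧸ A.submoduleOf C) := by
  refine middle (Submodule.mapQ _ _ (Submodule.inclusion hBC) fun _ h => h)
    (Submodule.factor fun _ h => hAB h) ?_ ?_ ?_ h₁ h₃
  · refine (injective_iff_map_eq_zero _).2 fun b hb => ?_
    obtain ⟨b, rfl⟩ := Submodule.Quotient.mk_surjective _ b
    rw [Submodule.mapQ_apply, Submodule.Quotient.mk_eq_zero] at hb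
    exact (Submodule.Quotient.mk_eq_zero _).2 hb
  · intro c
    obtain ⟨c, rfl⟩ := Submodule.Quotient.mk_surjective _ c
    exact ⟨Submodule.Quotient.mk c, rfl⟩
  · intro c
    obtain ⟨c, rfl⟩ := Submodule.Quotient.mk_surjective _ c
    constructor
    · intro h
      replace h : (Submodule.Quotient.mk c : C ⧸ B.submoduleOf C) = 0 := h
      rw [Submodule.Quotient.mk_eq_zero] at h
      exact ⟨Submodule.Quotient.mk ⟨c, h⟩, rfl⟩
    · rintro ⟨b, hb⟩
      rw [← hb]
      obtain ⟨b, rfl⟩ := Submodule.Quotient.mk_surjective _ b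
      exact (Submodule.Quotient.mk_eq_zero _).2 b.2

lemma subquotient_succ {x : R} (hx : x ∈ J) (hAB : A ≤ B)
    (hinj : ∀ c ∈ C, x • c ∈ A → c ∈ A)
    (hker : ∀ c ∈ C, c ∈ B ↔ ∃ c' ∈ C, c - x • c' ∈ A)
    (h : DepthGE J e (C ⧸ B.submoduleOf C)) : DepthGE J (e + 1) (C ⧸ A.submoduleOf C) := by
  refine succ hx (Submodule.factor fun _ h => hAB h) ?_ ?_ ?_ h
  · intro c hc
    obtain ⟨c, rfl⟩ := Submodule.Quotient.mk_surjective _ c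
    rw [← Submodule.Quotient.mk_smul, Submodule.Quotient.mk_eq_zero] at hc
    exact (Submodule.Quotient.mk_eq_zero _).2 (hinj c c.2 hc)
  · intro c
    obtain ⟨c, rfl⟩ := Submodule.Quotient.mk_surjective _ c
    exact ⟨Submodule.Quotient.mk c, rfl⟩
  · intro c
    obtain ⟨c, rfl⟩ := Submodule.Quotient.mk_surjective _ c
    refine (Submodule.Quotient.mk_eq_zero _).trans ((hker c c.2).trans ⟨?_, ?_⟩)
    · rintro ⟨c', hc', h⟩
      have h' : c - x • ⟨c', hc'⟩ ∈ A.submoduleOf C := h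
      exact ⟨Submodule.Quotient.mk ⟨c', hc'⟩, ((Submodule.Quotient.eq _).2 h').symm⟩
    · rintro ⟨c', h⟩
      obtain ⟨c', rfl⟩ := Submodule.Quotient.mk_surjective _ c'
      exact ⟨c', c'.2, (Submodule.Quotient.eq (A.submoduleOf C)).1 h.symm⟩

end DepthGE

end Homological

section Regions

variable (k : Type) [Field k] {G : Type} [AddCommGroup G] (Q : AddSubmonoid G)

/-- The group algebra `k[G]` as an algebra over `k[Q]`. -/
noncomputable abbrev groupAlg : Algebra (AddMonoidAlgebra k Q) (AddMonoidAlgebra k G) :=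
  (AddMonoidAlgebra.mapDomainRingHom k Q.subtype).toAlgebra

attribute [local instance] groupAlg

variable {k Q} in
lemma single_smul_coeff (q : Q) (r : k) (a : AddMonoidAlgebra k G) (g : G) :
    ((AddMonoidAlgebra.single q r : AddMonoidAlgebra k Q) • a).coeff g = r * a.coeff (g - q) := by
  have : (AddMonoidAlgebra.single q r : AddMonoidAlgebra k Q) • a =
      AddMonoidAlgebra.single (q : G) r * a := by
    rw [Algebra.smul_def]
    congr 1
    exact AddMonoidAlgebra.mapDomain_single
  rw [this, AddMonoidAlgebra.coeff_single_mul_apply, neg_add_eq_sub]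

variable {Q} in
/-- The `k[Q]`-submodule of `k[G]` spanned by the monomials with exponent in the `Q`-stable
set `U`. -/
noncomputable def monomialSubmodule (U : Set G) (hU : ∀ q ∈ Q, ∀ u ∈ U, q + u ∈ U) :
    Submodule (AddMonoidAlgebra k Q) (AddMonoidAlgebra k G) where
  carrier := {a | ∀ g, g ∉ U → a.coeff g = 0}
  zero_mem' := fun _ _ => rfl
  add_mem' := fun {a b} ha hb g hg => by
    rw [AddMonoidAlgebra.coeff_add, Finsupp.add_apply, ha g hg, hb g hg, add_zero]
  smul_mem' := fun r a ha => by
    induction r using AddMonoidAlgebra.induction_linear with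
    | zero =>
      rw [zero_smul]
      exact fun _ _ => rfl
    | add r s hr hs =>
      rw [add_smul]
      intro g hg
      rw [AddMonoidAlgebra.coeff_add, Finsupp.add_apply, hr g hg, hs g hg, add_zero]
    | single q r =>
      intro g hg
      rw [single_smul_coeff, ha, mul_zero]
      intro h
      exact hg (by simpa using hU q q.2 _ h)

lemma monomialSubmodule_mono {U V : Set G} {hU : ∀ q ∈ Q, ∀ u ∈ U, q + u ∈ U}
    {hV : ∀ q ∈ Q, ∀ u ∈ V, q + u ∈ V} (h : U ⊆ V) :
    monomialSubmodule k U hU ≤ monomialSubmodule k V hV :=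
  fun _ ha g hg => ha g fun h' => hg (h h')

variable {Q} in
/-- Every subquotient of `k[G]` spanned by monomials with exponents in `D` has
depth at least `e`. -/
def GoodRegion (J : Ideal (AddMonoidAlgebra k Q)) (e : ℕ) (D : Set G) : Prop :=
  ∀ (U V : Set G) (hU : ∀ q ∈ Q, ∀ u ∈ U, q + u ∈ U) (hV : ∀ q ∈ Q, ∀ u ∈ V, q + u ∈ V),
    U ⊆ V → V \ U = D → DepthGE J e (monomialSubmodule k V hV ⧸
      (monomialSubmodule k U hU).submoduleOf (monomialSubmodule k V hV))

namespace GoodRegion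

variable {k Q} {J : Ideal (AddMonoidAlgebra k Q)} {e : ℕ} {D : Set G}

lemma zero_right (J : Ideal (AddMonoidAlgebra k Q)) (D : Set G) : GoodRegion k J 0 D :=
  fun _ _ _ _ _ _ => DepthGE.zero_right _ _

lemma empty : GoodRegion k J e (∅ : Set G) := by
  intro U V hU hV _ h
  have : Subsingleton (monomialSubmodule k V hV ⧸
      (monomialSubmodule k U hU).submoduleOf (monomialSubmodule k V hV)) := by
    rw [Submodule.Quotient.subsingleton_iff, eq_top_iff]
    exact fun a _ => monomialSubmodule_mono k Q (hU := hV) (hV := hU) (Set.sdiff_eq_empty.1 h) a.2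
  exact DepthGE.of_subsingleton

lemma of_inter_diff (D₁ : Set G) (hD₁ : ∀ d ∈ D, d ∈ D₁ → ∀ q ∈ Q, q + d ∈ D → q + d ∈ D₁)
    (h₁ : GoodRegion k J e (D ∩ D₁)) (h₂ : GoodRegion k J e (D \ D₁)) : GoodRegion k J e D := by
  intro U V hU hV hUV hD
  have hW : ∀ q ∈ Q, ∀ u ∈ U ∪ (D ∩ D₁), q + u ∈ U ∪ (D ∩ D₁) := by
    rintro q hq u (hu | ⟨hu, hu₁⟩)
    · exact Or.inl (hU q hq u hu)
    · by_cases h : q + u ∈ U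
      · exact Or.inl h
      · have : q + u ∈ D := hD ▸ ⟨hV q hq u (hD ▸ hu : u ∈ V \ U).1, h⟩
        exact Or.inr ⟨this, hD₁ u hu hu₁ q hq this⟩
  have hDV : D ⊆ V := hD ▸ Set.sdiff_subset
  refine DepthGE.subquotient_trans (B := monomialSubmodule k (U ∪ (D ∩ D₁)) hW)
    (monomialSubmodule_mono k Q Set.subset_union_left)
    (monomialSubmodule_mono k Q (Set.union_subset hUV (Set.inter_subset_left.trans hDV)))
    (h₁ _ _ _ _ Set.subset_union_left ?_)
    (h₂ _ _ _ _ (Set.union_subset hUV (Set.inter_subset_left.trans hDV)) ?_)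
  · subst hD
    ext x
    simp only [Set.mem_sdiff, Set.mem_union, Set.mem_inter_iff]
    tauto
  · subst hD
    ext x
    simp only [Set.mem_sdiff, Set.mem_union, Set.mem_inter_iff]
    tauto

lemma succ (f : Q) (hf : AddMonoidAlgebra.single f 1 ∈ J) (hfD : ∀ d ∈ D, (f : G) + d ∈ D)
    (h : GoodRegion k J e {d ∈ D | d - f ∉ D}) : GoodRegion k J (e + 1) D := by
  intro U V hU hV hUV hD
  have hDV : D ⊆ V := hD ▸ Set.sdiff_subset
  have hDU : ∀ d ∈ D, d ∉ U := fun d hd => (hD ▸ hd : d ∈ V \ U).2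
  have hVD : ∀ v ∈ V, v ∉ U → v ∈ D := fun v hv hvU => hD ▸ ⟨hv, hvU⟩
  have hW : ∀ q ∈ Q, ∀ u ∈ U ∪ {g | g - f ∈ D}, q + u ∈ U ∪ {g | g - f ∈ D} := by
    rintro q hq u (hu | hu)
    · exact Or.inl (hU q hq u hu)
    · by_cases h : q + (u - f) ∈ U
      · left
        have := hU f f.2 _ h
        rwa [show (f : G) + (q + (u - f)) = q + u by abel] at this
      · right
        have := hVD _ (hV q hq _ (hDV hu)) h
        rwa [← add_sub_assoc] at this
  have hWV : U ∪ {g | g - f ∈ D} ⊆ V := by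
    rintro g (hg | hg)
    · exact hUV hg
    · simpa using hDV (hfD _ hg)
  refine DepthGE.subquotient_succ (B := monomialSubmodule k _ hW) hf
    (monomialSubmodule_mono k Q Set.subset_union_left) ?_ ?_ (h _ _ _ _ hWV ?_)
  · intro c hc hfc g hg
    by_cases hgV : g ∈ V
    · have := hfc (f + g) (hDU _ (hfD g (hVD g hgV hg)))
      rwa [single_smul_coeff, one_mul, add_sub_cancel_left] at this
    · exact hc g hgV
  · intro c hc
    constructor
    · intro hcB
      classical
      let c' : AddMonoidAlgebra k G := .ofCoeff ((c.coeff.comapDomain (fun g => g + (f : G))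
        (add_left_injective _).injOn).filter (· ∈ D))
      have hc' (g : G) : c'.coeff g = if g ∈ D then c.coeff (g + f) else 0 :=
        Finsupp.filter_apply ..
      refine ⟨c', fun g hg => ?_, fun g hg => ?_⟩
      · rw [hc', if_neg fun h => hg (hDV h)]
      · rw [AddMonoidAlgebra.coeff_sub, Finsupp.sub_apply, single_smul_coeff, hc', one_mul]
        split_ifs with hgD
        · rw [sub_add_cancel, sub_self]
        · rw [sub_zero]
          exact hcB g (by rintro (h | h) <;> contradiction)
    · rintro ⟨c', hc', hcc'⟩ g hg
      have := hcc' g fun h => hg (Or.inl h)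
      rw [AddMonoidAlgebra.coeff_sub, Finsupp.sub_apply, single_smul_coeff, one_mul,
        sub_eq_zero] at this
      rw [this]
      by_contra hne
      have hgV : g - f ∈ V := by
        by_contra hgV
        exact hne (hc' _ hgV)
      refine hg ?_
      by_cases hgU : g - f ∈ U
      · left
        simpa using hU f f.2 _ hgU
      · exact Or.inr (hVD _ hgV hgU)
  · subst hD
    ext x
    simp only [Set.mem_sdiff, Set.mem_union, Set.mem_ofPred_eq]
    tauto

/-- A region is good if it is partitioned into finitely many good regions by a function that is
monotone with respect to translation by elements of `Q`. -/
lemma of_fibers {α : Type*} [LinearOrder α] (φ : G → α) (hfin : (φ '' D).Finite)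
    (hφ : ∀ d ∈ D, ∀ q ∈ Q, q + d ∈ D → φ d ≤ φ (q + d))
    (h : ∀ t, GoodRegion k J e {d ∈ D | φ d = t}) : GoodRegion k J e D := by
  obtain ⟨s, hs⟩ := hfin.exists_finset_coe
  induction s using Finset.induction_on_max generalizing D with
  | empty =>
    have : D = ∅ := by simpa using hs.symm
    exact this ▸ empty
  | insert t s hst ih =>
    have hDle : ∀ d ∈ D, φ d ≤ t := by
      intro d hd
      have : φ d ∈ ((insert t s : Finset α) : Set α) := hs ▸ ⟨d, hd, rfl⟩
      rcases Finset.mem_insert.1 this with h | h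
      · exact h.le
      · exact (hst _ h).le
    refine of_inter_diff {d | φ d = t} ?_ (h t) (ih ?_ ?_ ?_ ?_)
    · intro d hd hdt q hq hqd
      exact (hDle _ hqd).antisymm (hdt ▸ hφ d hd q hq hqd)
    · exact hfin.subset (Set.image_mono Set.sdiff_subset)
    · exact fun d hd q hq hqd => hφ d hd.1 q hq hqd.1
    · intro t'
      by_cases htt' : t' = t
      · convert empty
        ext d
        simp only [Set.mem_sdiff, Set.mem_ofPred_eq, Set.mem_empty_iff_false]
        aesop
      · convert h t' using 1
        ext d
        simp only [Set.mem_sdiff, Set.mem_ofPred_eq]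
        aesop
    · ext a
      constructor
      · intro ha
        have : a ∈ φ '' D := hs ▸ Finset.mem_coe.2 (Finset.mem_insert_of_mem ha)
        obtain ⟨d, hd, rfl⟩ := this
        exact ⟨d, ⟨hd, (hst _ ha).ne⟩, rfl⟩
      · rintro ⟨d, ⟨hd, hdt⟩, rfl⟩
        have : φ d ∈ ((insert t s : Finset α) : Set α) := hs ▸ ⟨d, hd, rfl⟩
        exact (Finset.mem_insert.1 this).resolve_left hdt

lemma of_fibers_of_eq {α : Type*} (φ : G → α) (hfin : (φ '' D).Finite)
    (hφ : ∀ d ∈ D, ∀ q ∈ Q, q + d ∈ D → φ d = φ (q + d))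
    (h : ∀ t, GoodRegion k J e {d ∈ D | φ d = t}) : GoodRegion k J e D := by
  obtain ⟨_, -⟩ := exists_wellFoundedLT α
  exact of_fibers φ hfin (fun d hd q hq hqd => (hφ d hd q hq hqd).le) h

end GoodRegion

end Regions

section Cones

variable {N : ℕ}

lemma toQ_zero : toQ (0 : ZN N) = 0 := by
  ext
  simp [toQ]

lemma toQ_add (x y : ZN N) : toQ (x + y) = toQ x + toQ y := by
  ext
  simp [toQ]

lemma toQ_sub (x y : ZN N) : toQ (x - y) = toQ x - toQ y := by
  ext
  simp [toQ]

lemma toQ_neg (x : ZN N) : toQ (-x) = -toQ x := by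
  ext
  simp [toQ]

lemma toQ_nsmul (n : ℕ) (x : ZN N) : toQ (n • x) = (n : ℚ) • toQ x := by
  ext
  simp [toQ]

lemma toQ_zsmul (n : ℤ) (x : ZN N) : toQ (n • x) = (n : ℚ) • toQ x := by
  ext
  simp [toQ]

lemma toQ_injective : Function.Injective (toQ : ZN N → Fin N → ℚ) := by
  intro x y h
  ext i
  exact Int.cast_injective (α := ℚ) (congrFun h i)

/-- A linear functional on `ℚ^N` taking integer values on `ℤ^N`. -/
def IsIntegral (φ : Module.Dual ℚ (Fin N → ℚ)) : Prop :=
  ∀ x : ZN N, ∃ m : ℤ, φ (toQ x) = m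

lemma IsIntegral.smul_sub_smul {φ ψ : Module.Dual ℚ (Fin N → ℚ)} (hφ : IsIntegral φ)
    (hψ : IsIntegral ψ) (a : ZN N) : IsIntegral (φ (toQ a) • ψ - ψ (toQ a) • φ) := by
  intro x
  obtain ⟨m₁, h₁⟩ := hφ a
  obtain ⟨m₂, h₂⟩ := hψ x
  obtain ⟨m₃, h₃⟩ := hψ a
  obtain ⟨m₄, h₄⟩ := hφ x
  refine ⟨m₁ * m₂ - m₃ * m₄, ?_⟩
  simp [h₁, h₂, h₃, h₄]

lemma exists_isIntegral_smul (φ : Module.Dual ℚ (Fin N → ℚ)) :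
    ∃ n : ℚ, n ≠ 0 ∧ IsIntegral (n • φ) := by
  classical
  obtain ⟨b, hb⟩ := IsLocalization.exist_integer_multiples_of_finset (nonZeroDivisors ℤ)
    (Finset.univ.image fun i : Fin N => φ (Pi.single i 1))
  refine ⟨((b : ℤ) : ℚ), Int.cast_ne_zero.2 (nonZeroDivisors.ne_zero b.2), fun x => ?_⟩
  have hb' (i : Fin N) : ∃ m : ℤ, (m : ℚ) = ((b : ℤ) : ℚ) * φ (Pi.single i 1) := by
    obtain ⟨m, hm⟩ := hb _ (Finset.mem_image_of_mem _ (Finset.mem_univ i))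
    exact ⟨m, by simpa [zsmul_eq_mul] using hm⟩
  choose m hm using hb'
  refine ⟨∑ i, x i * m i, ?_⟩
  have hx : toQ x = ∑ i, (x i : ℚ) • (Pi.single i 1 : Fin N → ℚ) := by
    ext j
    simp [toQ, Finset.sum_apply, Pi.single_apply]
  rw [hx, map_sum, Int.cast_sum]
  refine Finset.sum_congr rfl fun i _ => ?_
  rw [map_smul, LinearMap.smul_apply, Int.cast_mul, hm, smul_eq_mul, smul_eq_mul]

/-- A step of Fourier–Motzkin elimination. -/
lemma exists_nonneg_sub_smul_iff (L : Finset (Module.Dual ℚ (Fin N → ℚ)))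
    (hL : ∀ ℓ ∈ L, IsIntegral ℓ) (a x : ZN N)
    (h₀ : ∀ ℓ ∈ L, 0 ≤ ℓ (toQ a) → 0 ≤ ℓ (toQ x))
    (h₁ : ∀ ℓ ∈ L, ∀ ℓ' ∈ L, 0 ≤ ℓ (toQ a) → ℓ' (toQ a) ≤ 0 →
      0 ≤ ℓ (toQ a) * ℓ' (toQ x) - ℓ' (toQ a) * ℓ (toQ x)) :
    ∃ n t : ℕ, 1 ≤ n ∧ ∀ ℓ ∈ L, 0 ≤ ℓ (toQ (n • x - t • a)) := by
  by_cases hneg : ∃ ℓ ∈ L, ℓ (toQ x) < 0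
  swap
  · push Not at hneg
    exact ⟨1, 0, le_rfl, by simpa using hneg⟩
  classical
  obtain ⟨ℓ₀, hℓ₀, hmax⟩ := Finset.exists_max_image (L.filter fun ℓ => ℓ (toQ x) < 0)
    (fun ℓ => ℓ (toQ x) / ℓ (toQ a))
    (by
      obtain ⟨ℓ, h, h'⟩ := hneg
      exact ⟨ℓ, Finset.mem_filter.2 ⟨h, h'⟩⟩)
  obtain ⟨hℓ₀L, hx⟩ := Finset.mem_filter.1 hℓ₀
  have ha : ℓ₀ (toQ a) < 0 := by
    by_contra h
    exact absurd (h₀ ℓ₀ hℓ₀L (not_lt.1 h)) (not_le.2 hx)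
  obtain ⟨n, hn⟩ := hL ℓ₀ hℓ₀L a
  obtain ⟨t, ht⟩ := hL ℓ₀ hℓ₀L x
  have hn0 : n < 0 := by
    rw [hn] at ha
    exact_mod_cast ha
  have ht0 : t < 0 := by
    rw [ht] at hx
    exact_mod_cast hx
  have hn' : ((n.natAbs : ℕ) : ℚ) = -ℓ₀ (toQ a) := by
    rw [hn, Nat.cast_natAbs, abs_of_neg hn0, Int.cast_neg]
  have ht' : ((t.natAbs : ℕ) : ℚ) = -ℓ₀ (toQ x) := by
    rw [ht, Nat.cast_natAbs, abs_of_neg ht0, Int.cast_neg]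
  refine ⟨n.natAbs, t.natAbs, by lia, fun ℓ hℓ => ?_⟩
  rw [toQ_sub, toQ_nsmul, toQ_nsmul, map_sub, map_smul, map_smul, hn', ht', smul_eq_mul,
    smul_eq_mul]
  rcases le_or_gt 0 (ℓ (toQ a)) with h | h
  · have := h₁ ℓ hℓ ℓ₀ hℓ₀L h ha.le
    linarith
  · rcases le_or_gt 0 (ℓ (toQ x)) with h' | h'
    · nlinarith
    · have := hmax ℓ (Finset.mem_filter.2 ⟨hℓ, h'⟩)
      rw [div_le_iff_of_neg h, div_mul_eq_mul_div, div_le_iff_of_neg ha] at this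
      linarith

/-- The rational cone spanned by a finitely generated submonoid of `ℤ^N` is cut out by finitely
many linear inequalities. -/
lemma exists_functionals {Q : AddSubmonoid (ZN N)} (hQ : Q.FG) :
    ∃ L : Finset (Module.Dual ℚ (Fin N → ℚ)), (∀ ℓ ∈ L, IsIntegral ℓ) ∧
      ∀ x : ZN N, (∃ n : ℕ, 1 ≤ n ∧ n • x ∈ Q) ↔ ∀ ℓ ∈ L, 0 ≤ ℓ (toQ x) := by
  classical
  obtain ⟨S, rfl⟩ := hQ
  induction S using Finset.induction_on with
  | empty =>
    let p (i : Fin N) : Module.Dual ℚ (Fin N → ℚ) := LinearMap.proj i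
    refine ⟨Finset.univ.image p ∪ Finset.univ.image fun i => -p i, ?_, fun x => ?_⟩
    · intro ℓ hℓ x
      simp only [Finset.mem_union, Finset.mem_image, Finset.mem_univ, true_and] at hℓ
      rcases hℓ with ⟨i, rfl⟩ | ⟨i, rfl⟩
      · exact ⟨x i, rfl⟩
      · exact ⟨-x i, by simp [p, toQ]⟩
    · have : (∃ n : ℕ, 1 ≤ n ∧ n • x ∈ AddSubmonoid.closure ((∅ : Finset (ZN N)) : Set (ZN N))) ↔
          x = 0 := by
        simp only [Finset.coe_empty, AddSubmonoid.closure_empty, AddSubmonoid.mem_bot]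
        constructor
        · rintro ⟨n, hn, h⟩
          exact (smul_eq_zero.1 h).resolve_left (by lia)
        · rintro rfl
          exact ⟨1, le_rfl, by simp⟩
      rw [this]
      constructor
      · rintro rfl ℓ _
        rw [toQ_zero, map_zero]
      · intro h
        ext i
        have h₁ : 0 ≤ toQ x i := h (p i) (by simp)
        have h₂ : 0 ≤ -toQ x i := h (-p i) (by simp)
        have h₃ : (x i : ℚ) = 0 := le_antisymm (neg_nonneg.1 h₂) h₁
        exact_mod_cast h₃
  | insert a S _ ih =>
    obtain ⟨L, hL, hLS⟩ := ih
    refine ⟨L.filter (fun ℓ => 0 ≤ ℓ (toQ a)) ∪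
      ((L ×ˢ L).filter (fun p => 0 ≤ p.1 (toQ a) ∧ p.2 (toQ a) ≤ 0)).image
        (fun p => p.1 (toQ a) • p.2 - p.2 (toQ a) • p.1), ?_, fun x => ?_⟩
    · intro ℓ hℓ
      simp only [Finset.mem_union, Finset.mem_filter, Finset.mem_image, Finset.mem_product,
        Prod.exists] at hℓ
      rcases hℓ with ⟨hℓ, -⟩ | ⟨φ, ψ, ⟨⟨hφ, hψ⟩, -⟩, rfl⟩
      · exact hL ℓ hℓ
      · exact (hL φ hφ).smul_sub_smul (hL ψ hψ) a
    · have hmem (y : ZN N) : y ∈ AddSubmonoid.closure ((insert a S : Finset (ZN N)) : Set (ZN N)) ↔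
          ∃ t : ℕ, ∃ z ∈ AddSubmonoid.closure (S : Set (ZN N)), t • a + z = y := by
        rw [Finset.coe_insert, Set.insert_eq, AddSubmonoid.closure_union, AddSubmonoid.mem_sup]
        simp [AddSubmonoid.mem_closure_singleton]
      constructor
      · rintro ⟨n, hn, h⟩
        obtain ⟨t, z, hz, htz⟩ := (hmem _).1 h
        have hz' := (hLS z).1 ⟨1, le_rfl, by simpa using hz⟩
        have hn' : (0 : ℚ) < n := by exact_mod_cast hn
        have hx (ℓ : Module.Dual ℚ (Fin N → ℚ)) :
            n * ℓ (toQ x) = t * ℓ (toQ a) + ℓ (toQ z) := by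
          rw [← smul_eq_mul, ← map_smul, ← toQ_nsmul, ← htz, toQ_add, map_add, toQ_nsmul, map_smul,
            smul_eq_mul]
        intro ℓ hℓ
        simp only [Finset.mem_union, Finset.mem_filter, Finset.mem_image, Finset.mem_product,
          Prod.exists] at hℓ
        rcases hℓ with ⟨hℓ, hℓa⟩ | ⟨φ, ψ, ⟨⟨hφ, hψ⟩, hφa, hψa⟩, rfl⟩
        · refine nonneg_of_mul_nonneg_right ?_ hn'
          rw [hx]
          have := hz' ℓ hℓ
          positivity
        · refine nonneg_of_mul_nonneg_right ?_ hn'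
          have h₁ := mul_nonneg hφa (hz' ψ hψ)
          have h₂ := mul_nonneg (neg_nonneg.2 hψa) (hz' φ hφ)
          have h₃ := hx φ
          have h₄ := hx ψ
          simp only [LinearMap.sub_apply, LinearMap.smul_apply, smul_eq_mul]
          rw [show n * (φ (toQ a) * ψ (toQ x) - ψ (toQ a) * φ (toQ x)) =
            φ (toQ a) * (n * ψ (toQ x)) - ψ (toQ a) * (n * φ (toQ x)) by ring, h₃, h₄]
          linarith
      · intro h
        obtain ⟨n, t, hn, hnt⟩ := exists_nonneg_sub_smul_iff L hL a x
          (fun ℓ hℓ hℓa => h ℓ (Finset.mem_union_left _ (Finset.mem_filter.2 ⟨hℓ, hℓa⟩)))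
          (fun φ hφ ψ hψ hφa hψa => h (φ (toQ a) • ψ - ψ (toQ a) • φ)
            (Finset.mem_union_right _ (Finset.mem_image.2 ⟨(φ, ψ), Finset.mem_filter.2
              ⟨Finset.mem_product.2 ⟨hφ, hψ⟩, hφa, hψa⟩, rfl⟩)))
        obtain ⟨m, hm, hmx⟩ := (hLS _).2 hnt
        refine ⟨m * n, Nat.mul_pos hm hn, (hmem _).2 ⟨m * t, _, hmx, ?_⟩⟩
        rw [smul_sub, ← mul_smul, ← mul_smul]
        abel

lemma exists_nsmul_eq_toQ {F : AddSubmonoid (ZN N)} {x : Fin N → ℚ} (hx : x ∈ qspan F) :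
    ∃ m : ℕ, 1 ≤ m ∧ ∃ g ∈ gp F, (m : ℚ) • x = toQ g := by
  induction hx using Submodule.span_induction with
  | mem x hx =>
    obtain ⟨g, hg, rfl⟩ := hx
    exact ⟨1, le_rfl, g, AddSubgroup.subset_closure hg, by simp⟩
  | zero => exact ⟨1, le_rfl, 0, zero_mem _, by simp [toQ_zero]⟩
  | add x y _ _ hx hy =>
    obtain ⟨m, hm, g, hg, hmg⟩ := hx
    obtain ⟨m', hm', g', hg', hmg'⟩ := hy
    refine ⟨m * m', Nat.mul_pos hm hm', m' • g + m • g',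
      add_mem (nsmul_mem hg _) (nsmul_mem hg' _), ?_⟩
    rw [toQ_add, toQ_nsmul, toQ_nsmul, ← hmg, ← hmg', smul_add, Nat.cast_mul, smul_smul, smul_smul,
      mul_comm (m' : ℚ)]
  | smul r x _ hx =>
    obtain ⟨m, hm, g, hg, hmg⟩ := hx
    refine ⟨r.den * m, Nat.mul_pos r.den_pos hm, r.num • g, zsmul_mem hg _, ?_⟩
    rw [toQ_zsmul, ← hmg, smul_smul, smul_smul, Nat.cast_mul, ← Rat.den_mul_eq_num r]
    congr 1
    ring

lemma toQ_mem_qspan {F : AddSubmonoid (ZN N)} {g : ZN N} (hg : g ∈ gp F) : toQ g ∈ qspan F := by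
  induction hg using AddSubgroup.closure_induction with
  | mem x hx => exact Submodule.subset_span ⟨x, hx, rfl⟩
  | zero => exact toQ_zero (N := N) ▸ zero_mem _
  | add x y _ _ hx hy => exact toQ_add x y ▸ add_mem hx hy
  | neg x _ hx => exact toQ_neg x ▸ neg_mem hx

lemma finrank_qspan (F : AddSubmonoid (ZN N)) : Module.finrank ℚ (qspan F) = rk (gp F) := by
  let f : AddSubgroup.toIntSubmodule (gp F) →ₗ[ℤ] qspan F := AddMonoidHom.toIntLinearMap
    { toFun := fun g => ⟨toQ g, toQ_mem_qspan g.2⟩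
      map_zero' := Subtype.ext toQ_zero
      map_add' := fun x y => Subtype.ext (toQ_add _ _) }
  have : IsLocalizedModule (nonZeroDivisors ℤ) f := by
    refine ⟨fun n => ?_, fun y => ?_, fun {x₁ x₂} h => ⟨1, ?_⟩⟩
    · have hn : ((n : ℤ) : ℚ) ≠ 0 := Int.cast_ne_zero.2 (nonZeroDivisors.ne_zero n.2)
      rw [Module.End.isUnit_iff]
      have : ⇑((algebraMap ℤ (Module.End ℤ (qspan F))) n) =
          fun y => ((n : ℤ) : ℚ) • y := by
        ext1 y
        exact (Int.cast_smul_eq_zsmul ℚ _ _).symm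
      rw [this]
      exact ⟨smul_right_injective _ hn, fun y => ⟨((n : ℤ) : ℚ)⁻¹ • y, smul_inv_smul₀ hn y⟩⟩
    · obtain ⟨m, hm, g, hg, h⟩ := exists_nsmul_eq_toQ y.2
      refine ⟨(⟨g, hg⟩, ⟨m, mem_nonZeroDivisors_of_ne_zero (by lia)⟩), Subtype.ext ?_⟩
      refine Eq.trans ?_ h
      change ((m : ℤ) • y : qspan F).1 = _
      rw [← Int.cast_smul_eq_zsmul ℚ]
      simp
    · exact congrArg _ (Subtype.ext (toQ_injective (congrArg Subtype.val h)))
  rw [IsFractionRing.finrank_right_eq (R := ℤ),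
    IsLocalizedModule.finrank_eq (nonZeroDivisors ℤ) f le_rfl]
  rfl

end Cones

section Sweep

variable {N : ℕ}

/-- The subspace of the rational span of `Q` on which all functionals in `E` vanish. -/
def faceSpan (Q : AddSubmonoid (ZN N)) (E : Finset (Module.Dual ℚ (Fin N → ℚ))) :
    Submodule ℚ (Fin N → ℚ) where
  carrier := {x | x ∈ qspan Q ∧ ∀ ℓ ∈ E, ℓ x = 0}
  zero_mem' := ⟨zero_mem _, fun ℓ _ => map_zero ℓ⟩
  add_mem' := fun ha hb => ⟨add_mem ha.1 hb.1, fun ℓ hℓ => by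
    rw [map_add, ha.2 ℓ hℓ, hb.2 ℓ hℓ, add_zero]⟩
  smul_mem' := fun r _ ha => ⟨Submodule.smul_mem _ r ha.1, fun ℓ hℓ => by
    rw [map_smul, ha.2 ℓ hℓ, smul_zero]⟩

/-- The lattice points of a translate by `v` of a face of the cone cut out by `L`. -/
def faceRegion (Q : AddSubmonoid (ZN N)) (L E : Finset (Module.Dual ℚ (Fin N → ℚ)))
    (v : Fin N → ℚ) : Set (ZN N) :=
  {q | q ∈ gp Q ∧ (∀ ℓ ∈ L, ℓ v ≤ ℓ (toQ q)) ∧ ∀ ℓ ∈ E, ℓ (toQ q) = ℓ v}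

/-- `E` is exactly the set of functionals in `L` vanishing at some point of `Q`. -/
def IsFaceSet (Q : AddSubmonoid (ZN N)) (L E : Finset (Module.Dual ℚ (Fin N → ℚ))) : Prop :=
  E ⊆ L ∧ ∃ f ∈ Q, (∀ ℓ ∈ E, ℓ (toQ f) = 0) ∧ ∀ ℓ ∈ L, ℓ ∉ E → 0 < ℓ (toQ f)

variable {Q : AddSubmonoid (ZN N)} {L E E' : Finset (Module.Dual ℚ (Fin N → ℚ))}

lemma faceSpan_anti (h : E ⊆ E') : faceSpan Q E' ≤ faceSpan Q E :=
  fun _ hx => ⟨hx.1, fun ℓ hℓ => hx.2 ℓ (h hℓ)⟩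

lemma IsFaceSet.eq_of_finrank_le (hE : IsFaceSet Q L E) (hEE' : E ⊆ E') (hE' : E' ⊆ L)
    (h : Module.finrank ℚ (faceSpan Q E) ≤ Module.finrank ℚ (faceSpan Q E')) : E' = E := by
  have heq := Submodule.eq_of_le_of_finrank_le (faceSpan_anti (Q := Q) hEE') h
  obtain ⟨f, hf, hfE, hfL⟩ := hE.2
  have hmem : toQ f ∈ faceSpan Q E' :=
    heq ▸ ⟨toQ_mem_qspan (AddSubgroup.subset_closure hf), hfE⟩
  refine Finset.Subset.antisymm (fun ℓ hℓ => ?_) hEE'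
  by_contra hℓE
  exact (hfL ℓ (hE' hℓ) hℓE).ne' (hmem.2 ℓ hℓ)

lemma eventually_no_int_of_pos (a : ℚ) {b : ℚ} (hb : 0 < b) :
    ∀ᶠ ε in nhdsWithin (0 : ℚ) (Set.Ioi 0), ∀ m : ℤ, (m : ℚ) < a → (m : ℚ) < a - ε * b := by
  have hδ : 0 < (a - ⌈a⌉ + 1) / b := div_pos (by linarith [Int.ceil_lt_add_one a]) hb
  filter_upwards [Ioo_mem_nhdsGT hδ] with ε hε m hm
  have h₁ : m ≤ ⌈a⌉ - 1 := Int.le_sub_one_of_lt (Int.lt_ceil.2 hm)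
  have h₂ : (m : ℚ) ≤ ⌈a⌉ - 1 := by exact_mod_cast h₁
  have h₃ := (lt_div_iff₀ hb).1 hε.2
  linarith

lemma eventually_ne_int (a : ℚ) {b : ℚ} (hb : b ≠ 0) :
    ∀ᶠ ε in nhdsWithin (0 : ℚ) (Set.Ioi 0), ∀ m : ℤ, a - ε * b ≠ m := by
  rcases hb.lt_or_gt with hb | hb
  · filter_upwards [eventually_no_int_of_pos (-a) (neg_pos.2 hb), self_mem_nhdsWithin] with ε hε h0
      m hm
    have h1 : 0 < ε := h0
    have := hε (-m) (by push_cast; nlinarith)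
    push_cast at this
    nlinarith
  · filter_upwards [eventually_no_int_of_pos a hb, self_mem_nhdsWithin] with ε hε h0 m hm
    have h1 : 0 < ε := h0
    have := hε m (by nlinarith)
    linarith

/-- If a face of codimension at least two in `faceSpan Q E` is given, then some integral functional
vanishes on this face and on `x`, but not on `faceSpan Q E`. -/
lemma exists_isIntegral_separating (x : Fin N → ℚ)
    (h : Module.finrank ℚ (faceSpan Q E') + 1 < Module.finrank ℚ (faceSpan Q E)) :
    ∃ φ : Module.Dual ℚ (Fin N → ℚ), IsIntegral φ ∧
      (∀ y ∈ faceSpan Q E' ⊔ Submodule.span ℚ {x}, φ y = 0) ∧ ∃ u ∈ faceSpan Q E, φ u ≠ 0 := by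
  have hnle : ¬ faceSpan Q E ≤ faceSpan Q E' ⊔ Submodule.span ℚ {x} := by
    intro hle
    have h₁ := Submodule.finrank_mono hle
    have h₂ := Submodule.finrank_add_le_finrank_add_finrank (faceSpan Q E')
      (Submodule.span ℚ {x})
    have h₃ := finrank_span_le_card (R := ℚ) ({x} : Set (Fin N → ℚ))
    simp only [Set.toFinset_singleton, Finset.card_singleton] at h₃
    lia
  obtain ⟨u, hu, hu'⟩ := SetLike.not_le_iff_exists.1 hnle
  obtain ⟨φ, hφu, hφ⟩ := Submodule.exists_le_ker_of_notMem hu'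
  obtain ⟨n, hn, hnφ⟩ := exists_isIntegral_smul φ
  refine ⟨n • φ, hnφ, fun y hy => ?_, u, hu, ?_⟩
  · rw [LinearMap.smul_apply, LinearMap.mem_ker.1 (hφ hy), smul_zero]
  · rw [LinearMap.smul_apply]
    exact smul_ne_zero hn hφu

/-- A region can be described by a base point in general position. -/
lemma exists_generic_basepoint (hL : ∀ ℓ ∈ L, IsIntegral ℓ) {f : ZN N} (hf : f ∈ Q)
    (hfE : ∀ ℓ ∈ E, ℓ (toQ f) = 0) (hfL : ∀ ℓ ∈ L, ℓ ∉ E → 0 < ℓ (toQ f))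
    {v : Fin N → ℚ} (hv : v ∈ qspan Q) :
    ∃ v' ∈ qspan Q, faceRegion Q L E v' = faceRegion Q L E v ∧ ∀ E' ⊆ L, ∀ q ∈ gp Q,
      toQ q - v' ∈ faceSpan Q E' ⊔ Submodule.span ℚ {toQ f} →
        Module.finrank ℚ (faceSpan Q E) ≤ Module.finrank ℚ (faceSpan Q E') + 1 := by
  classical
  let B := L.powerset.filter fun E' =>
    Module.finrank ℚ (faceSpan Q E') + 1 < Module.finrank ℚ (faceSpan Q E)
  have hB (E' : B) := exists_isIntegral_separating (toQ f) (Finset.mem_filter.1 E'.2).2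
  choose φ hφint hφ hφE using hB
  obtain ⟨u, hu, hφu⟩ := Module.Dual.exists_forall_mem_ne_zero_of_forall_exists _ φ hφE
  have hn : ∀ᶠ n : ℕ in Filter.atTop, ∀ ℓ ∈ L.filter (· ∉ E), 0 < ℓ ((n : ℚ) • toQ f + u) := by
    rw [Filter.eventually_all_finset]
    intro ℓ hℓ
    obtain ⟨hℓL, hℓE⟩ := Finset.mem_filter.1 hℓ
    obtain ⟨m, hm⟩ := exists_nat_gt (-ℓ u / ℓ (toQ f))
    filter_upwards [Filter.eventually_ge_atTop m] with n hn
    have h₁ := (div_lt_iff₀ (hfL ℓ hℓL hℓE)).1 hm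
    have h₂ : (m : ℚ) * ℓ (toQ f) ≤ n * ℓ (toQ f) :=
      mul_le_mul_of_nonneg_right (by exact_mod_cast hn) (hfL ℓ hℓL hℓE).le
    rw [map_add, map_smul, smul_eq_mul]
    linarith
  obtain ⟨n, hn⟩ := hn.exists
  set w := (n : ℚ) • toQ f + u with hw
  have hfmem : toQ f ∈ qspan Q := toQ_mem_qspan (AddSubgroup.subset_closure hf)
  have hφw (E' : B) : φ E' w = φ E' u := by
    rw [hw, map_add, map_smul, hφ E' (toQ f)
      (Submodule.mem_sup_right (Submodule.mem_span_singleton_self _)), smul_zero, zero_add]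
  have hwE : ∀ ℓ ∈ E, ℓ w = 0 := fun ℓ hℓ => by
    rw [hw, map_add, map_smul, hfE ℓ hℓ, hu.2 ℓ hℓ, smul_zero, add_zero]
  have h₁ : ∀ᶠ ε in nhdsWithin (0 : ℚ) (Set.Ioi 0), ∀ ℓ ∈ L.filter (· ∉ E),
      ∀ m : ℤ, (m : ℚ) < ℓ v → (m : ℚ) < ℓ v - ε * ℓ w :=
    (Filter.eventually_all_finset _).2 fun ℓ hℓ => eventually_no_int_of_pos _ (hn ℓ hℓ)
  have h₂ : ∀ᶠ ε in nhdsWithin (0 : ℚ) (Set.Ioi 0), ∀ E' : B,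
      ∀ m : ℤ, φ E' v - ε * φ E' w ≠ m :=
    Filter.eventually_all.2 fun E' => eventually_ne_int _ (hφw E' ▸ hφu E')
  obtain ⟨ε, hε₁, hε₂, hε₀⟩ := (h₁.and (h₂.and self_mem_nhdsWithin)).exists
  replace hε₀ : 0 < ε := hε₀
  have happly (ℓ : Module.Dual ℚ (Fin N → ℚ)) : ℓ (v - ε • w) = ℓ v - ε * ℓ w := by
    rw [map_sub, map_smul, smul_eq_mul]
  refine ⟨v - ε • w, sub_mem hv (Submodule.smul_mem _ _ (add_mem (Submodule.smul_mem _ _ hfmem)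
    hu.1)), ?_, fun E' hE' q hq hqv => ?_⟩
  · have hE : ∀ ℓ ∈ E, ℓ (v - ε • w) = ℓ v := fun ℓ hℓ => by
      rw [happly, hwE ℓ hℓ, mul_zero, sub_zero]
    ext q
    refine and_congr_right fun _ => and_congr (forall₂_congr fun ℓ hℓ => ?_)
      (forall₂_congr fun ℓ hℓ => by rw [hE ℓ hℓ])
    by_cases hℓE : ℓ ∈ E
    · rw [hE ℓ hℓE]
    · have hℓ' : ℓ ∈ L.filter (· ∉ E) := Finset.mem_filter.2 ⟨hℓ, hℓE⟩
      obtain ⟨m, hm⟩ := hL ℓ hℓ q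
      rw [happly, hm]
      constructor
      · intro h
        by_contra h'
        exact absurd h (not_le.2 (hε₁ ℓ hℓ' m (not_le.1 h')))
      · intro h
        nlinarith [hn ℓ hℓ']
  · by_contra hlt
    let E'' : B := ⟨E', Finset.mem_filter.2 ⟨Finset.mem_powerset.2 hE', not_le.1 hlt⟩⟩
    obtain ⟨m, hm⟩ := hφint E'' q
    have := hφ E'' _ hqv
    rw [map_sub, hm, happly, sub_eq_zero] at this
    exact hε₂ E'' m this.symm

lemma exists_toQ_eq_nsmul (hL : ∀ x : ZN N, (∃ n : ℕ, 1 ≤ n ∧ n • x ∈ Q) ↔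
    ∀ ℓ ∈ L, 0 ≤ ℓ (toQ x)) {x : Fin N → ℚ} (hx : x ∈ qspan Q) (hxL : ∀ ℓ ∈ L, 0 ≤ ℓ x) :
    ∃ n : ℕ, 1 ≤ n ∧ ∃ f ∈ Q, toQ f = (n : ℚ) • x := by
  obtain ⟨m, hm, g, hg, hmg⟩ := exists_nsmul_eq_toQ hx
  obtain ⟨n, hn, hng⟩ := (hL g).2 fun ℓ hℓ => by
    rw [← hmg, map_smul, smul_eq_mul]
    exact mul_nonneg (Nat.cast_nonneg _) (hxL ℓ hℓ)
  refine ⟨n * m, Nat.mul_pos hn hm, n • g, hng, ?_⟩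
  rw [toQ_nsmul, ← hmg, smul_smul, Nat.cast_mul]

open Classical in
/-- The functionals in `L` taking the same value at `q` and `v`. -/
noncomputable def tightSet (L : Finset (Module.Dual ℚ (Fin N → ℚ))) (v : Fin N → ℚ) (q : ZN N) :
    Finset (Module.Dual ℚ (Fin N → ℚ)) :=
  L.filter fun ℓ => ℓ (toQ q) = ℓ v

lemma mem_tightSet {v : Fin N → ℚ} {q : ZN N} {ℓ : Module.Dual ℚ (Fin N → ℚ)} :
    ℓ ∈ tightSet L v q ↔ ℓ ∈ L ∧ ℓ (toQ q) = ℓ v :=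
  Finset.mem_filter

lemma tightSet_subset {v : Fin N → ℚ} {q : ZN N} : tightSet L v q ⊆ L :=
  Finset.filter_subset _ _

lemma isFaceSet_tightSet (hL : ∀ x : ZN N, (∃ n : ℕ, 1 ≤ n ∧ n • x ∈ Q) ↔
    ∀ ℓ ∈ L, 0 ≤ ℓ (toQ x)) {v : Fin N → ℚ} (hv : v ∈ qspan Q) {q : ZN N} (hq : q ∈ gp Q)
    (hqv : ∀ ℓ ∈ L, ℓ v ≤ ℓ (toQ q)) : IsFaceSet Q L (tightSet L v q) := by
  refine ⟨tightSet_subset, ?_⟩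
  obtain ⟨n, hn, f, hf, hfx⟩ := exists_toQ_eq_nsmul hL
    (sub_mem (toQ_mem_qspan hq) hv) fun ℓ hℓ => by
      rw [map_sub]
      exact sub_nonneg.2 (hqv ℓ hℓ)
  refine ⟨f, hf, fun ℓ hℓ => ?_, fun ℓ hℓ hℓ' => ?_⟩
  · rw [hfx, map_smul, map_sub, (mem_tightSet.1 hℓ).2, sub_self, smul_zero]
  · rw [hfx, map_smul, map_sub, smul_eq_mul]
    have hlt : ℓ v < ℓ (toQ q) :=
      (hqv ℓ hℓ).lt_of_ne fun h => hℓ' (mem_tightSet.2 ⟨hℓ, h.symm⟩)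
    have : (0 : ℚ) < n := by exact_mod_cast hn
    exact mul_pos this (sub_pos.2 hlt)

variable {k : Type} [Field k] {J : Ideal (AddMonoidAlgebra k Q)}

/-- Translates of a face are good as soon as the layers of the sweep along `f` are. -/
lemma goodRegion_layer (hL : ∀ x : ZN N, (∃ n : ℕ, 1 ≤ n ∧ n • x ∈ Q) ↔
    ∀ ℓ ∈ L, 0 ≤ ℓ (toQ x)) {e : ℕ} {f : ZN N} (hf : f ∈ Q) (hEL : E ⊆ L)
    (hfE : ∀ ℓ ∈ E, ℓ (toQ f) = 0) (hfL : ∀ ℓ ∈ L, ℓ ∉ E → 0 < ℓ (toQ f))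
    {v : Fin N → ℚ} (hv : v ∈ qspan Q)
    (hgen : ∀ E' ⊆ L, ∀ q ∈ gp Q,
      toQ q - v ∈ faceSpan Q E' ⊔ Submodule.span ℚ {toQ f} →
        Module.finrank ℚ (faceSpan Q E) ≤ Module.finrank ℚ (faceSpan Q E') + 1)
    (ih : ∀ E' ⊆ L, ∀ v' ∈ qspan Q, IsFaceSet Q L E' →
      Module.finrank ℚ (faceSpan Q E) ≤ Module.finrank ℚ (faceSpan Q E') + 1 →
        GoodRegion k J e (faceRegion Q L E' v'))
    (t : ℚ) :
    GoodRegion k J e {q ∈ faceRegion Q L E (v + t • toQ f) |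
      ∃ ℓ ∈ L, ℓ ∉ E ∧ ℓ (toQ q) = ℓ (v + t • toQ f)} := by
  set v' := v + t • toQ f with hv'
  have hfmem : toQ f ∈ qspan Q := toQ_mem_qspan (AddSubgroup.subset_closure hf)
  have hv'mem : v' ∈ qspan Q := add_mem hv (Submodule.smul_mem _ _ hfmem)
  set D := {q ∈ faceRegion Q L E v' | ∃ ℓ ∈ L, ℓ ∉ E ∧ ℓ (toQ q) = ℓ v'} with hD
  have hface (q : ZN N) (hq : q ∈ D) : IsFaceSet Q L (tightSet L v' q) :=
    isFaceSet_tightSet hL hv'mem hq.1.1 hq.1.2.1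
  have hsub (q : ZN N) (hq : q ∈ D) : E ⊆ tightSet L v' q :=
    fun ℓ hℓ => mem_tightSet.2 ⟨hEL hℓ, hq.1.2.2 ℓ hℓ⟩
  have hle (q : ZN N) (hq : q ∈ D) : Module.finrank ℚ (faceSpan Q E) ≤
      Module.finrank ℚ (faceSpan Q (tightSet L v' q)) + 1 := by
    refine hgen _ tightSet_subset q hq.1.1 ?_
    have : toQ q - v = (toQ q - v') + t • toQ f := by
      rw [hv']
      abel
    rw [this]
    refine Submodule.add_mem_sup ⟨sub_mem (toQ_mem_qspan hq.1.1) hv'mem, fun ℓ hℓ => ?_⟩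
      (Submodule.smul_mem _ _ (Submodule.mem_span_singleton_self _))
    rw [map_sub, (mem_tightSet.1 hℓ).2, sub_self]
  have hlt (q : ZN N) (hq : q ∈ D) : Module.finrank ℚ (faceSpan Q (tightSet L v' q)) <
      Module.finrank ℚ (faceSpan Q E) := by
    refine Submodule.finrank_lt_finrank_of_lt (lt_of_le_of_ne (faceSpan_anti (hsub q hq)) ?_)
    intro heq
    obtain ⟨ℓ, hℓ, hℓE, hℓq⟩ := hq.2
    have hfE' : toQ f ∈ faceSpan Q (tightSet L v' q) := heq ▸ ⟨hfmem, hfE⟩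
    exact (hfL ℓ hℓ hℓE).ne' (hfE'.2 ℓ (mem_tightSet.2 ⟨hℓ, hℓq⟩))
  have huniq (q q' : ZN N) (hq : q ∈ D) (hq' : q' ∈ D)
      (h : tightSet L v' q ⊆ tightSet L v' q') : tightSet L v' q' = tightSet L v' q :=
    (hface q hq).eq_of_finrank_le h tightSet_subset (by
      have := hlt q hq
      have := hle q' hq'
      lia)
  refine GoodRegion.of_fibers_of_eq (tightSet L v') ?_ ?_ ?_
  · refine (L.powerset.finite_toSet).subset ?_
    rintro _ ⟨q, -, rfl⟩
    exact Finset.mem_coe.2 (Finset.mem_powerset.2 tightSet_subset)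
  · intro q hq p hp hpq
    refine huniq _ _ hpq hq fun ℓ hℓ => ?_
    obtain ⟨hℓL, hℓ⟩ := mem_tightSet.1 hℓ
    refine mem_tightSet.2 ⟨hℓL, le_antisymm ?_ (hq.1.2.1 ℓ hℓL)⟩
    rw [← hℓ, toQ_add, map_add]
    exact le_add_of_nonneg_left ((hL p).1 ⟨1, le_rfl, by rwa [one_smul]⟩ ℓ hℓL)
  · intro E'
    by_cases hne : ∃ q₀ ∈ D, tightSet L v' q₀ = E'
    · obtain ⟨q₀, hq₀, rfl⟩ := hne
      convert ih _ tightSet_subset v' hv'mem (hface q₀ hq₀) (hle q₀ hq₀) using 1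
      ext q
      constructor
      · rintro ⟨hq, hqq₀⟩
        exact ⟨hq.1.1, hq.1.2.1, fun ℓ hℓ => (mem_tightSet.1 (hqq₀ ▸ hℓ)).2⟩
      · rintro ⟨hq, hqL, hqq₀⟩
        obtain ⟨ℓ, hℓL, hℓE, hℓ⟩ := hq₀.2
        have hqD : q ∈ D := ⟨⟨hq, hqL, fun ℓ hℓ => hqq₀ ℓ (hsub q₀ hq₀ hℓ)⟩,
          ℓ, hℓL, hℓE, hqq₀ ℓ (mem_tightSet.2 ⟨hℓL, hℓ⟩)⟩
        exact ⟨hqD, huniq q₀ q hq₀ hqD fun ℓ hℓ =>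
          mem_tightSet.2 ⟨(mem_tightSet.1 hℓ).1, hqq₀ ℓ hℓ⟩⟩
    · convert GoodRegion.empty
      ext q
      simp only [Set.mem_ofPred_eq, Set.mem_empty_iff_false, iff_false]
      exact fun h => hne ⟨q, h⟩

lemma goodRegion_faceRegion (hLint : ∀ ℓ ∈ L, IsIntegral ℓ)
    (hL : ∀ x : ZN N, (∃ n : ℕ, 1 ≤ n ∧ n • x ∈ Q) ↔ ∀ ℓ ∈ L, 0 ≤ ℓ (toQ x))
    (hJ : ∀ q : Q, (q : ZN N) ∉ unitsFace Q → AddMonoidAlgebra.single q 1 ∈ J) (e : ℕ)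
    {v : Fin N → ℚ} (hv : v ∈ qspan Q) (hE : IsFaceSet Q L E)
    (he : e + Module.finrank ℚ (faceSpan Q L) ≤ Module.finrank ℚ (faceSpan Q E)) :
    GoodRegion k J e (faceRegion Q L E v) := by
  induction e generalizing E v with
  | zero => exact GoodRegion.zero_right _ _
  | succ e ih =>
    classical
    obtain ⟨hEL, f, hf, hfE, hfL⟩ := hE
    have hnonneg : ∀ p ∈ Q, ∀ ℓ ∈ L, 0 ≤ ℓ (toQ p) := fun p hp =>
      (hL p).1 ⟨1, le_rfl, by rwa [one_smul]⟩
    have hne : (L.filter (· ∉ E)).Nonempty := by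
      by_contra hempty
      have : L ⊆ E := by
        simpa [Finset.filter_eq_empty_iff, Finset.subset_iff] using
          Finset.not_nonempty_iff_eq_empty.1 hempty
      rw [Finset.Subset.antisymm hEL this] at he
      lia
    have hfJ : AddMonoidAlgebra.single (⟨f, hf⟩ : Q) 1 ∈ J := by
      refine hJ _ fun hfu => ?_
      obtain ⟨ℓ, hℓ⟩ := hne
      obtain ⟨hℓL, hℓE⟩ := Finset.mem_filter.1 hℓ
      have := hnonneg _ hfu.2 ℓ hℓL
      rw [toQ_neg, map_neg] at this
      linarith [hfL ℓ hℓL hℓE]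
    obtain ⟨v', hv', hvv', hgen⟩ := exists_generic_basepoint hLint hf hfE hfL hv
    rw [← hvv']
    refine GoodRegion.succ ⟨f, hf⟩ hfJ ?_ ?_
    · rintro q ⟨hq, hqL, hqE⟩
      refine ⟨add_mem (AddSubgroup.subset_closure hf) hq, fun ℓ hℓ => ?_, fun ℓ hℓ => ?_⟩
      · rw [toQ_add, map_add]
        exact le_add_of_nonneg_of_le (hnonneg f hf ℓ hℓ) (hqL ℓ hℓ)
      · rw [toQ_add, map_add, hfE ℓ hℓ, zero_add, hqE ℓ hℓ]
    · let r (ℓ : Module.Dual ℚ (Fin N → ℚ)) (q : ZN N) : ℚ := (ℓ (toQ q) - ℓ v') / ℓ (toQ f)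
      let τ (q : ZN N) : ℚ := (L.filter (· ∉ E)).inf' hne fun ℓ => r ℓ q
      have hr {ℓ} (hℓL : ℓ ∈ L) (hℓE : ℓ ∉ E) (q : ZN N) :
          ℓ (toQ q) = ℓ v' + r ℓ q * ℓ (toQ f) := by
        simp only [r]
        rw [div_mul_cancel₀ _ (hfL ℓ hℓL hℓE).ne']
        ring
      have hτle {ℓ} (hℓL : ℓ ∈ L) (hℓE : ℓ ∉ E) (q : ZN N) : τ q ≤ r ℓ q :=
        Finset.inf'_le _ (Finset.mem_filter.2 ⟨hℓL, hℓE⟩)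
      have hτeq (q : ZN N) : ∃ ℓ ∈ L, ℓ ∉ E ∧ τ q = r ℓ q := by
        obtain ⟨ℓ, hℓ, h⟩ := Finset.exists_mem_eq_inf' hne fun ℓ => r ℓ q
        exact ⟨ℓ, (Finset.mem_filter.1 hℓ).1, (Finset.mem_filter.1 hℓ).2, h⟩
      have hrange : ∀ q ∈ faceRegion Q L E v', q - f ∉ faceRegion Q L E v' ↔ τ q < 1 := by
        intro q hq
        constructor
        · intro hqf
          by_contra! h1
          refine hqf ⟨sub_mem hq.1 (AddSubgroup.subset_closure hf), fun ℓ hℓ => ?_,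
            fun ℓ hℓ => ?_⟩
          · rw [toQ_sub, map_sub]
            by_cases hℓE : ℓ ∈ E
            · rw [hfE ℓ hℓE, sub_zero]
              exact hq.2.1 ℓ hℓ
            · rw [hr hℓ hℓE q]
              nlinarith [hfL ℓ hℓ hℓE, h1.trans (hτle hℓ hℓE q)]
          · rw [toQ_sub, map_sub, hfE ℓ hℓ, sub_zero, hq.2.2 ℓ hℓ]
        · intro h1 hqf
          obtain ⟨ℓ, hℓL, hℓE, h⟩ := hτeq q
          have h2 := hqf.2.1 ℓ hℓL
          rw [toQ_sub, map_sub, hr hℓL hℓE q] at h2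
          nlinarith [hfL ℓ hℓL hℓE]
      have hnn : ∀ q ∈ faceRegion Q L E v', 0 ≤ τ q := by
        intro q hq
        obtain ⟨ℓ, hℓL, hℓE, h⟩ := hτeq q
        rw [h]
        exact div_nonneg (sub_nonneg.2 (hq.2.1 ℓ hℓL)) (hfL ℓ hℓL hℓE).le
      refine GoodRegion.of_fibers τ ?_ ?_ fun t => ?_
      · refine ((L.filter (· ∉ E)).finite_toSet.biUnion fun ℓ _ =>
          (Set.finite_Icc ⌊ℓ v'⌋ ⌈ℓ v' + ℓ (toQ f)⌉).image
            fun m : ℤ => ((m : ℚ) - ℓ v') / ℓ (toQ f)).subset ?_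
        rintro _ ⟨q, ⟨hq, hqf⟩, rfl⟩
        obtain ⟨ℓ, hℓL, hℓE, h⟩ := hτeq q
        obtain ⟨m, hm⟩ := hLint ℓ hℓL q
        have h1 : r ℓ q < 1 := h ▸ (hrange q hq).1 hqf
        have hmv : ℓ v' ≤ m := hm ▸ hq.2.1 ℓ hℓL
        have hmf : (m : ℚ) ≤ ℓ v' + ℓ (toQ f) := by
          rw [← hm, hr hℓL hℓE q]
          nlinarith [hfL ℓ hℓL hℓE]
        refine Set.mem_biUnion (Finset.mem_coe.2 (Finset.mem_filter.2 ⟨hℓL, hℓE⟩))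
          ⟨m, ⟨?_, ?_⟩, ?_⟩
        · exact_mod_cast (Int.floor_le _).trans hmv
        · exact_mod_cast hmf.trans (Int.le_ceil _)
        · rw [h]
          simp only [r, hm]
      · intro q hq p hp hpq
        refine Finset.le_inf' _ _ fun ℓ hℓ => ?_
        obtain ⟨hℓL, hℓE⟩ := Finset.mem_filter.1 hℓ
        refine (hτle hℓL hℓE q).trans (div_le_div_of_nonneg_right ?_ (hfL ℓ hℓL hℓE).le)
        rw [toQ_add, map_add]
        linarith [hnonneg p hp ℓ hℓL]
      · by_cases ht : 0 ≤ t ∧ t < 1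
        · convert goodRegion_layer (k := k) (J := J) (e := e) hL hf hEL hfE hfL hv' hgen
            (fun E' _ v'' hv'' hE' h => ih hv'' hE' (by lia)) t using 1
          have hvE : ∀ ℓ ∈ E, ℓ (v' + t • toQ f) = ℓ v' := fun ℓ hℓ => by
            rw [map_add, map_smul, hfE ℓ hℓ, smul_zero, add_zero]
          have hvt (ℓ : Module.Dual ℚ (Fin N → ℚ)) : ℓ (v' + t • toQ f) = ℓ v' + t * ℓ (toQ f) := by
            rw [map_add, map_smul, smul_eq_mul]
          ext q
          constructor
          · rintro ⟨⟨hq, -⟩, rfl⟩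
            refine ⟨⟨hq.1, fun ℓ hℓ => ?_, fun ℓ hℓ => by rw [hvE ℓ hℓ, hq.2.2 ℓ hℓ]⟩, ?_⟩
            · by_cases hℓE : ℓ ∈ E
              · rw [hvE ℓ hℓE]
                exact hq.2.1 ℓ hℓ
              · rw [hvt, hr hℓ hℓE q]
                nlinarith [hfL ℓ hℓ hℓE, hτle hℓ hℓE q]
            · obtain ⟨ℓ, hℓL, hℓE, h⟩ := hτeq q
              exact ⟨ℓ, hℓL, hℓE, by rw [hvt, hr hℓL hℓE q, h]⟩
          · rintro ⟨⟨hq, hqL, hqE⟩, ℓ, hℓL, hℓE, hℓ⟩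
            have hqv : q ∈ faceRegion Q L E v' := by
              refine ⟨hq, fun ℓ hℓ => ?_, fun ℓ hℓ => by rw [← hvE ℓ hℓ, hqE ℓ hℓ]⟩
              refine le_trans ?_ (hqL ℓ hℓ)
              rw [hvt]
              exact le_add_of_nonneg_right (mul_nonneg ht.1 (hnonneg f hf ℓ hℓ))
            have hτt : τ q = t := by
              refine le_antisymm ((hτle hℓL hℓE q).trans_eq ?_) (Finset.le_inf' _ _ fun ℓ hℓ => ?_)
              · simp only [r]
                rw [hℓ, hvt, add_sub_cancel_left, mul_div_cancel_right₀ _ (hfL ℓ hℓL hℓE).ne']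
              · obtain ⟨hℓL, hℓE⟩ := Finset.mem_filter.1 hℓ
                rw [le_div_iff₀ (hfL ℓ hℓL hℓE), le_sub_iff_add_le', ← hvt]
                exact hqL ℓ hℓL
            exact ⟨⟨hqv, (hrange q hqv).2 (hτt ▸ ht.2)⟩, hτt⟩
        · convert GoodRegion.empty
          ext q
          simp only [Set.mem_ofPred_eq, Set.mem_empty_iff_false, iff_false]
          rintro ⟨⟨hq, hqf⟩, rfl⟩
          exact ht ⟨hnn q hq, (hrange q hq).1 hqf⟩

lemma faceSpan_le_qspan_unitsFace (hL : ∀ x : ZN N, (∃ n : ℕ, 1 ≤ n ∧ n • x ∈ Q) ↔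
    ∀ ℓ ∈ L, 0 ≤ ℓ (toQ x)) : faceSpan Q L ≤ qspan (unitsFace Q) := by
  rintro x ⟨hx, hxL⟩
  obtain ⟨n, hn, f, hf, hfx⟩ := exists_toQ_eq_nsmul hL hx fun ℓ hℓ => (hxL ℓ hℓ).ge
  obtain ⟨m, hm, hmf⟩ := (hL (-f)).2 fun ℓ hℓ => by
    rw [toQ_neg, hfx, map_neg, map_smul, hxL ℓ hℓ, smul_zero, neg_zero]
  have hmem : toQ (m • f) ∈ qspan (unitsFace Q) :=
    Submodule.subset_span ⟨_, ⟨nsmul_mem hf m, by rwa [← smul_neg]⟩, rfl⟩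
  rw [toQ_nsmul, hfx, smul_smul] at hmem
  exact (Submodule.smul_mem_iff _ (by positivity)).1 hmem

open Classical in
/-- The functionals in `L` vanishing on `Q`. -/
noncomputable def vanishingSet (Q : AddSubmonoid (ZN N))
    (L : Finset (Module.Dual ℚ (Fin N → ℚ))) : Finset (Module.Dual ℚ (Fin N → ℚ)) :=
  L.filter fun ℓ => ∀ q ∈ Q, ℓ (toQ q) = 0

lemma mem_vanishingSet {ℓ : Module.Dual ℚ (Fin N → ℚ)} :
    ℓ ∈ vanishingSet Q L ↔ ℓ ∈ L ∧ ∀ q ∈ Q, ℓ (toQ q) = 0 := by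
  simp only [vanishingSet, Finset.mem_filter]

lemma vanishingSet_subset : vanishingSet Q L ⊆ L := fun _ hℓ => (mem_vanishingSet.1 hℓ).1

lemma apply_eq_zero_of_mem_vanishingSet {ℓ : Module.Dual ℚ (Fin N → ℚ)}
    (hℓ : ℓ ∈ vanishingSet Q L) {x : Fin N → ℚ} (hx : x ∈ qspan Q) : ℓ x = 0 := by
  have : qspan Q ≤ LinearMap.ker ℓ := Submodule.span_le.2 <| by
    rintro _ ⟨q, hq, rfl⟩
    exact (mem_vanishingSet.1 hℓ).2 q hq
  exact this hx

lemma faceSpan_vanishingSet : faceSpan Q (vanishingSet Q L) = qspan Q :=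
  le_antisymm (fun _ hx => hx.1) fun _ hx => ⟨hx, fun _ hℓ =>
    apply_eq_zero_of_mem_vanishingSet hℓ hx⟩

lemma isFaceSet_vanishingSet (hL : ∀ q ∈ Q, ∀ ℓ ∈ L, 0 ≤ ℓ (toQ q)) :
    IsFaceSet Q L (vanishingSet Q L) := by
  classical
  refine ⟨vanishingSet_subset, ?_⟩
  have h (ℓ : Module.Dual ℚ (Fin N → ℚ)) :
      ∃ q ∈ Q, (∃ q' ∈ Q, ℓ (toQ q') ≠ 0) → ℓ (toQ q) ≠ 0 := by
    by_cases h : ∃ q' ∈ Q, ℓ (toQ q') ≠ 0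
    · obtain ⟨q, hq, hℓ⟩ := h
      exact ⟨q, hq, fun _ => hℓ⟩
    · exact ⟨0, zero_mem _, fun h' => absurd h' h⟩
  choose g hg hgne using h
  have hf : ∑ ℓ ∈ L, g ℓ ∈ Q := sum_mem fun ℓ _ => hg ℓ
  refine ⟨_, hf, fun ℓ hℓ => (mem_vanishingSet.1 hℓ).2 _ hf, fun ℓ hℓ hℓ' => ?_⟩
  have hne : ℓ (toQ (g ℓ)) ≠ 0 := hgne ℓ (by
    by_contra! h
    exact hℓ' (mem_vanishingSet.2 ⟨hℓ, h⟩))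
  rw [← Finset.add_sum_erase L g hℓ, toQ_add, map_add]
  exact add_pos_of_pos_of_nonneg ((hL _ (hg ℓ) ℓ hℓ).lt_of_ne' hne)
    (hL _ (sum_mem fun ℓ _ => hg ℓ) ℓ hℓ)

lemma faceRegion_vanishingSet (hL : ∀ x : ZN N, (∃ n : ℕ, 1 ≤ n ∧ n • x ∈ Q) ↔
    ∀ ℓ ∈ L, 0 ≤ ℓ (toQ x)) : faceRegion Q L (vanishingSet Q L) 0 = sat Q := by
  ext q
  refine and_congr_right fun hq => ?_
  rw [hL]
  simp only [map_zero]
  exact and_iff_left fun ℓ hℓ => apply_eq_zero_of_mem_vanishingSet hℓ (toQ_mem_qspan hq)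

variable (k) in
lemma goodRegion_sat (hQ : Q.FG) :
    GoodRegion k (pIdeal k Q (unitsFace Q)) (sdimQ Q) (sat Q : Set (ZN N)) := by
  obtain ⟨L, hLint, hL⟩ := exists_functionals hQ
  rw [← faceRegion_vanishingSet hL]
  refine goodRegion_faceRegion hLint hL (J := pIdeal k Q (unitsFace Q))
    (fun q hq => Ideal.subset_span ⟨q, hq, rfl⟩) _ (zero_mem _)
    (isFaceSet_vanishingSet fun q hq => (hL q).1 ⟨1, le_rfl, by rwa [one_smul]⟩) ?_
  have h₁ := Submodule.finrank_mono (faceSpan_le_qspan_unitsFace hL)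
  have h₂ := Submodule.finrank_mono (faceSpan_anti (Q := Q) (vanishingSet_subset (Q := Q) (L := L)))
  rw [finrank_qspan] at h₁
  rw [faceSpan_vanishingSet, finrank_qspan] at h₂ ⊢
  unfold sdimQ
  lia

end Sweep

section Saturation

variable (k : Type) [Field k] {N : ℕ} (Q : AddSubmonoid (ZN N))

attribute [local instance] groupAlg

/-- The inclusion `k[sat Q] → k[ℤ^N]` as a `k[Q]`-linear map. -/
noncomputable def satToGroupAlg :
    AddMonoidAlgebra k (sat Q) →ₗ[AddMonoidAlgebra k Q] AddMonoidAlgebra k (ZN N) where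
  toFun := AddMonoidAlgebra.mapDomainRingHom k (sat Q).subtype
  map_add' := map_add _
  map_smul' r a := by
    rw [Algebra.smul_def, map_mul, RingHom.id_apply, Algebra.smul_def]
    congr 1
    exact DFunLike.congr_fun (AddMonoidAlgebra.mapDomainRingHom_comp (R := k) (sat Q).subtype
      (satIncl Q)).symm r

lemma range_satToGroupAlg : LinearMap.range (satToGroupAlg k Q) =
    monomialSubmodule k (sat Q : Set (ZN N)) fun _ hq _ hu => add_mem (le_sat Q hq) hu := by
  ext a
  constructor
  · rintro ⟨a, rfl⟩ g hg
    refine Finsupp.mapDomain_of_notMem_range _ _ ?_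
    rintro ⟨g, rfl⟩
    exact hg g.2
  · intro ha
    refine ⟨.ofCoeff (a.coeff.comapDomain _ Subtype.val_injective.injOn),
      AddMonoidAlgebra.coeff_injective (Finsupp.mapDomain_comapDomain _ Subtype.val_injective _ ?_)⟩
    intro g hg
    by_contra hg'
    exact Finsupp.mem_support_iff.1 hg (ha g fun h => hg' ⟨⟨g, h⟩, rfl⟩)

variable {Q} in
lemma depthGE_sat (hQ : Q.FG) :
    DepthGE (pIdeal k Q (unitsFace Q)) (sdimQ Q) (AddMonoidAlgebra k (sat Q)) := by
  have h := goodRegion_sat k hQ ∅ (sat Q) (fun _ _ _ h => h.elim)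
    (fun _ hq _ hu => add_mem (le_sat Q hq) hu) (Set.empty_subset _) (Set.sdiff_empty)
  have hinj : Function.Injective (satToGroupAlg k Q) :=
    AddMonoidAlgebra.mapDomain_injective Subtype.val_injective
  refine DepthGE.of_equiv (((Submodule.quotEquivOfEqBot _ ?_).trans
    (LinearEquiv.ofEq _ _ (range_satToGroupAlg k Q).symm)).trans
    (LinearEquiv.ofInjective _ hinj).symm) h
  rw [eq_bot_iff]
  intro a ha
  refine Subtype.ext (AddMonoidAlgebra.coeff_injective (Finsupp.ext fun g => ?_))
  exact ha g (Set.notMem_empty g)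

end Saturation

end LocalCohomologyIso

/-- For `1 ≤ i < d = *dim Q`, the local cohomology modules
`H^i_m(k[Q])` and `H^{i-1}_m(C)` are isomorphic as `k[Q]`-modules, where `m = p_{F₀}` and
`C = k[sat Q]/k[Q]`. -/
theorem localCohomology_iso (k : Type) [Field k] {N : ℕ} (Q : AddSubmonoid (ZN N))
    (hQ : Q.FG) (i : ℕ) (h1 : 1 ≤ i) (h2 : i < sdimQ Q) :
    Nonempty
      ((localCohomology (pIdeal k Q (unitsFace Q)) i).obj
          (ModuleCat.of (AddMonoidAlgebra k ↥Q) (AddMonoidAlgebra k ↥Q)) ≅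
        (localCohomology (pIdeal k Q (unitsFace Q)) (i - 1)).obj
          (ModuleCat.of (AddMonoidAlgebra k ↥Q) (holeModule k Q))) := by
  obtain ⟨j, rfl⟩ := Nat.exists_eq_add_of_le' h1
  have hinj : Function.Injective
      (Algebra.linearMap (AddMonoidAlgebra k Q) (AddMonoidAlgebra k (sat Q))) :=
    AddMonoidAlgebra.mapDomain_injective (AddSubmonoid.inclusion_injective (le_sat Q))
  have hS : CategoryTheory.ShortComplex.ShortExact (CategoryTheory.ShortComplex.mk
      (ModuleCat.ofHom
        (Algebra.linearMap (AddMonoidAlgebra k Q) (AddMonoidAlgebra k (sat Q))))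
      (ModuleCat.ofHom (LinearMap.range
        (Algebra.linearMap (AddMonoidAlgebra k Q) (AddMonoidAlgebra k (sat Q)))).mkQ)
      (by
        rw [← ModuleCat.ofHom_comp, LinearMap.range_mkQ_comp]
        rfl)) :=
    ModuleCat.shortComplex_shortExact _ (fun _ => Submodule.Quotient.mk_eq_zero _)
      hinj (Submodule.mkQ_surjective _)
  exact LocalCohomologyIso.localCohomology_succ_iso _ hS
    (LocalCohomologyIso.depthGE_sat k hQ) j h2
end
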